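/- For every integer g ≥ 3, every odd integer N ≥ 1, and every finite abelian group C regarded as a trivial module over G_N = Sp_{2g}(ℤ/Nℤ), the second group cohomology H²(G_N, C) vanishes. -/

import Mathlib

open Matrix

/-- The paper's standard symplectic form matrix `J = [[0, 1_g], [-1_g, 0]]`. -/
def paperJ (l R : Type*) [DecidableEq l] [CommRing R] : Matrix (l ⊕ l) (l ⊕ l) R :=
  Matrix.fromBlocks 0 1 (-1) 0

/-- The paper's symplectic condition `ᵀM·J·M = J` (with `J = [[0, 1_g], [-1_g, 0]]`)
characterizes membership in Mathlib's `Matrix.symplecticGroup`; hence the latter *is* the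
symplectic group `Sp_{2g}(R)` of the paper. -/
theorem mem_symplecticGroup_iff_paper {l R : Type*} [DecidableEq l] [Fintype l] [CommRing R]
    (M : Matrix (l ⊕ l) (l ⊕ l) R) :
    M ∈ Matrix.symplecticGroup l R ↔ Mᵀ * paperJ l R * M = paperJ l R := by
  have hJ : paperJ l R = -(Matrix.J l R) := by
    rw [paperJ, Matrix.J, Matrix.fromBlocks_neg]; norm_num
  rw [SymplecticGroup.mem_iff', hJ]
  constructor
  · intro h; rw [Matrix.mul_neg, Matrix.neg_mul, h]
  · intro h
    have := congrArg Neg.neg h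
    simpa [Matrix.mul_neg, Matrix.neg_mul] using this

namespace SpH2

/-- The ring-theoretic properties of `ℤ/pᵏℤ`, `p` odd, that are used below. -/
class OddChainRing (R : Type*) [CommRing R] : Prop extends IsLocalRing R where
  exists_odd_cast_eq_zero : ∃ M : ℕ, Odd M ∧ (M : R) = 0
  natCast_surjective : ∀ r : R, ∃ n : ℕ, (n : R) = r
  dvd_total : ∀ a b : R, a ∣ b ∨ b ∣ a
  units_cyclic : IsCyclic Rˣ
  exists_nonsquare_add : ∃ a b : Rˣ, (a + b : R) = 1 ∧ ¬ IsSquare a ∧ ¬ IsSquare b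

/-- A group acting on a symplectic module together with lifts of all transvections along
unimodular vectors, subject to the obvious equivariance. -/
structure TransvectionSystem (R V E : Type*) [CommRing R] [AddCommGroup V] [Module R V]
    [Group E] where
  ω : V →ₗ[R] V →ₗ[R] R
  ρ : E →* (V ≃ₗ[R] V)
  tr : V → R → E
  alt : ∀ x, ω x x = 0
  ω_ρ : ∀ g x y, ω (ρ g x) (ρ g y) = ω x y
  ker_central : ∀ k, ρ k = 1 → ∀ g, g * k = k * g
  ρ_tr : ∀ x, (∃ z, IsUnit (ω x z)) → ∀ c v, ρ (tr x c) v = v + (c * ω x v) • x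
  tr_add : ∀ x, (∃ z, IsUnit (ω x z)) → ∀ c d, tr x (c + d) = tr x c * tr x d
  tr_conj : ∀ x, (∃ z, IsUnit (ω x z)) → ∀ g c, g * tr x c * g⁻¹ = tr (ρ g x) c
  tr_smul : ∀ x, (∃ z, IsUnit (ω x z)) → ∀ u : R, IsUnit u → ∀ c, tr (u • x) c = tr x (u ^ 2 * c)
  tr_add_sub : ∀ x x' y, ω x x' = 1 → (∃ z, IsUnit (ω y z)) → ω x y = 0 → ω x' y = 0 → ∀ c,
    tr (x + y) c * tr (x - y) c = tr x (2 * c) * tr y (2 * c)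

section Ring

variable {R : Type*} [CommRing R]

theorem not_isUnit_neg {a : R} (ha : ¬ IsUnit a) : ¬ IsUnit (-a) := fun h => ha (by simpa using h.neg)

variable [OddChainRing R]

theorem isUnit_two : IsUnit (2 : R) := by
  obtain ⟨M, ⟨k, hk⟩, h0⟩ := OddChainRing.exists_odd_cast_eq_zero (R := R)
  refine IsUnit.of_mul_eq_one (-(k : R)) ?_
  rw [hk] at h0
  push_cast at h0
  linear_combination -h0

theorem isUnit_add_or {a b : R} (h : IsUnit (a + b)) : IsUnit a ∨ IsUnit b :=
  IsLocalRing.isUnit_or_isUnit_of_isUnit_add h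

theorem isUnit_add_of_not {a b : R} (ha : IsUnit a) (hb : ¬ IsUnit b) : IsUnit (a + b) := by
  have : IsUnit ((a + b) + -b) := by simpa using ha
  rcases isUnit_add_or this with h | h
  · exact h
  · exact absurd (by simpa using h.neg) hb

theorem exists_units_add (c : R) : IsUnit c ∨ IsUnit (c - 1) := by
  have : IsUnit (c + -(c - 1)) := by simp
  rcases isUnit_add_or this with h | h
  · exact .inl h
  · exact .inr (by simpa using h.neg)

end Ring

namespace TransvectionSystem

variable {R V E : Type*} [CommRing R] [AddCommGroup V] [Module R V] [Group E]
  (S : TransvectionSystem R V E)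

/-- Unimodular vectors. -/
def X (x : V) : Prop := ∃ z, IsUnit (S.ω x z)

theorem skew (x y : V) : S.ω y x = - S.ω x y := by
  have h := S.alt (x + y)
  simp only [map_add, LinearMap.add_apply, S.alt] at h
  linear_combination h

variable {S}

theorem X_left {x y : V} (h : IsUnit (S.ω x y)) : S.X x := ⟨y, h⟩

theorem X_right {x y : V} (h : IsUnit (S.ω x y)) : S.X y := ⟨x, by rw [S.skew]; exact h.neg⟩

theorem X_of_one {x y : V} (h : S.ω x y = 1) : S.X x := X_left (h ▸ isUnit_one)

theorem X_of_one' {x y : V} (h : S.ω x y = 1) : S.X y := X_right (h ▸ isUnit_one)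

theorem isUnit_swap {x y : V} (h : IsUnit (S.ω x y)) : IsUnit (S.ω y x) := by
  rw [S.skew]; exact h.neg

theorem ω_swap_zero {x y : V} (h : S.ω x y = 0) : S.ω y x = 0 := by
  rw [S.skew, h, neg_zero]

theorem X.smul {x : V} (hx : S.X x) {u : R} (hu : IsUnit u) : S.X (u • x) := by
  obtain ⟨z, hz⟩ := hx
  exact ⟨z, by simpa using hu.mul hz⟩

theorem X.neg {x : V} (hx : S.X x) : S.X (-x) := by
  obtain ⟨z, hz⟩ := hx
  exact ⟨z, by simpa using hz⟩

@[simp] theorem ρ_mul_apply (g h : E) (v : V) : S.ρ (g * h) v = S.ρ g (S.ρ h v) := by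
  rw [map_mul]; rfl

theorem ρ_inv_eq {g : E} {v w : V} (h : S.ρ g v = w) : S.ρ g⁻¹ w = v := by rw [← h]; simp

theorem X.map {x : V} (hx : S.X x) (g : E) : S.X (S.ρ g x) := by
  obtain ⟨z, hz⟩ := hx
  exact ⟨S.ρ g z, by rwa [S.ω_ρ]⟩

theorem ρ_ext {g h : E} (H : ∀ v, S.ρ g v = S.ρ h v) : S.ρ g = S.ρ h := LinearEquiv.ext H

/-- Two elements with the same action differ by a central element. -/
theorem exists_ker {g h : E} (H : ∀ v, S.ρ g v = S.ρ h v) : ∃ k, S.ρ k = 1 ∧ g = h * k :=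
  ⟨h⁻¹ * g, by rw [map_mul, map_inv, ρ_ext H]; simp, by group⟩

theorem ρ_of_ker {k : E} (hk : S.ρ k = 1) (v : V) : S.ρ k v = v := by rw [hk]; rfl

theorem tr_zero {x : V} (hx : S.X x) : S.tr x 0 = 1 := by
  have := S.tr_add x hx 0 0
  simpa using this

theorem tr_neg {x : V} (hx : S.X x) (c : R) : S.tr x (-c) = (S.tr x c)⁻¹ := by
  rw [eq_inv_iff_mul_eq_one, ← S.tr_add x hx]; simp [tr_zero hx]

theorem tr_neg_vec {x : V} (hx : S.X x) (c : R) : S.tr (-x) c = S.tr x c := by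
  have := S.tr_smul x hx (-1) isUnit_one.neg c
  simpa using this

theorem conj_tr {x : V} (hx : S.X x) (g : E) (c : R) : g * S.tr x c = S.tr (S.ρ g x) c * g := by
  rw [← S.tr_conj x hx]; group

theorem tr_comm_of_fix {x : V} (hx : S.X x) {g : E} (hg : S.ρ g x = x) (c : R) :
    g * S.tr x c = S.tr x c * g := by
  rw [conj_tr hx, hg]

theorem ρ_tr' {x : V} (hx : S.X x) (c : R) (v : V) :
    S.ρ (S.tr x c) v = v + (c * S.ω x v) • x := S.ρ_tr x hx c v

theorem tr_fix {x y : V} (hx : S.X x) (h : S.ω x y = 0) (c : R) : S.ρ (S.tr x c) y = y := by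
  rw [ρ_tr' hx, h]; simp

theorem tr_comm {x y : V} (hx : S.X x) (hy : S.X y) (h : S.ω x y = 0) (c d : R) :
    S.tr x c * S.tr y d = S.tr y d * S.tr x c :=
  tr_comm_of_fix hy (tr_fix hx h c) d

theorem tr_comm_self {x : V} (hx : S.X x) (c d : R) :
    S.tr x c * S.tr x d = S.tr x d * S.tr x c := tr_comm hx hx (S.alt x) c d

theorem tr_nsmul {x : V} (hx : S.X x) (n : ℕ) (c : R) : S.tr x (n * c) = S.tr x c ^ n := by
  induction n with
  | zero => simp [tr_zero hx]
  | succ n ih => rw [Nat.cast_succ, add_mul, one_mul, S.tr_add x hx, ih, pow_succ]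

variable (S) in
/-- The subgroup generated by transvections along unimodular vectors of a submodule. -/
def EL (L : Submodule R V) : Subgroup E :=
  Subgroup.closure {g | ∃ v ∈ L, S.X v ∧ ∃ c, g = S.tr v c}

theorem tr_mem_EL {L : Submodule R V} {v : V} (hv : v ∈ L) (hX : S.X v) (c : R) :
    S.tr v c ∈ S.EL L := Subgroup.subset_closure ⟨v, hv, hX, c, rfl⟩

theorem EL_mono {L L' : Submodule R V} (h : L ≤ L') : S.EL L ≤ S.EL L' :=
  Subgroup.closure_mono fun _ ⟨v, hv, hX, c, hc⟩ => ⟨v, h hv, hX, c, hc⟩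

/-- Induction over `EL L`: a property stable under left multiplication by generators. -/
theorem EL_induction {L : Submodule R V} {p : E → Prop} (h1 : p 1)
    (hmul : ∀ v ∈ L, S.X v → ∀ c, ∀ g, p g → p (S.tr v c * g)) {g : E} (hg : g ∈ S.EL L) : p g := by
  have key : ∀ h, p h → p (g * h) := by
    induction hg using Subgroup.closure_induction'' with
    | mem g hx => obtain ⟨v, hv, hX, c, rfl⟩ := hx; exact fun h hh => hmul v hv hX c h hh
    | inv_mem g hx =>
      obtain ⟨v, hv, hX, c, rfl⟩ := hx
      intro h hh
      rw [← tr_neg hX]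
      exact hmul v hv hX _ h hh
    | one => simp
    | mul a b _ _ ha hb => intro h hh; rw [mul_assoc]; exact ha _ (hb _ hh)
  simpa using key 1 h1

theorem EL_map_mem {L : Submodule R V} {g : E} (hg : g ∈ S.EL L) {v : V} (hv : v ∈ L) :
    S.ρ g v ∈ L := by
  refine EL_induction (p := fun g => S.ρ g v ∈ L) (by simpa) (fun x hx hX c g ih => ?_) hg
  rw [ρ_mul_apply, ρ_tr' hX]
  exact L.add_mem ih (L.smul_mem _ hx)

theorem EL_fix {L : Submodule R V} {g : E} (hg : g ∈ S.EL L) {v : V}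
    (hv : ∀ x ∈ L, S.ω x v = 0) : S.ρ g v = v := by
  refine EL_induction (p := fun g => S.ρ g v = v) (by simp) (fun x hx hX c g ih => ?_) hg
  rw [ρ_mul_apply, ih, tr_fix hX (hv x hx)]

variable (S) in
/-- The orthogonal complement of two vectors. -/
def perp (e f : V) : Submodule R V := LinearMap.ker (S.ω e) ⊓ LinearMap.ker (S.ω f)

theorem mem_perp {e f v : V} : v ∈ S.perp e f ↔ S.ω e v = 0 ∧ S.ω f v = 0 := by
  simp [perp]

theorem EL_perp_fix {L : Submodule R V} {e f : V} {g : E} (hg : g ∈ S.EL (L ⊓ S.perp e f)) :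
    S.ρ g e = e ∧ S.ρ g f = f :=
  ⟨EL_fix hg fun _ hx => ω_swap_zero (mem_perp.1 hx.2).1,
    EL_fix hg fun _ hx => ω_swap_zero (mem_perp.1 hx.2).2⟩

variable (S) in
/-- Orthogonal projection onto the complement of a hyperbolic pair. -/
def proj (e f v : V) : V := v - S.ω v f • e + S.ω v e • f

theorem proj_mem {e f : V} (h : S.ω e f = 1) {L : Submodule R V} (he : e ∈ L) (hf : f ∈ L) {v : V}
    (hv : v ∈ L) : S.proj e f v ∈ L ⊓ S.perp e f := by
  refine ⟨L.add_mem (L.sub_mem hv (L.smul_mem _ he)) (L.smul_mem _ hf), mem_perp.2 ⟨?_, ?_⟩⟩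
  · simp [proj, S.alt, h, S.skew v e]
  · simp [proj, S.alt, h, S.skew v f, S.skew e f]

theorem ω_proj {e f x v : V} (hx : x ∈ S.perp e f) : S.ω x (S.proj e f v) = S.ω x v := by
  obtain ⟨h1, h2⟩ := mem_perp.1 hx
  simp [proj, ω_swap_zero h1, ω_swap_zero h2]

variable (S) in
/-- Unimodularity in `V` of a vector of `L` is witnessed in `L`. -/
def Good (L : Submodule R V) : Prop := ∀ x ∈ L, S.X x → ∃ z ∈ L, IsUnit (S.ω x z)

theorem good_top : S.Good ⊤ := fun _ _ ⟨z, hz⟩ => ⟨z, trivial, hz⟩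

theorem Good.inf_perp {L : Submodule R V} (hL : S.Good L) {e f : V} (h : S.ω e f = 1) (he : e ∈ L)
    (hf : f ∈ L) : S.Good (L ⊓ S.perp e f) := by
  intro x hx hX
  obtain ⟨z, hz, hu⟩ := hL x hx.1 hX
  exact ⟨_, proj_mem h he hf hz, by rwa [ω_proj hx.2]⟩

theorem Good.exists_one {L : Submodule R V} (hL : S.Good L) {x : V} (hx : x ∈ L) (hX : S.X x) :
    ∃ z ∈ L, S.ω x z = 1 := by
  obtain ⟨z, hz, u, hu⟩ := hL x hx hX
  exact ⟨(↑u⁻¹ : R) • z, L.smul_mem _ hz, by simp [← hu]⟩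

section Local

variable [OddChainRing R]

theorem Good.exists_nbr {L : Submodule R V} (hL : S.Good L) {x y : V} (hx : x ∈ L) (hX : S.X x)
    (hy : y ∈ L) (hY : S.X y) : ∃ w ∈ L, IsUnit (S.ω w x) ∧ IsUnit (S.ω w y) := by
  obtain ⟨u, hu, hux⟩ := hL x hx hX
  obtain ⟨v, hv, hvy⟩ := hL y hy hY
  replace hux := isUnit_swap hux
  replace hvy := isUnit_swap hvy
  by_cases h1 : IsUnit (S.ω u y)
  · exact ⟨u, hu, hux, h1⟩
  by_cases h2 : IsUnit (S.ω v x)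
  · exact ⟨v, hv, h2, hvy⟩
  refine ⟨u + v, L.add_mem hu hv, ?_, ?_⟩
  · simpa using isUnit_add_of_not hux h2
  · simpa [add_comm] using isUnit_add_of_not hvy h1

theorem Good.exists_nbr_three {L : Submodule R V} (hL : S.Good L) {x y z : V} (hx : x ∈ L)
    (hX : S.X x) (hy : y ∈ L) (hY : S.X y) (hz : z ∈ L) (hZ : S.X z) :
    ∃ w ∈ L, IsUnit (S.ω w x) ∧ IsUnit (S.ω w y) ∧ IsUnit (S.ω w z) := by
  obtain ⟨w, hw, hwx, hwy⟩ := hL.exists_nbr hx hX hy hY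
  by_cases hwz : IsUnit (S.ω w z)
  · exact ⟨w, hw, hwx, hwy, hwz⟩
  obtain ⟨u, hu, huz⟩ := hL z hz hZ
  replace huz := isUnit_swap huz
  have hp : IsUnit (S.ω (w + u) z) := by
    simpa [add_comm] using isUnit_add_of_not huz hwz
  have hm : IsUnit (S.ω (w - u) z) := by
    simpa [sub_eq_add_neg, add_comm] using isUnit_add_of_not huz.neg hwz
  by_cases hpp : IsUnit (S.ω (w + u) x) ∧ IsUnit (S.ω (w + u) y)
  · exact ⟨_, L.add_mem hw hu, hpp.1, hpp.2, hp⟩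
  by_cases hmm : IsUnit (S.ω (w - u) x) ∧ IsUnit (S.ω (w - u) y)
  · exact ⟨_, L.sub_mem hw hu, hmm.1, hmm.2, hm⟩
  -- each of `w ± u` fails at one of `x`, `y`, and they cannot fail at the same one
  have two : ∀ t, IsUnit (S.ω w t) → ¬ IsUnit (S.ω (w + u) t) → IsUnit (S.ω (w - u) t) := by
    intro t ht h
    have h2 : IsUnit (2 * S.ω w t + -(S.ω (w + u) t)) :=
      isUnit_add_of_not (isUnit_two.mul ht) (not_isUnit_neg h)
    convert h2 using 1
    simp; ring
  have unit_u : ∀ t, IsUnit (S.ω w t) → (¬ IsUnit (S.ω (w + u) t) ∨ ¬ IsUnit (S.ω (w - u) t)) →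
      IsUnit (S.ω u t) := by
    intro t ht h
    rcases h with h | h
    · have h2 := isUnit_add_of_not ht.neg h
      simpa using h2
    · have h2 := isUnit_add_of_not ht (not_isUnit_neg h)
      simpa using h2
  refine ⟨u, hu, unit_u x hwx ?_, unit_u y hwy ?_, huz⟩
  · by_contra hc
    push Not at hc
    refine hmm ⟨hc.2, two y hwy fun h => hpp ⟨hc.1, h⟩⟩
  · by_contra hc
    push Not at hc
    refine hmm ⟨two x hwx fun h => hpp ⟨h, hc.1⟩, hc.2⟩

end Local

variable (S) in
/-- The transvection carrying `x` to `y`, when `ω y x` is a unit. -/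
noncomputable def θ (y x : V) : E := S.tr (y - x) (Ring.inverse (S.ω y x))

theorem X_sub {x y : V} (h : IsUnit (S.ω y x)) : S.X (y - x) := ⟨x, by simpa [S.alt] using h⟩

theorem θ_apply {x y : V} (h : IsUnit (S.ω y x)) : S.ρ (S.θ y x) x = y := by
  rw [θ, ρ_tr' (X_sub h)]
  simp [S.alt, Ring.inverse_mul_cancel _ h]

theorem θ_inv {x y : V} (h : IsUnit (S.ω y x)) : (S.θ y x)⁻¹ = S.θ x y := by
  have h' : Ring.inverse (S.ω x y) = - Ring.inverse (S.ω y x) := by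
    obtain ⟨u, hu⟩ := h
    rw [S.skew y x, ← hu, ← Units.val_neg, Ring.inverse_unit, Ring.inverse_unit]
    simp
  rw [θ, θ, h', ← neg_sub y x, tr_neg_vec (X_sub h), tr_neg (X_sub h)]

theorem θ_conj {x y : V} (h : IsUnit (S.ω y x)) (g : E) :
    g * S.θ y x * g⁻¹ = S.θ (S.ρ g y) (S.ρ g x) := by
  rw [θ, θ, S.tr_conj _ (X_sub h), S.ω_ρ, map_sub]

theorem θ_mem {L : Submodule R V} {x y : V} (hx : x ∈ L) (hy : y ∈ L) (h : IsUnit (S.ω y x)) :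
    S.θ y x ∈ S.EL L := tr_mem_EL (L.sub_mem hy hx) (X_sub h) _

theorem Good.transitive [OddChainRing R] {L : Submodule R V} (hL : S.Good L) {x y : V} (hx : x ∈ L)
    (hX : S.X x) (hy : y ∈ L) (hY : S.X y) : ∃ g ∈ S.EL L, S.ρ g x = y := by
  obtain ⟨w, hw, hwx, hwy⟩ := hL.exists_nbr hx hX hy hY
  exact ⟨S.θ y w * S.θ w x, mul_mem (θ_mem hw hy (isUnit_swap hwy)) (θ_mem hx hw hwx), by
    rw [ρ_mul_apply, θ_apply hwx, θ_apply (isUnit_swap hwy)]⟩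

variable (S) in
/-- A Heisenberg element over `w ∈ e^⊥`. -/
def nn (e w : V) : E := S.tr (e + w) 1 * S.tr w (-1)

theorem X_add_of {e f w : V} (h : S.ω e f = 1) (hw : S.ω f w = 0) : S.X (e + w) :=
  X_of_one (y := f) (by simp [h, ω_swap_zero hw])

theorem ρ_nn {e f w : V} (h : S.ω e f = 1) (hX : S.X w) (he : S.ω e w = 0) (hf : S.ω f w = 0)
    (v : V) : S.ρ (S.nn e w) v = v + S.ω w v • e + S.ω e v • (e + w) := by
  rw [nn, ρ_mul_apply, ρ_tr' hX, ρ_tr' (X_add_of h hf)]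
  simp [S.alt, he]
  module

theorem nn_conj {e f w : V} (h : S.ω e f = 1) (hX : S.X w) (hf : S.ω f w = 0) (g : E) :
    g * S.nn e w * g⁻¹ = S.nn (S.ρ g e) (S.ρ g w) := by
  rw [nn, nn, ← map_add, ← S.tr_conj _ (X_add_of h hf), ← S.tr_conj _ hX]; group

variable (S) in
/-- The Heisenberg group attached to `e` and a submodule of `e^⊥`. -/
def HeisN (e : V) (L : Submodule R V) : Subgroup E :=
  Subgroup.closure ({g | ∃ w ∈ L, S.X w ∧ g = S.nn e w} ∪ {g | ∃ c, g = S.tr e c})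

theorem nn_mem {e w : V} {L : Submodule R V} (hw : w ∈ L) (hX : S.X w) : S.nn e w ∈ S.HeisN e L :=
  Subgroup.subset_closure (.inl ⟨w, hw, hX, rfl⟩)

theorem tr_mem_HeisN (e : V) (L : Submodule R V) (c : R) : S.tr e c ∈ S.HeisN e L :=
  Subgroup.subset_closure (.inr ⟨c, rfl⟩)

theorem HeisN_fix {e f : V} (h : S.ω e f = 1) {L : Submodule R V} {g : E}
    (hg : g ∈ S.HeisN e (L ⊓ S.perp e f)) : S.ρ g e = e := by
  induction hg using Subgroup.closure_induction with
  | mem g hx =>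
    rcases hx with ⟨w, hw, hX, rfl⟩ | ⟨c, rfl⟩
    · obtain ⟨h1, h2⟩ := mem_perp.1 hw.2
      rw [ρ_nn h hX h1 h2]
      simp [S.alt, ω_swap_zero h1]
    · exact tr_fix (X_of_one h) (S.alt e) c
  | one => simp
  | mul a b _ _ ha hb => rw [ρ_mul_apply, hb, ha]
  | inv a _ ha => exact ρ_inv_eq ha

theorem HeisN_le_EL {e f : V} (h : S.ω e f = 1) {L : Submodule R V} (he : e ∈ L) :
    S.HeisN e (L ⊓ S.perp e f) ≤ S.EL L := by
  rw [HeisN, Subgroup.closure_le]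
  rintro g (⟨w, hw, hX, rfl⟩ | ⟨c, rfl⟩)
  · exact mul_mem (tr_mem_EL (L.add_mem he hw.1) (X_add_of h (mem_perp.1 hw.2).2) _)
      (tr_mem_EL hw.1 hX _)
  · exact tr_mem_EL he (X_of_one h) _

variable (S) in
/-- Either zero or containing a hyperbolic pair. -/
def ZeroOrHyp (L : Submodule R V) : Prop := (∀ v ∈ L, v = 0) ∨ ∃ a ∈ L, ∃ b ∈ L, S.ω a b = 1

theorem heis_transitive [OddChainRing R] {L : Submodule R V} {e f f' : V} (h : S.ω e f = 1)
    (he : e ∈ L) (hf : f ∈ L) (hf' : f' ∈ L) (h' : S.ω e f' = 1)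
    (hL : S.ZeroOrHyp (L ⊓ S.perp e f)) :
    ∃ r ∈ S.HeisN e (L ⊓ S.perp e f), S.ρ r f = f' := by
  obtain ⟨w, hw, β, hβ⟩ : ∃ w ∈ L ⊓ S.perp e f, ∃ β : R, f' = f + w + β • e := by
    refine ⟨S.proj e f f', proj_mem h he hf hf', S.ω f' f, ?_⟩
    rw [proj, S.skew e f', h']
    module
  have key : ∃ r ∈ S.HeisN e (L ⊓ S.perp e f), ∃ γ : R, S.ρ r f = f + w + γ • e := by
    by_cases hX : S.X w
    · obtain ⟨h1, h2⟩ := mem_perp.1 hw.2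
      refine ⟨_, nn_mem hw hX, 1, ?_⟩
      rw [ρ_nn h hX h1 h2, ω_swap_zero h2, h]
      module
    rcases hL with h0 | ⟨a, ha, b, hb, hab⟩
    · exact ⟨1, one_mem _, 0, by simp [h0 w hw]⟩
    · have hXa : S.X (w + a) := by
        refine ⟨b, ?_⟩
        rw [map_add, LinearMap.add_apply, hab, add_comm]
        exact isUnit_add_of_not isUnit_one fun hu => hX ⟨b, hu⟩
      have hwa := Submodule.add_mem _ hw ha
      have hna := Submodule.neg_mem _ ha
      obtain ⟨h1, h2⟩ := mem_perp.1 hwa.2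
      obtain ⟨h3, h4⟩ := mem_perp.1 hna.2
      refine ⟨_, mul_mem (nn_mem hna (X_of_one hab).neg) (nn_mem hwa hXa), ?_⟩
      rw [ρ_mul_apply, ρ_nn h hXa h1 h2, ω_swap_zero h2, h, ρ_nn h (X_of_one hab).neg h3 h4]
      have h5 : S.ω e (f + (0 : R) • e + (1 : R) • (e + (w + a))) = 1 := by
        have : S.ω e (w + a) = 0 := h1
        simp only [map_add, map_smul, h, S.alt, this]; simp
      rw [h5]
      exact ⟨S.ω (-a) (f + (0 : R) • e + (1 : R) • (e + (w + a))) + 2, by module⟩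
  obtain ⟨r, hr, γ, hγ⟩ := key
  refine ⟨S.tr e (β - γ) * r, mul_mem (tr_mem_HeisN _ _ _) hr, ?_⟩
  rw [ρ_mul_apply, hγ, ρ_tr' (X_of_one h), hβ]
  have h5 : S.ω e (f + w + γ • e) = 1 := by
    simp [h, S.alt, (mem_perp.1 hw.2).1]
  rw [h5]
  module

end TransvectionSystem
end SpH2

namespace SpH2

/-- Two root subgroups in a group satisfying the rank one Steinberg relations, with commuting
torus elements. -/
structure RankOne {R E : Type*} [CommRing R] [Group E] (x y : R → E) : Prop where
  x_add : ∀ c d, x (c + d) = x c * x d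
  y_add : ∀ c d, y (c + d) = y c * y d
  conj_x : ∀ (u : Rˣ) c, (x u * y (-↑u⁻¹) * x u) * x c = y (-(c * (↑u⁻¹) ^ 2)) * (x u * y (-↑u⁻¹) * x u)
  conj_y : ∀ (u : Rˣ) c, (x u * y (-↑u⁻¹) * x u) * y c = x (-(c * (↑u) ^ 2)) * (x u * y (-↑u⁻¹) * x u)
  torus_comm : ∀ u v : Rˣ, Commute ((x u * y (-↑u⁻¹) * x u) * (x (-1) * y 1 * x (-1)))
    ((x v * y (-↑v⁻¹) * x v) * (x (-1) * y 1 * x (-1)))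

namespace RankOne

variable {R E : Type*} [CommRing R] [Group E] {x y : R → E} (H : RankOne x y)

/-- Weyl elements. -/
def w (x y : R → E) (u : Rˣ) : E := x u * y (-↑u⁻¹) * x u

/-- Torus elements. -/
def t (x y : R → E) (u : Rˣ) : E := w x y u * w x y (-1)

include H

theorem x_zero : x 0 = 1 := by simpa using H.x_add 0 0

theorem y_zero : y 0 = 1 := by simpa using H.y_add 0 0

theorem x_neg (c : R) : x (-c) = (x c)⁻¹ := by
  rw [eq_inv_iff_mul_eq_one, ← H.x_add]; simp [H.x_zero]

theorem y_neg (c : R) : y (-c) = (y c)⁻¹ := by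
  rw [eq_inv_iff_mul_eq_one, ← H.y_add]; simp [H.y_zero]

theorem w_x (u : Rˣ) (c : R) : w x y u * x c = y (-(c * (↑u⁻¹) ^ 2)) * w x y u := H.conj_x u c

theorem w_y (u : Rˣ) (c : R) : w x y u * y c = x (-(c * (↑u) ^ 2)) * w x y u := H.conj_y u c

theorem t_comm (u v : Rˣ) : t x y u * t x y v = t x y v * t x y u := by
  have := H.torus_comm u v
  simpa [t, w] using this.eq

theorem w_neg (u : Rˣ) : w x y (-u) = (w x y u)⁻¹ := by
  simp [w, H.x_neg, H.y_neg, mul_assoc]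

theorem w_alt (u : Rˣ) : w x y u = y (-↑u⁻¹) * x u * y (-↑u⁻¹) := by
  have h1 := H.w_x u u
  have h2 := H.w_y u (-↑u⁻¹)
  have e1 : -((u : R) * (↑u⁻¹) ^ 2) = -↑u⁻¹ := by simp [pow_two]
  have e2 : -(-(↑u⁻¹ : R) * (↑u) ^ 2) = u := by simp [pow_two]
  rw [e1] at h1
  rw [e2] at h2
  have : w x y u * w x y u = (y (-↑u⁻¹) * x u * y (-↑u⁻¹)) * w x y u := by
    nth_rw 2 [w]
    calc w x y u * (x u * y (-↑u⁻¹) * x u) = (w x y u * x u) * y (-↑u⁻¹) * x u := by group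
      _ = y (-↑u⁻¹) * (w x y u * y (-↑u⁻¹)) * x u := by rw [h1]; group
      _ = y (-↑u⁻¹) * x u * (w x y u * x u) := by rw [h2]; group
      _ = _ := by rw [h1]; group
  exact mul_right_cancel this

theorem w_w (u v : Rˣ) : w x y u * w x y v = w x y (u ^ 2 * v⁻¹) * w x y u := by
  have e1 : -((v : R) * (↑u⁻¹) ^ 2) = -↑(u ^ 2 * v⁻¹)⁻¹ := by
    simp [mul_comm]
  have e2 : -(-(↑v⁻¹ : R) * (↑u) ^ 2) = ↑(u ^ 2 * v⁻¹) := by simp [mul_comm]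
  rw [H.w_alt (u ^ 2 * v⁻¹), ← e1, ← e2]
  nth_rw 2 [w]
  calc w x y u * (x v * y (-↑v⁻¹) * x v) = (w x y u * x v) * y (-↑v⁻¹) * x v := by group
    _ = y (-(v * (↑u⁻¹) ^ 2)) * (w x y u * y (-↑v⁻¹)) * x v := by rw [H.w_x]; group
    _ = y (-(v * (↑u⁻¹) ^ 2)) * x (-(-↑v⁻¹ * (↑u) ^ 2)) * (w x y u * x v) := by
        rw [H.w_y]; group
    _ = _ := by rw [H.w_x]; group

theorem w_eq (u : Rˣ) : w x y u = t x y u * w x y 1 := by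
  rw [t, H.w_neg 1]; group

theorem t_x (u : Rˣ) (c : R) : t x y u * x c = x (u ^ 2 * c) * t x y u := by
  rw [t, mul_assoc, H.w_x, ← mul_assoc, H.w_y, mul_assoc]
  congr 2
  simp [mul_comm]

theorem t_y (u : Rˣ) (c : R) : t x y u * y c = y ((↑u⁻¹) ^ 2 * c) * t x y u := by
  rw [t, mul_assoc, H.w_y, ← mul_assoc, H.w_x, mul_assoc]
  congr 2
  simp [mul_comm]

theorem t_w (u v : Rˣ) : t x y u * w x y v = w x y (u ^ 2 * v) * t x y u := by
  have e2 : (↑u⁻¹ : R) ^ 2 * -↑v⁻¹ = -↑(u ^ 2 * v)⁻¹ := by simp [mul_comm]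
  have e1 : (↑u : R) ^ 2 * v = ↑(u ^ 2 * v) := by simp
  rw [w, w, ← mul_assoc, ← mul_assoc, H.t_x, mul_assoc (x _) (t x y u), H.t_y, mul_assoc (x _),
    mul_assoc (y _), H.t_x, e1, e2]
  group

theorem t_sq_mul (u v : Rˣ) : t x y (u ^ 2 * v) = t x y (u ^ 2) * t x y v := by
  have h1 : t x y u * t x y v = w x y (u ^ 2 * v) * w x y (u ^ 2 * -1) * t x y u := by
    nth_rw 2 [t]
    rw [← mul_assoc, H.t_w, mul_assoc, H.t_w, mul_assoc]
  have h2 : w x y (u ^ 2 * -1) = w x y (-1) * (t x y (u ^ 2))⁻¹ := by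
    rw [t, mul_neg_one, H.w_neg, H.w_neg]; group
  rw [h2, ← mul_assoc, ← t, H.t_comm u v, mul_left_inj] at h1
  rw [H.t_comm, h1]; group

theorem w_one_t (b : Rˣ) : w x y 1 * t x y b = t x y b⁻¹ * w x y 1 := by
  rw [t, ← mul_assoc, H.w_w, mul_assoc, H.w_w, t]
  simp [mul_assoc]

theorem w_mul_w (u v : Rˣ) : w x y u * w x y v = t x y u * t x y v⁻¹ * (w x y 1 * w x y 1) := by
  rw [H.w_eq u, H.w_eq v, mul_assoc, ← mul_assoc (w x y 1), H.w_one_t]; group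

theorem t_one : t x y 1 = 1 := by rw [t, H.w_neg]; group

theorem y_unit (c : Rˣ) : y c = x ↑c⁻¹ * w x y (-c⁻¹) * x ↑c⁻¹ := by
  simp [w, H.x_neg, mul_assoc]

theorem t_mul_of_add_eq_one {a b : Rˣ} (hab : (a + b : R) = 1) :
    t x y (a * b) = t x y a * t x y b := by
  have e0 : (↑a⁻¹ : R) + ↑b⁻¹ = ↑(a * b)⁻¹ := by
    have ha : (↑a⁻¹ : R) * a = 1 := by simp
    have hb : (↑b⁻¹ : R) * b = 1 := by simp
    rw [mul_inv, Units.val_mul]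
    linear_combination (↑a⁻¹ * ↑b⁻¹ : R) * hab - (↑b⁻¹ : R) * ha - (↑a⁻¹ : R) * hb
  have h0 : y (-↑(a * b)⁻¹) = y (-↑a⁻¹) * y (-↑b⁻¹) := by
    rw [← H.y_add, ← e0]; congr 1; ring
  have yw : ∀ u : Rˣ, y (-↑u⁻¹) = x (-u) * w x y u * x (-u) := by
    intro u; simp [w, H.x_neg, mul_assoc]
  have h1 : w x y a * x (-1) * w x y b = x (a ^ 2) * w x y (a * b) * x (b ^ 2) := by
    rw [yw, yw a, yw b] at h0
    have e1 : (a : R) ^ 2 = a + -↑(a * b) := by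
      rw [Units.val_mul]; linear_combination (a : R) * hab
    have e2 : (b : R) ^ 2 = -↑(a * b) + b := by
      rw [Units.val_mul]; linear_combination (b : R) * hab
    have e3 : (-1 : R) = -a + -b := by linear_combination hab
    rw [e1, e2, e3, H.x_add a, H.x_add _ (b : R), H.x_add (-a : R)]
    calc _ = x a * (x (-a) * w x y a * x (-a) * (x (-b) * w x y b * x (-b))) * x b := by
          rw [H.x_neg, H.x_neg]; group
      _ = _ := by rw [← h0]; group
  have h2 : w x y a * w x y b = w x y (a ^ 2) * w x y (a * b) := by
    have e1 : -(-1 * (↑a⁻¹ : R) ^ 2) = (↑a⁻¹ : R) ^ 2 := by ring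
    have e2 : (b : R) ^ 2 * (↑(a * b)⁻¹) ^ 2 = (↑a⁻¹ : R) ^ 2 := by
      rw [← mul_pow]; congr 1; rw [← Units.val_mul]; congr 1; group
    rw [H.w_x, e1, mul_assoc (x _), H.w_x, e2] at h1
    have e3 : (↑a⁻¹ : R) ^ 2 = ↑(a ^ 2)⁻¹ := by simp
    rw [e3] at h1
    rw [H.w_alt (a ^ 2), Units.val_pow_eq_pow_val]
    calc _ = (y (↑(a ^ 2)⁻¹))⁻¹ * (y (↑(a ^ 2)⁻¹) * w x y a * w x y b) := by group
      _ = _ := by rw [h1, H.y_neg]; group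
  rw [H.w_mul_w a b, H.w_mul_w (a ^ 2), mul_left_inj, ← H.t_sq_mul] at h2
  have e1 : b⁻¹ = b⁻¹ ^ 2 * b := by group
  have e2 : a ^ 2 * (a * b)⁻¹ = b⁻¹ ^ 2 * (a * b) := by
    rw [mul_inv, pow_two, pow_two]
    simp [mul_assoc, mul_comm]
  have e3 : t x y b⁻¹ = t x y (b⁻¹ ^ 2) * t x y b := by
    nth_rw 1 [e1]; exact H.t_sq_mul _ _
  rw [e2, e3, H.t_sq_mul, ← mul_assoc, H.t_comm a, mul_assoc, mul_right_inj] at h2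
  exact h2.symm

theorem t_mul [OddChainRing R] (u v : Rˣ) : t x y (u * v) = t x y u * t x y v := by
  have sqmul : ∀ u v : Rˣ, IsSquare u → t x y (u * v) = t x y u * t x y v := by
    rintro _ v ⟨r, rfl⟩
    rw [← pow_two]; exact H.t_sq_mul r v
  have mulsq : ∀ u v : Rˣ, IsSquare v → t x y (u * v) = t x y u * t x y v := by
    intro u v hv
    rw [mul_comm, sqmul v u hv, H.t_comm]
  have hdiv : ∀ a b : Rˣ, ¬ IsSquare a → ¬ IsSquare b → ∃ s, IsSquare s ∧ a = b * s := by
    obtain ⟨g, hg⟩ := (OddChainRing.units_cyclic (R := R)).exists_generator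
    intro a b ha hb
    obtain ⟨i, rfl⟩ := hg a
    obtain ⟨j, rfl⟩ := hg b
    refine ⟨g ^ (i - j), ?_, by simp [← _root_.zpow_add]⟩
    have odd : ∀ k : ℤ, ¬ IsSquare (g ^ k) → Odd k := by
      intro k hk
      by_contra hc
      rw [Int.not_odd_iff_even] at hc
      obtain ⟨r, rfl⟩ := hc
      exact hk ⟨g ^ r, _root_.zpow_add g r r⟩
    obtain ⟨r, hr⟩ := (odd i ha).sub_odd (odd j hb)
    exact ⟨g ^ r, by rw [hr, _root_.zpow_add]⟩
  by_cases hu : IsSquare u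
  · exact sqmul u v hu
  by_cases hv : IsSquare v
  · exact mulsq u v hv
  obtain ⟨a, b, hab, ha, hb⟩ := OddChainRing.exists_nonsquare_add (R := R)
  obtain ⟨s, hs, rfl⟩ := hdiv u a hu ha
  obtain ⟨r, hr, rfl⟩ := hdiv v b hv hb
  rw [mul_mul_mul_comm, mulsq _ _ (hs.mul hr), H.t_mul_of_add_eq_one hab, mulsq a _ hs, mulsq b _ hr,
    sqmul _ _ hs]
  have := H.t_comm b s
  calc t x y a * t x y b * (t x y s * t x y r) = t x y a * (t x y b * t x y s) * t x y r := by group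
    _ = _ := by rw [this]; group

/-- The two big cell forms of a group element whose first column is `(α, γ)`. -/
def Cell (x y : R → E) (g : E) (α γ : R) : Prop :=
  (∀ c : Rˣ, (c : R) = γ → ∃ d, g = x (α * ↑c⁻¹) * w x y (-c⁻¹) * x d) ∧
  (∀ a : Rˣ, (a : R) = α → ∃ d, g = y (γ * ↑a⁻¹) * t x y a * x d)

variable [OddChainRing R]

theorem w_mul_t (v a : Rˣ) : w x y v * t x y a = w x y (v * a⁻¹) := by
  rw [H.w_eq, mul_assoc, H.w_one_t, ← mul_assoc, ← H.t_mul, ← H.w_eq]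

theorem w_mul_w_inv (v c : Rˣ) : w x y v * w x y (-c⁻¹) = t x y (v * c) := by
  have h1 : w x y 1 * w x y 1 = t x y (-1) := by
    have : t x y (-1) * t x y (-1) = 1 := by rw [← H.t_mul]; simp [H.t_one]
    rw [eq_inv_of_mul_eq_one_left this, t, H.w_neg, _root_.mul_inv_rev, inv_inv]
  rw [H.w_mul_w, h1, ← H.t_mul, ← H.t_mul]
  congr 1
  simp [← inv_neg]

theorem cell_w {g : E} {α γ : R} (hc : Cell x y g α γ) (v : Rˣ) :
    Cell x y (w x y v * g) (v * γ) (-(↑v⁻¹ * α)) := by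
  constructor
  · intro c hcc
    have ha : (↑(-(v * c)) : R) = α := by
      rw [Units.val_neg, Units.val_mul, hcc]; simp
    obtain ⟨d, rfl⟩ := hc.2 _ ha
    refine ⟨d, ?_⟩
    rw [← mul_assoc, ← mul_assoc, H.w_y, mul_assoc (x _), H.w_mul_t]
    congr 3
    · rw [inv_neg, mul_inv, Units.val_neg, Units.val_mul]
      have : (↑v⁻¹ : R) * v = 1 := by simp
      linear_combination (γ * ↑c⁻¹ * v) * this
    · rw [inv_neg, mul_inv]; simp
  · intro a haa
    have hcc : (↑(v⁻¹ * a) : R) = γ := by rw [Units.val_mul, haa]; simp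
    obtain ⟨d, rfl⟩ := hc.1 _ hcc
    refine ⟨d, ?_⟩
    rw [← mul_assoc, ← mul_assoc, H.w_x, mul_assoc (y _), H.w_mul_w_inv]
    congr 3
    · rw [mul_inv, Units.val_mul, inv_inv]
      have : (↑v⁻¹ : R) * v = 1 := by simp
      linear_combination (-α * ↑a⁻¹ * ↑v⁻¹) * this
    · simp

theorem cell_convert (a c : Rˣ) (d : R) :
    ∃ d', x (a * ↑c⁻¹) * w x y (-c⁻¹) * x d = y (c * ↑a⁻¹) * t x y a * x d' := by
  refine ⟨-((↑a⁻¹) ^ 2 * (a * ↑c⁻¹)) + d, ?_⟩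
  have h := H.y_unit (c * a⁻¹)
  have e1 : ((c * a⁻¹)⁻¹ : Rˣ) = a * c⁻¹ := by group
  rw [Units.val_mul, e1, Units.val_mul] at h
  have h2 : x ((a : R) * ↑c⁻¹) * t x y a = t x y a * x ((↑a⁻¹) ^ 2 * (a * ↑c⁻¹)) := by
    rw [H.t_x]; congr 2
    rw [← mul_assoc, ← mul_pow]; simp
  rw [h, mul_assoc (x _ * w x y _), h2, ← mul_assoc, mul_assoc (x _) (w x y _) (t x y _), H.w_mul_t,
    H.x_add, H.x_neg]
  have e3 : -(a * c⁻¹) * a⁻¹ = -c⁻¹ := by rw [neg_mul]; congr 1; rw [mul_comm, inv_mul_cancel_left]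
  rw [e3]
  group

theorem cell_x {g : E} {α γ : R} (hu : IsUnit α ∨ IsUnit γ) (hc : Cell x y g α γ) (c : Rˣ) :
    Cell x y (x c * g) (α + c * γ) γ := by
  have first : ∀ b : Rˣ, (b : R) = γ → ∃ d, x c * g = x ((α + c * γ) * ↑b⁻¹) * w x y (-b⁻¹) * x d := by
    intro b hb
    obtain ⟨d, rfl⟩ := hc.1 b hb
    refine ⟨d, ?_⟩
    rw [add_mul, add_comm, H.x_add, ← hb]
    simp [mul_assoc]
  refine ⟨first, fun a ha => ?_⟩
  by_cases hγ : IsUnit γ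
  · obtain ⟨b, hb⟩ := hγ
    obtain ⟨d, hd⟩ := first b hb
    rw [hd, ← ha, ← hb]
    exact H.cell_convert a b d
  obtain ⟨α', rfl⟩ := hu.resolve_right hγ
  obtain ⟨d, rfl⟩ := hc.2 α' rfl
  obtain ⟨z, hz⟩ : ∃ z : Rˣ, z = a * α'⁻¹ := ⟨_, rfl⟩
  have hz' : (z : R) = 1 + c * (γ * ↑α'⁻¹) := by
    rw [hz, Units.val_mul, ha]
    have : (↑α'⁻¹ : R) * α' = 1 := by simp
    linear_combination this
  have hy : y (γ * ↑α'⁻¹) = y (-↑c⁻¹) * y ↑(z * c⁻¹) := by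
    rw [← H.y_add]; congr 1
    rw [Units.val_mul, hz']
    have : (↑c⁻¹ : R) * c = 1 := by simp
    linear_combination (-γ * ↑α'⁻¹) * this
  have hxy : x c * y (-↑c⁻¹) = w x y c * x (-c) := by simp [w, H.x_neg]
  have h1 : x c * y (γ * ↑α'⁻¹) = y (γ * ↑a⁻¹) * t x y z * x ↑(z * c⁻¹)⁻¹ := by
    rw [hy, H.y_unit, ← mul_assoc, hxy]
    have h2 : w x y c * x (-c) * (x ↑(z * c⁻¹)⁻¹ * w x y (-(z * c⁻¹)⁻¹) * x ↑(z * c⁻¹)⁻¹) =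
      w x y c * x (-c + ↑(z * c⁻¹)⁻¹) * w x y (-(z * c⁻¹)⁻¹) * x ↑(z * c⁻¹)⁻¹ := by
      rw [H.x_add]; group
    rw [h2, H.w_x, mul_assoc (y _), H.w_mul_w_inv]
    congr 3
    · have e1 : (↑(z * c⁻¹)⁻¹ : R) = c * ↑z⁻¹ := by rw [← Units.val_mul, mul_inv, inv_inv, mul_comm]
      have e2 : (↑a⁻¹ : R) = ↑z⁻¹ * ↑α'⁻¹ := by
        rw [← Units.val_mul, hz, mul_inv, inv_inv, mul_inv_cancel_right]
      have e3 : (↑c⁻¹ : R) * c = 1 := by simp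
      have e4 : (↑z⁻¹ : R) * z = 1 := by simp
      rw [e1, e2]
      rw [hz'] at e4
      linear_combination (↑c⁻¹ : R) * (1 - ↑z⁻¹) * e3 + (γ * ↑α'⁻¹ * ↑z⁻¹) * e3 - (↑c⁻¹ : R) * e4
    · rw [mul_comm z]; simp
  refine ⟨(↑α'⁻¹) ^ 2 * ↑(z * c⁻¹)⁻¹ + d, ?_⟩
  have h3 : t x y a = t x y z * t x y α' := by rw [← H.t_mul, hz]; congr 1; simp
  have h4 : t x y α' * x ((↑α'⁻¹) ^ 2 * ↑(z * c⁻¹)⁻¹) = x ↑(z * c⁻¹)⁻¹ * t x y α' := by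
    rw [H.t_x]; congr 2
    rw [← mul_assoc, ← mul_pow]; simp
  rw [← mul_assoc, ← mul_assoc, h1, h3, H.x_add]
  calc _ = y (γ * ↑a⁻¹) * t x y z * (x ↑(z * c⁻¹)⁻¹ * t x y α') * x d := by group
    _ = _ := by rw [← h4]; group

theorem cell_y {g : E} {α γ : R} (hu : IsUnit α ∨ IsUnit γ) (hc : Cell x y g α γ) (c : Rˣ) :
    Cell x y (y c * g) α (γ + c * α) := by
  have key : ∀ {α γ : R}, IsUnit γ ∨ IsUnit α → ∀ d : R, IsUnit (α + d * γ) ∨ IsUnit γ := by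
    intro α γ h d
    by_cases hγ : IsUnit γ
    · exact .inr hγ
    · exact .inl (isUnit_add_of_not (h.resolve_left hγ) fun h => hγ (isUnit_of_mul_isUnit_right h))
  have h1 := H.cell_x hu hc c⁻¹
  have h2 := H.cell_w h1 (-c⁻¹)
  have hu1 := key hu.symm (↑c⁻¹ : R)
  have hu2 : IsUnit ((↑(-c⁻¹) : R) * γ) ∨ IsUnit (-((↑(-c⁻¹)⁻¹ : R) * (α + ↑c⁻¹ * γ))) := by
    rcases hu1 with h | h
    · right; rw [IsUnit.neg_iff]; exact (Units.isUnit _).mul h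
    · left; exact (Units.isUnit _).mul h
  have h3 := H.cell_x hu2 h2 c⁻¹
  convert h3 using 1
  · rw [H.y_unit]; group
  all_goals
    have e : (↑c⁻¹ : R) * c = 1 := by simp
    simp only [inv_neg, inv_inv, Units.val_neg]
  · linear_combination (-α - ↑c⁻¹ * γ) * e
  · linear_combination -γ * e

end RankOne

namespace TransvectionSystem

open RankOne

variable {R V E : Type*} [CommRing R] [AddCommGroup V] [Module R V] [Group E]
  {S : TransvectionSystem R V E}

theorem eq_add_proj (m m' v : V) : v = S.ω v m' • m + (-S.ω v m) • m' + S.proj m m' v := by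
  rw [proj]; module

section

variable {m m' : V} (h : S.ω m m' = 1)
include h

theorem ρ_x_m' (c : R) : S.ρ (S.tr m c) m' = m' + c • m := by
  rw [ρ_tr' (X_of_one h), h, mul_one]

theorem ρ_y_m (c : R) : S.ρ (S.tr m' (-c)) m = m + c • m' := by
  rw [ρ_tr' (X_of_one' h), S.skew m m', h]; simp

theorem ρ_w_m (u : Rˣ) : S.ρ (w (S.tr m) (fun c => S.tr m' (-c)) u) m = -((↑u⁻¹ : R) • m') := by
  simp only [w, ρ_mul_apply]
  rw [tr_fix (X_of_one h) (S.alt m), ρ_y_m h, map_add, map_smul, tr_fix (X_of_one h) (S.alt m),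
    ρ_x_m' h, smul_add, smul_smul]
  simp

theorem ρ_w_m' (u : Rˣ) : S.ρ (w (S.tr m) (fun c => S.tr m' (-c)) u) m' = (u : R) • m := by
  simp only [w, ρ_mul_apply]
  rw [ρ_x_m' h, map_add, map_smul, ρ_y_m h, tr_fix (X_of_one' h) (S.alt m'), smul_add, smul_smul]
  simp only [mul_neg, Units.mul_inv, map_add, map_smul]
  rw [tr_fix (X_of_one h) (S.alt m), ρ_x_m' h]
  module

theorem ρ_w_perp (u : Rˣ) {v : V} (h1 : S.ω m v = 0) (h2 : S.ω m' v = 0) :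
    S.ρ (w (S.tr m) (fun c => S.tr m' (-c)) u) v = v := by
  simp only [w, ρ_mul_apply, tr_fix (X_of_one h) h1, tr_fix (X_of_one' h) h2]

theorem rankOne [OddChainRing R] : RankOne (S.tr m) (fun c => S.tr m' (-c)) := by
  have hm := X_of_one h
  have hm' := X_of_one' h
  have t_m : ∀ u, S.ρ (t (S.tr m) (fun c => S.tr m' (-c)) u) m = (u : R) • m := by
    intro u
    rw [t, ρ_mul_apply, ρ_w_m h]
    simp [ρ_w_m' h]
  have t_m' : ∀ u, S.ρ (t (S.tr m) (fun c => S.tr m' (-c)) u) m' = (↑u⁻¹ : R) • m' := by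
    intro u
    rw [t, ρ_mul_apply, ρ_w_m' h]
    simp [ρ_w_m h]
  have t_p : ∀ u v, v ∈ S.perp m m' → S.ρ (t (S.tr m) (fun c => S.tr m' (-c)) u) v = v := by
    intro u v hv
    obtain ⟨h1, h2⟩ := mem_perp.1 hv
    rw [t, ρ_mul_apply, ρ_w_perp h _ h1 h2, ρ_w_perp h _ h1 h2]
  have t_mul : ∀ u u', S.ρ (t (S.tr m) (fun c => S.tr m' (-c)) (u * u')) =
      S.ρ (t (S.tr m) (fun c => S.tr m' (-c)) u * t (S.tr m) (fun c => S.tr m' (-c)) u') := by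
    intro u u'
    refine ρ_ext fun v => ?_
    have hp : S.proj m m' v ∈ S.perp m m' := (proj_mem h (L := ⊤) trivial trivial trivial).2
    rw [eq_add_proj (S := S) m m' v]
    simp only [map_add, map_smul, ρ_mul_apply, t_m, t_m', t_p _ _ hp]
    simp [smul_smul, mul_comm]
  have conj_x : ∀ (u : Rˣ) c, w (S.tr m) (fun c => S.tr m' (-c)) u * S.tr m c =
      S.tr m' (- -(c * (↑u⁻¹) ^ 2)) * w (S.tr m) (fun c => S.tr m' (-c)) u := by
    intro u c
    rw [conj_tr hm, ρ_w_m h, tr_neg_vec (hm'.smul (Units.isUnit _)),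
      S.tr_smul _ hm' _ (Units.isUnit _), neg_neg, mul_comm c]
  have conj_y : ∀ (u : Rˣ) c, w (S.tr m) (fun c => S.tr m' (-c)) u * S.tr m' (-c) =
      S.tr m (-(c * (↑u) ^ 2)) * w (S.tr m) (fun c => S.tr m' (-c)) u := by
    intro u c
    rw [conj_tr hm', ρ_w_m' h, S.tr_smul _ hm _ (Units.isUnit _), mul_neg, mul_comm c]
  refine ⟨S.tr_add m hm, fun c d => ?_, conj_x, conj_y, ?_⟩
  · simp only [neg_add, S.tr_add m' hm']
  · intro u v
    have e : ∀ u : Rˣ, (S.tr m u * S.tr m' (- -(↑u⁻¹ : R)) * S.tr m u) *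
        (S.tr m (-1) * S.tr m' (-1) * S.tr m (-1)) = t (S.tr m) (fun c => S.tr m' (-c)) u := by
      intro u; simp [t, w]
    rw [e, e]
    obtain ⟨g, hg⟩ := (OddChainRing.units_cyclic (R := R)).exists_generator
    obtain ⟨φ, hφ⟩ : ∃ φ : Rˣ →* (V ≃ₗ[R] V),
        ∀ u, φ u = S.ρ (t (S.tr m) (fun c => S.tr m' (-c)) u) :=
      ⟨MonoidHom.mk' (fun u => S.ρ (t (S.tr m) (fun c => S.tr m' (-c)) u))
        fun u u' => (t_mul u u').trans (map_mul S.ρ _ _), fun u => rfl⟩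
    have hk : ∀ u, ∃ i : ℤ, ∃ k, S.ρ k = 1 ∧ t (S.tr m) (fun c => S.tr m' (-c)) u =
        t (S.tr m) (fun c => S.tr m' (-c)) g ^ i * k := by
      intro u
      obtain ⟨i, rfl⟩ := hg u
      refine ⟨i, exists_ker fun v => ?_⟩
      rw [← hφ, map_zpow, map_zpow, hφ]
    obtain ⟨i, k, hk1, hi⟩ := hk u
    obtain ⟨j, l, hl1, hj⟩ := hk v
    rw [hi, hj]
    have hkc : ∀ g, Commute k g := fun g => (S.ker_central k hk1 g).symm
    have hlc : ∀ g, Commute g l := fun g => S.ker_central l hl1 g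
    exact (((Commute.refl _).zpow_zpow _ _).mul_right (hlc _)).mul_left (hkc _)

/-- In the rank one subgroup, the stabilizer of `m` is the root subgroup of `m`. -/
theorem rankOne_stab [OddChainRing R] {g : E} (hg : g ∈ S.EL (Submodule.span R {m, m'}))
    (hgm : S.ρ g m = m) : ∃ c, g = S.tr m c := by
  have H := rankOne h
  have hm := X_of_one h
  have hm' := X_of_one' h
  set y : R → E := fun c => S.tr m' (-c) with hy
  let p : E → Prop := fun g => ∃ α γ : R, (IsUnit α ∨ IsUnit γ) ∧ S.ρ g m = α • m + γ • m' ∧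
    Cell (S.tr m) y g α γ
  have key : ∀ {α γ : R}, IsUnit γ ∨ IsUnit α → ∀ d : R, IsUnit (α + d * γ) ∨ IsUnit γ := by
    intro α γ h d
    by_cases hγ : IsUnit γ
    · exact .inr hγ
    · exact .inl (isUnit_add_of_not (h.resolve_left hγ) fun h => hγ (isUnit_of_mul_isUnit_right h))
  have px : ∀ (c : Rˣ) g, p g → p (S.tr m c * g) := by
    rintro c g ⟨α, γ, hu, hg, hc⟩
    refine ⟨_, _, key hu.symm c, ?_, H.cell_x hu hc c⟩
    rw [ρ_mul_apply, hg, map_add, map_smul, map_smul, tr_fix hm (S.alt m), ρ_x_m' h]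
    module
  have py : ∀ (c : Rˣ) g, p g → p (y c * g) := by
    rintro c g ⟨α, γ, hu, hg, hc⟩
    refine ⟨_, _, (key hu c).symm, ?_, H.cell_y hu hc c⟩
    rw [ρ_mul_apply, hg, map_add, map_smul, map_smul, tr_fix hm' (S.alt m'), ρ_y_m h]
    module
  have split : ∀ c : R, ∃ a b : R, c = a + b ∧ (IsUnit a ∧ (IsUnit b ∨ b = 0)) := by
    intro c
    rcases exists_units_add c with h | h
    · exact ⟨c, 0, by simp, h, .inr rfl⟩
    · exact ⟨1, c - 1, by ring, isUnit_one, .inl h⟩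
  have px' : ∀ (c : R) g, p g → p (S.tr m c * g) := by
    intro c g hg
    obtain ⟨a, b, rfl, ⟨a, rfl⟩, ⟨b, rfl⟩ | rfl⟩ := split c
    · rw [S.tr_add m hm, mul_assoc]; exact px _ _ (px _ _ hg)
    · rw [add_zero]; exact px _ _ hg
  have py' : ∀ (c : R) g, p g → p (y c * g) := by
    intro c g hg
    obtain ⟨a, b, rfl, ⟨a, rfl⟩, ⟨b, rfl⟩ | rfl⟩ := split c
    · rw [H.y_add, mul_assoc]; exact py _ _ (py _ _ hg)
    · rw [add_zero]; exact py _ _ hg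
  have hp : p g := by
    refine EL_induction ?_ ?_ hg
    · refine ⟨1, 0, .inl isUnit_one, by simp, ?_, ?_⟩
      · exact fun c hc => ⟨0, absurd hc c.ne_zero⟩
      · intro a ha
        have : a = 1 := Units.ext ha
        subst this
        exact ⟨0, by simp [H.t_one, H.y_zero, H.x_zero]⟩
    · intro v hv hX c g hg
      obtain ⟨α, γ, rfl⟩ := Submodule.mem_span_pair.1 hv
      have hu : IsUnit α ∨ IsUnit γ := by
        obtain ⟨z, hz⟩ := hX
        simp only [map_add, map_smul, LinearMap.add_apply, LinearMap.smul_apply, smul_eq_mul] at hz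
        exact (isUnit_add_or hz).imp isUnit_of_mul_isUnit_left isUnit_of_mul_isUnit_left
      rcases hu with ⟨u, rfl⟩ | ⟨u, rfl⟩
      · have e : S.tr ((u : R) • m + γ • m') c =
            y (γ * ↑u⁻¹) * S.tr m (u ^ 2 * c) * y (-(γ * ↑u⁻¹)) := by
          rw [H.y_neg, hy, S.tr_conj _ hm, ρ_y_m h, ← S.tr_smul _ (hm.map _ |> fun h' => by
            rwa [ρ_y_m h] at h') _ u.isUnit]
          congr 1
          rw [smul_add, smul_smul, mul_left_comm]; simp
        rw [e, mul_assoc, mul_assoc]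
        exact py' _ _ (px' _ _ (py' _ _ hg))
      · have e : S.tr (α • m + (u : R) • m') c =
            S.tr m (α * ↑u⁻¹) * y (-(u ^ 2 * c)) * S.tr m (-(α * ↑u⁻¹)) := by
          rw [tr_neg hm, hy]
          simp only [neg_neg]
          rw [S.tr_conj _ hm', ρ_x_m' h, ← S.tr_smul _ (hm'.map _ |> fun h' => by
            rwa [ρ_x_m' h] at h') _ u.isUnit]
          congr 1
          rw [smul_add, smul_smul, mul_left_comm, add_comm]; simp
        rw [e, mul_assoc, mul_assoc]
        exact px' _ _ (py' _ _ (px' _ _ hg))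
  obtain ⟨α, γ, -, hαγ, hc⟩ := hp
  rw [hgm] at hαγ
  have h1 : α = 1 := by
    have := congrArg (fun v => S.ω v m') hαγ
    simpa [h, S.alt] using this.symm
  have h2 : γ = 0 := by
    have := congrArg (fun v => S.ω m v) hαγ
    simpa [h, S.alt] using this.symm
  subst h1 h2
  obtain ⟨d, hd⟩ := hc.2 1 (by simp)
  exact ⟨d, by simpa [H.t_one, H.y_zero] using hd⟩

end
end TransvectionSystem
end SpH2

namespace SpH2
namespace TransvectionSystem

variable {R V E : Type*} [CommRing R] [AddCommGroup V] [Module R V] [Group E]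
  {S : TransvectionSystem R V E}

variable (S) in
/-- The subgroup generated by transvections along vectors of `L` orthogonal to `x`. -/
def SL (L : Submodule R V) (x : V) : Subgroup E :=
  Subgroup.closure {g | ∃ v ∈ L, S.X v ∧ S.ω v x = 0 ∧ ∃ c, g = S.tr v c}

theorem tr_mem_SL {L : Submodule R V} {x v : V} (hv : v ∈ L) (hX : S.X v) (h : S.ω v x = 0) (c : R) :
    S.tr v c ∈ S.SL L x := Subgroup.subset_closure ⟨v, hv, hX, h, c, rfl⟩

theorem SL_conj {L : Submodule R V} {x y : V} {g : E} (hg : g ∈ S.EL L) (hxy : S.ρ g x = y) {s : E}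
    (hs : s ∈ S.SL L x) : g * s * g⁻¹ ∈ S.SL L y := by
  induction hs using Subgroup.closure_induction with
  | mem s h =>
    obtain ⟨v, hv, hX, h0, c, rfl⟩ := h
    rw [S.tr_conj v hX]
    exact tr_mem_SL (EL_map_mem hg hv) (hX.map g) (by rw [← hxy, S.ω_ρ, h0]) c
  | one => simp
  | mul a b _ _ ha hb => convert mul_mem ha hb using 1; group
  | inv a _ ha => convert inv_mem ha using 1; group

theorem SL_conj_inv {L : Submodule R V} {x y : V} {g : E} (hg : g ∈ S.EL L) (hxy : S.ρ g x = y)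
    {s : E} (hs : s ∈ S.SL L y) : g⁻¹ * s * g ∈ S.SL L x := by
  simpa using SL_conj (inv_mem hg) (ρ_inv_eq hxy) hs

variable (S) in
/-- The coset of elements carrying `x` to `y` along a path of length two in `L`. -/
def D (L : Submodule R V) (y x : V) (g : E) : Prop :=
  ∀ z ∈ L, IsUnit (S.ω z x) → IsUnit (S.ω z y) → (S.θ y z * S.θ z x)⁻¹ * g ∈ S.SL L x

theorem D_one {L : Submodule R V} {x : V} : S.D L x x 1 := by
  intro z _ zx _
  rw [← θ_inv zx]; simp

variable [OddChainRing R]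

theorem triangle_of_isUnit {L : Submodule R V} {x y z : V} (hx : x ∈ L) (hy : y ∈ L) (hz : z ∈ L)
    (ha : IsUnit (S.ω x y)) (hb : IsUnit (S.ω y z)) (hc : IsUnit (S.ω z x))
    (hs : IsUnit (S.ω x y + S.ω y z + S.ω z x)) :
    S.θ x z * S.θ z y * S.θ y x ∈ S.SL L x := by
  obtain ⟨s, hs⟩ := hs
  obtain ⟨a, ha'⟩ := ha
  have sσ : (s : R) * ↑s⁻¹ = 1 := by simp
  have aι : (a : R) * ↑a⁻¹ = 1 := by simp
  have e1 := S.skew x y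
  have e2 := S.skew y z
  have e3 := S.skew z x
  obtain ⟨m, hm⟩ : ∃ m, m = (-(S.ω x y + S.ω z x) * ↑s⁻¹) • (y - x) +
      (-(a : R) * ↑s⁻¹) • (z - y) := ⟨_, rfl⟩
  obtain ⟨m', hm'⟩ : ∃ m', m' = (↑a⁻¹ : R) • (y - x) := ⟨_, rfl⟩
  have hmm : S.ω m m' = 1 := by
    simp only [hm, hm', map_add, map_sub, map_smul, LinearMap.add_apply, LinearMap.sub_apply,
      LinearMap.smul_apply, smul_eq_mul, S.alt, e1, e2]
    rw [← ha'] at hs ⊢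
    linear_combination ((a : R) * ↑a⁻¹) * (↑s⁻¹ : R) * (-hs) + sσ * ((a : R) * ↑a⁻¹) + aι
  have hmx : S.ω m x = 0 := by
    simp only [hm, map_add, map_sub, map_smul, LinearMap.add_apply, LinearMap.sub_apply,
      LinearMap.smul_apply, smul_eq_mul, S.alt, e1]
    rw [← ha']
    ring
  have d1 : y - x ∈ Submodule.span R {m, m'} := by
    refine Submodule.mem_span_pair.2 ⟨0, a, ?_⟩
    rw [hm', smul_smul, aι]; simp
  have d2 : z - y ∈ Submodule.span R {m, m'} := by
    have : z - y = (-(↑a⁻¹ : R) * s) • m + (-(↑a⁻¹ : R) * s) • ((S.ω x y + S.ω z x) * ↑s⁻¹) • (y - x) := by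
      have e : (-(↑a⁻¹ : R) * s) * (-(a : R) * ↑s⁻¹) = 1 := by
        linear_combination (a : R) * ↑a⁻¹ * sσ + aι
      calc z - y = ((-(↑a⁻¹ : R) * s) * (-(a : R) * ↑s⁻¹)) • (z - y) := by rw [e, one_smul]
        _ = _ := by rw [hm]; module
    rw [this]
    exact Submodule.add_mem _ (Submodule.smul_mem _ _ (Submodule.subset_span (by simp)))
      (Submodule.smul_mem _ _ (Submodule.smul_mem _ _ d1))
  have hg : S.θ x z * S.θ z y * S.θ y x ∈ S.EL (Submodule.span R {m, m'}) := by
    refine mul_mem (mul_mem (tr_mem_EL ?_ (X_sub (isUnit_swap hc)) _)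
      (tr_mem_EL d2 (X_sub (isUnit_swap hb)) _)) (tr_mem_EL d1 (X_sub (isUnit_swap ⟨a, ha'⟩)) _)
    have : x - z = -((y - x) + (z - y)) := by abel
    rw [this]
    exact Submodule.neg_mem _ (Submodule.add_mem _ d1 d2)
  have hgx : S.ρ (S.θ x z * S.θ z y * S.θ y x) x = x := by
    rw [ρ_mul_apply, ρ_mul_apply, θ_apply (isUnit_swap ⟨a, ha'⟩), θ_apply (isUnit_swap hb),
      θ_apply (isUnit_swap hc)]
  have hm'x : S.ω m' (x - m) = 0 := by
    rw [map_sub, S.skew m m', hmm, hm']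
    simp only [map_sub, map_smul, LinearMap.sub_apply, LinearMap.smul_apply, smul_eq_mul, S.alt, e1]
    rw [← ha']
    linear_combination -aι
  have hgm : S.ρ (S.θ x z * S.θ z y * S.θ y x) m = m := by
    have h1 : S.ρ (S.θ x z * S.θ z y * S.θ y x) (x - m) = x - m := by
      refine EL_fix hg fun v hv => ?_
      obtain ⟨p, q, rfl⟩ := Submodule.mem_span_pair.1 hv
      have : S.ω m (x - m) = 0 := by rw [map_sub, hmx, S.alt, sub_zero]
      simp [this, hm'x]
    rw [map_sub, hgx] at h1
    exact sub_right_injective h1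
  obtain ⟨c, hc⟩ := rankOne_stab hmm hg hgm
  rw [hc]
  refine tr_mem_SL ?_ (X_of_one hmm) hmx c
  rw [hm]
  exact L.add_mem (L.smul_mem _ (L.sub_mem hy hx)) (L.smul_mem _ (L.sub_mem hz hy))

theorem triangle {L : Submodule R V} {x y z : V} (hx : x ∈ L) (hy : y ∈ L) (hz : z ∈ L)
    (ha : IsUnit (S.ω x y)) (hb : IsUnit (S.ω y z)) (hc : IsUnit (S.ω z x)) :
    S.θ x z * S.θ z y * S.θ y x ∈ S.SL L x := by
  by_cases hs : IsUnit (S.ω x y + S.ω y z + S.ω z x)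
  · exact triangle_of_isUnit hx hy hz ha hb hc hs
  obtain ⟨a, ha'⟩ := id ha
  have aι : (a : R) * ↑a⁻¹ = 1 := by simp
  obtain ⟨w, hw⟩ : ∃ w, w = (↑a⁻¹ : R) • (x - y) := ⟨_, rfl⟩
  have hwL : w ∈ L := hw ▸ L.smul_mem _ (L.sub_mem hx hy)
  have hs' : ¬ IsUnit (↑a⁻¹ * (S.ω x y + S.ω y z + S.ω z x)) := fun h =>
    hs (isUnit_of_mul_isUnit_right h)
  have wx : S.ω w x = 1 := by
    simp [hw, S.alt, S.skew x y, ← ha']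
  have wy : S.ω w y = 1 := by
    simp [hw, S.alt, ← ha']
  have wz' : S.ω w z = 1 + -(↑a⁻¹ * (S.ω x y + S.ω y z + S.ω z x)) := by
    simp only [hw, map_sub, map_smul, LinearMap.sub_apply, LinearMap.smul_apply, smul_eq_mul, S.skew z x,
      ← ha']
    linear_combination aι
  have wz : IsUnit (S.ω w z) := by
    rw [wz']; exact isUnit_add_of_not isUnit_one (not_isUnit_neg hs')
  have uwx : IsUnit (S.ω w x) := wx ▸ isUnit_one
  have uwy : IsUnit (S.ω w y) := wy ▸ isUnit_one
  have t1 : S.θ x w * S.θ w y * S.θ y x ∈ S.SL L x := by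
    refine triangle_of_isUnit hx hy hwL ha (isUnit_swap uwy) uwx ?_
    rw [S.skew w y, wx, wy]; simpa
  have t2 : S.θ y w * S.θ w z * S.θ z y ∈ S.SL L y := by
    refine triangle_of_isUnit hy hz hwL hb (isUnit_swap wz) uwy ?_
    rw [S.skew w z, wz', wy]
    convert isUnit_add_of_not hb hs' using 1
    ring
  have t3 : S.θ z w * S.θ w x * S.θ x z ∈ S.SL L z := by
    refine triangle_of_isUnit hz hx hwL hc (isUnit_swap uwx) wz ?_
    rw [S.skew w x, wz', wx]
    convert isUnit_add_of_not hc (not_isUnit_neg hs') using 1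
    ring
  have q : S.θ x w * S.θ w z ∈ S.EL L := mul_mem (θ_mem hwL hx (isUnit_swap uwx)) (θ_mem hz hwL wz)
  have q' : S.θ x w * S.θ w y ∈ S.EL L := mul_mem (θ_mem hwL hx (isUnit_swap uwx)) (θ_mem hy hwL uwy)
  have t3' := SL_conj q (by rw [ρ_mul_apply, θ_apply wz, θ_apply (isUnit_swap uwx)]) t3
  have t2' := SL_conj q' (by rw [ρ_mul_apply, θ_apply uwy, θ_apply (isUnit_swap uwx)]) t2
  convert mul_mem (mul_mem t3' t2') t1 using 1
  rw [← θ_inv uwx, ← θ_inv uwy, ← θ_inv wz]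
  group

theorem two_path_of_nbr {L : Submodule R V} {x y z w : V} (hx : x ∈ L) (hy : y ∈ L) (hz : z ∈ L)
    (hw : w ∈ L) (zx : IsUnit (S.ω z x)) (zy : IsUnit (S.ω z y)) (wx : IsUnit (S.ω w x))
    (wy : IsUnit (S.ω w y)) (wz : IsUnit (S.ω w z)) :
    (S.θ y w * S.θ w x)⁻¹ * (S.θ y z * S.θ z x) ∈ S.SL L x := by
  have t1 : S.θ x w * S.θ w z * S.θ z x ∈ S.SL L x :=
    triangle hx hz hw (isUnit_swap zx) (isUnit_swap wz) wx
  have t2 : S.θ z w * S.θ w y * S.θ y z ∈ S.SL L z :=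
    triangle hz hy hw zy (isUnit_swap wy) wz
  have t2' := SL_conj_inv (θ_mem hx hz zx) (θ_apply zx) t2
  convert mul_mem t1 t2' using 1
  rw [← θ_inv wx, ← θ_inv wz, ← θ_inv (isUnit_swap wy)]
  group

theorem four_cycle {L : Submodule R V} (hL : S.Good L) {x y z z' : V} (hx : x ∈ L) (hy : y ∈ L)
    (hz : z ∈ L) (hz' : z' ∈ L) (zx : IsUnit (S.ω z x)) (zy : IsUnit (S.ω z y))
    (zx' : IsUnit (S.ω z' x)) (zy' : IsUnit (S.ω z' y)) :
    (S.θ y z' * S.θ z' x)⁻¹ * (S.θ y z * S.θ z x) ∈ S.SL L x := by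
  by_cases hxy : IsUnit (S.ω x y)
  · have t1 : S.θ x y * S.θ y z * S.θ z x ∈ S.SL L x :=
      triangle hx hz hy (isUnit_swap zx) zy (isUnit_swap hxy)
    have t2 : S.θ x y * S.θ y z' * S.θ z' x ∈ S.SL L x :=
      triangle hx hz' hy (isUnit_swap zx') zy' (isUnit_swap hxy)
    convert mul_mem (inv_mem t2) t1 using 1
    group
  obtain ⟨w, hw, wx, wy, wz, wz'⟩ : ∃ w ∈ L, IsUnit (S.ω w x) ∧ IsUnit (S.ω w y) ∧
      IsUnit (S.ω w z) ∧ IsUnit (S.ω w z') := by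
    obtain ⟨w, hw, wx, wy, wz⟩ := hL.exists_nbr_three hx (X_right zx) hy (X_right zy) hz (X_left zx)
    by_cases wz' : IsUnit (S.ω w z')
    · exact ⟨w, hw, wx, wy, wz, wz'⟩
    by_cases hp : IsUnit (S.ω (w + x) z)
    · refine ⟨w + x, L.add_mem hw hx, by simpa [S.alt], ?_, hp, ?_⟩
      · simpa using isUnit_add_of_not wy hxy
      · simpa [add_comm] using isUnit_add_of_not (isUnit_swap zx') wz'
    · refine ⟨w - x, L.sub_mem hw hx, by simpa [S.alt], ?_, ?_, ?_⟩
      · simpa [sub_eq_add_neg] using isUnit_add_of_not wy (not_isUnit_neg hxy)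
      · have := isUnit_add_of_not (isUnit_two.mul wz) (not_isUnit_neg hp)
        convert this using 1
        simp; ring
      · simpa [sub_eq_add_neg, add_comm] using isUnit_add_of_not (isUnit_swap zx').neg wz'
  have t1 := two_path_of_nbr hx hy hz hw zx zy wx wy wz
  have t2 := two_path_of_nbr hx hy hz' hw zx' zy' wx wy wz'
  convert mul_mem (inv_mem t2) t1 using 1
  group

theorem D_of_exists {L : Submodule R V} (hL : S.Good L) {x y z : V} {g : E} (hx : x ∈ L) (hy : y ∈ L)
    (hz : z ∈ L) (zx : IsUnit (S.ω z x)) (zy : IsUnit (S.ω z y))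
    (h : (S.θ y z * S.θ z x)⁻¹ * g ∈ S.SL L x) : S.D L y x g := by
  intro z' hz' zx' zy'
  convert mul_mem (four_cycle hL hx hy hz hz' zx zy zx' zy') h using 1
  group

theorem D_mul {L : Submodule R V} (hL : S.Good L) {x y z : V} {g g' : E} (hx : x ∈ L) (hX : S.X x)
    (hy : y ∈ L) (hY : S.X y) (hz : z ∈ L) (hZ : S.X z) (h' : S.D L z y g') (h : S.D L y x g) :
    S.D L z x (g' * g) := by
  obtain ⟨w, hw, wx, wy, wz⟩ := hL.exists_nbr_three hx hX hy hY hz hZ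
  refine D_of_exists hL hx hz hw wx wz ?_
  have t1 := h w hw wx wy
  have t2 := h' w hw wy wz
  have t2' := SL_conj_inv (mul_mem (θ_mem hw hy (isUnit_swap wy)) (θ_mem hx hw wx))
    (by rw [ρ_mul_apply, θ_apply wx, θ_apply (isUnit_swap wy)]) t2
  convert mul_mem t2' t1 using 1
  rw [← θ_inv wy]
  group

theorem D_θ {L : Submodule R V} {x y : V} (hx : x ∈ L) (hy : y ∈ L)
    (h : IsUnit (S.ω y x)) : S.D L y x (S.θ y x) := by
  intro z hz zx zy
  convert triangle hx hy hz (isUnit_swap h) (isUnit_swap zy) zx using 1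
  rw [← θ_inv zx, ← θ_inv zy]; group

theorem D_tr {L : Submodule R V} (hL : S.Good L) {x v : V} (hx : x ∈ L) (hX : S.X x) (hv : v ∈ L)
    (hV : S.X v) (c : R) : S.D L (S.ρ (S.tr v c) x) x (S.tr v c) := by
  have T_mem : ∀ c, ∀ x ∈ L, S.ρ (S.tr v c) x ∈ L := fun c x hx =>
    EL_map_mem (tr_mem_EL hv hV c) hx
  have direct : ∀ c : R, IsUnit c → ∀ x ∈ L, IsUnit (S.ω v x) →
      S.D L (S.ρ (S.tr v c) x) x (S.tr v c) := by
    intro c hc x hx hvx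
    have hT : S.ρ (S.tr v c) x = x + (c * S.ω v x) • v := ρ_tr' hV c x
    have hy : IsUnit (S.ω (S.ρ (S.tr v c) x) x) := by
      rw [hT]; simpa [S.alt] using (hc.mul hvx).mul hvx
    have e : S.θ (S.ρ (S.tr v c) x) x = S.tr v c := by
      rw [θ, hT, add_sub_cancel_left, S.tr_smul v hV _ (hc.mul hvx)]
      congr 1
      have h2 := hy
      rw [hT] at h2
      have e2 : S.ω (x + (c * S.ω v x) • v) x = c * S.ω v x * S.ω v x := by simp [S.alt]
      rw [e2] at h2 ⊢
      have h3 := Ring.mul_inverse_cancel _ h2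
      linear_combination c * h3
    have := D_θ hx (T_mem c x hx) hy
    rwa [e] at this
  have unit : ∀ c : R, IsUnit c → ∀ x ∈ L, S.X x → S.D L (S.ρ (S.tr v c) x) x (S.tr v c) := by
    intro c hc x hx hX
    obtain ⟨z, hz, zx, zv⟩ := hL.exists_nbr hx hX hv hV
    have h1 := D_θ hx hz zx
    have h2 := direct c hc z hz (isUnit_swap zv)
    have h3 := D_θ (T_mem c z hz) (T_mem c x hx)
      (by rw [S.ω_ρ]; exact isUnit_swap zx : IsUnit (S.ω (S.ρ (S.tr v c) x) (S.ρ (S.tr v c) z)))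
    have h4 := D_mul hL hx hX (T_mem c z hz) ((X_left zx).map _) (T_mem c x hx) (hX.map _) h3
      (D_mul hL hx hX hz (X_left zx) (T_mem c z hz) ((X_left zx).map _) h2 h1)
    rw [← θ_conj (isUnit_swap zx), ← θ_inv zx] at h4
    convert h4 using 1
    group
  rcases exists_units_add c with h | h
  · exact unit c h x hx hX
  · have e : S.tr v c = S.tr v 1 * S.tr v (c - 1) := by rw [← S.tr_add v hV]; congr 1; ring
    rw [e, ρ_mul_apply]
    exact D_mul hL hx hX (T_mem _ _ hx) (hX.map _) (T_mem _ _ (T_mem _ _ hx)) ((hX.map _).map _)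
      (unit 1 isUnit_one _ (T_mem _ _ hx) (hX.map _)) (unit _ h x hx hX)

/-- The stabilizer of a unimodular vector `e` in `EL L` is generated by the transvections along
vectors orthogonal to `e`. -/
theorem mem_SL_of_fix {L : Submodule R V} (hL : S.Good L) {e : V} (he : e ∈ L) (hE : S.X e) {g : E}
    (hg : g ∈ S.EL L) (hge : S.ρ g e = e) : g ∈ S.SL L e := by
  have key : S.ρ g e ∈ L ∧ S.X (S.ρ g e) ∧ S.D L (S.ρ g e) e g := by
    refine EL_induction (p := fun g => S.ρ g e ∈ L ∧ S.X (S.ρ g e) ∧ S.D L (S.ρ g e) e g)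
      ⟨by simpa, by simpa, by simpa using D_one⟩ ?_ hg
    rintro v hv hV c g ⟨h1, h2, h3⟩
    have h4 := D_tr hL h1 h2 hv hV c
    rw [ρ_mul_apply]
    have h5 := EL_map_mem (tr_mem_EL hv hV c) h1
    exact ⟨h5, h2.map _, D_mul hL he hE h1 h2 h5 (h2.map _) h4 h3⟩
  rw [hge] at key
  obtain ⟨z, hz, hez⟩ := hL e he hE
  have := key.2.2 z hz (isUnit_swap hez) (isUnit_swap hez)
  rw [← θ_inv (isUnit_swap hez)] at this
  simpa using this

end TransvectionSystem
end SpH2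

namespace SpH2
namespace TransvectionSystem

open RankOne

variable {R V E : Type*} [CommRing R] [AddCommGroup V] [Module R V] [Group E]
  {S : TransvectionSystem R V E}

variable (S) in
/-- `L` is an orthogonal sum of `n` hyperbolic planes. -/
def HasRank : ℕ → Submodule R V → Prop
  | 0, L => ∀ v ∈ L, v = 0
  | n + 1, L => ∃ e ∈ L, ∃ f ∈ L, S.ω e f = 1 ∧ HasRank n (L ⊓ S.perp e f)

theorem HasRank.zeroOrHyp {n : ℕ} {L : Submodule R V} (h : S.HasRank n L) : S.ZeroOrHyp L := by
  cases n with
  | zero => exact .inl h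
  | succ n =>
    obtain ⟨e, he, f, hf, hef, -⟩ := h
    exact .inr ⟨e, he, f, hf, hef⟩

variable (S) in
/-- There are three mutually orthogonal hyperbolic pairs. -/
structure ThreePairs (e₀ f₀ e₁ f₁ e₂ f₂ : V) : Prop where
  h₀ : S.ω e₀ f₀ = 1
  h₁ : S.ω e₁ f₁ = 1
  h₂ : S.ω e₂ f₂ = 1
  e₁_mem : e₁ ∈ S.perp e₀ f₀
  f₁_mem : f₁ ∈ S.perp e₀ f₀
  e₂_mem : e₂ ∈ S.perp e₀ f₀
  f₂_mem : f₂ ∈ S.perp e₀ f₀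
  e₂_mem' : e₂ ∈ S.perp e₁ f₁
  f₂_mem' : f₂ ∈ S.perp e₁ f₁

theorem map_mem_perp {e f v : V} (g : E) (h : v ∈ S.perp e f) :
    S.ρ g v ∈ S.perp (S.ρ g e) (S.ρ g f) := by
  rw [mem_perp] at h ⊢; rwa [S.ω_ρ, S.ω_ρ]

theorem ThreePairs.map {e₀ f₀ e₁ f₁ e₂ f₂ : V} (T : S.ThreePairs e₀ f₀ e₁ f₁ e₂ f₂) (g : E) :
    S.ThreePairs (S.ρ g e₀) (S.ρ g f₀) (S.ρ g e₁) (S.ρ g f₁) (S.ρ g e₂) (S.ρ g f₂) where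
  h₀ := by rw [S.ω_ρ, T.h₀]
  h₁ := by rw [S.ω_ρ, T.h₁]
  h₂ := by rw [S.ω_ρ, T.h₂]
  e₁_mem := map_mem_perp g T.e₁_mem
  f₁_mem := map_mem_perp g T.f₁_mem
  e₂_mem := map_mem_perp g T.e₂_mem
  f₂_mem := map_mem_perp g T.f₂_mem
  e₂_mem' := map_mem_perp g T.e₂_mem'
  f₂_mem' := map_mem_perp g T.f₂_mem'

theorem perp_symm {e f a b : V} (ha : a ∈ S.perp e f) (hb : b ∈ S.perp e f) : e ∈ S.perp a b :=
  mem_perp.2 ⟨ω_swap_zero (mem_perp.1 ha).1, ω_swap_zero (mem_perp.1 hb).1⟩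

theorem perp_symm' {e f a b : V} (ha : a ∈ S.perp e f) (hb : b ∈ S.perp e f) : f ∈ S.perp a b :=
  mem_perp.2 ⟨ω_swap_zero (mem_perp.1 ha).2, ω_swap_zero (mem_perp.1 hb).2⟩

section

variable [OddChainRing R]

/-- Witt transitivity on one hyperbolic pair. -/
theorem exists_map_pair {e₀ f₀ e₁ f₁ e₂ f₂ : V} (T : S.ThreePairs e₀ f₀ e₁ f₁ e₂ f₂) {e f : V}
    (h : S.ω e f = 1) : ∃ g ∈ S.EL ⊤, S.ρ g e₀ = e ∧ S.ρ g f₀ = f := by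
  obtain ⟨g, hg, rfl⟩ := good_top.transitive (S := S) (x := e₀) (y := e) trivial (X_of_one T.h₀)
    trivial (X_of_one h)
  have T' := T.map g
  obtain ⟨r, hr, hrf⟩ := heis_transitive (L := ⊤) T'.h₀ trivial trivial (f' := f) trivial h
    (.inr ⟨_, ⟨trivial, T'.e₁_mem⟩, _, ⟨trivial, T'.f₁_mem⟩, T'.h₁⟩)
  exact ⟨r * g, mul_mem (HeisN_le_EL (L := ⊤) T'.h₀ trivial hr) hg, by rw [ρ_mul_apply, HeisN_fix T'.h₀ hr],
    by rw [ρ_mul_apply, hrf]⟩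

/-- Witt transitivity on two orthogonal hyperbolic pairs. -/
theorem exists_map_pairs {e₀ f₀ e₁ f₁ e₂ f₂ : V} (T : S.ThreePairs e₀ f₀ e₁ f₁ e₂ f₂) {e f a b : V}
    (h : S.ω e f = 1) (hab : S.ω a b = 1) (ha : a ∈ S.perp e f) (hb : b ∈ S.perp e f) :
    ∃ g ∈ S.EL ⊤, S.ρ g e₀ = e ∧ S.ρ g f₀ = f ∧ S.ρ g e₁ = a ∧ S.ρ g f₁ = b := by
  obtain ⟨g, hg, rfl, rfl⟩ := exists_map_pair T h
  have T' := T.map g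
  have hL := good_top.inf_perp T'.h₀ trivial trivial
  obtain ⟨g', hg', rfl⟩ := hL.transitive ⟨trivial, T'.e₁_mem⟩ (X_of_one T'.h₁) ⟨trivial, ha⟩
    (X_of_one hab)
  have T'' := T'.map g'
  obtain ⟨i1, i2⟩ := EL_perp_fix hg'
  rw [i1, i2] at T''
  have hr0 : S.ZeroOrHyp (⊤ ⊓ S.perp (S.ρ g e₀) (S.ρ g f₀) ⊓
      S.perp (S.ρ g' (S.ρ g e₁)) (S.ρ g' (S.ρ g f₁))) :=
    .inr ⟨_, ⟨⟨trivial, T''.e₂_mem⟩, T''.e₂_mem'⟩, _, ⟨⟨trivial, T''.f₂_mem⟩, T''.f₂_mem'⟩, T''.h₂⟩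
  obtain ⟨r, hr, hrf⟩ := heis_transitive (L := ⊤ ⊓ S.perp (S.ρ g e₀) (S.ρ g f₀)) T''.h₁
    ⟨trivial, T''.e₁_mem⟩ ⟨trivial, T''.f₁_mem⟩ (f' := b) ⟨trivial, hb⟩ hab hr0
  have hrE := HeisN_le_EL T''.h₁ (L := ⊤ ⊓ S.perp (S.ρ g e₀) (S.ρ g f₀)) ⟨trivial, T''.e₁_mem⟩ hr
  obtain ⟨j1, j2⟩ := EL_perp_fix hrE
  refine ⟨r * (g' * g), mul_mem (EL_mono le_top hrE) (mul_mem (EL_mono le_top hg') hg), ?_, ?_, ?_, ?_⟩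
  · rw [ρ_mul_apply, ρ_mul_apply, i1, j1]
  · rw [ρ_mul_apply, ρ_mul_apply, i2, j2]
  · rw [ρ_mul_apply, ρ_mul_apply, HeisN_fix T''.h₁ hr]
  · rw [ρ_mul_apply, ρ_mul_apply, hrf]

theorem exists_second_pair {e₀ f₀ e₁ f₁ e₂ f₂ : V} (T : S.ThreePairs e₀ f₀ e₁ f₁ e₂ f₂) {e f : V}
    (h : S.ω e f = 1) : ∃ a ∈ S.perp e f, ∃ b ∈ S.perp e f, S.ω a b = 1 := by
  obtain ⟨g, -, rfl, rfl⟩ := exists_map_pair T h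
  exact ⟨_, (T.map g).e₁_mem, _, (T.map g).f₁_mem, (T.map g).h₁⟩

theorem exists_third_pair {e₀ f₀ e₁ f₁ e₂ f₂ : V} (T : S.ThreePairs e₀ f₀ e₁ f₁ e₂ f₂) {e f a b : V}
    (h : S.ω e f = 1) (hab : S.ω a b = 1) (ha : a ∈ S.perp e f) (hb : b ∈ S.perp e f) :
    ∃ e' f', S.ThreePairs e f a b e' f' := by
  obtain ⟨g, -, rfl, rfl, rfl, rfl⟩ := exists_map_pairs T h hab ha hb
  exact ⟨_, _, T.map g⟩

/-- Elements of `E` stabilizing `L` act on `L` like elements of `EL L`. -/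
theorem exists_mem_EL_of_stab {n : ℕ} {L : Submodule R V} (hn : S.HasRank n L) (hL : S.Good L) {g : E}
    (hg : ∀ v ∈ L, S.ρ g v ∈ L) : ∃ h ∈ S.EL L, ∀ v ∈ L, S.ρ g v = S.ρ h v := by
  induction n generalizing L g with
  | zero => exact ⟨1, one_mem _, fun v hv => by simp [hn v hv]⟩
  | succ n ih =>
    obtain ⟨e, he, f, hf, hef, hn'⟩ := hn
    obtain ⟨h₁, hh₁, h₁e⟩ := hL.transitive he (X_of_one hef) (hg e he) ((X_of_one hef).map g)
    have hf' : S.ρ (h₁⁻¹ * g) f ∈ L := by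
      rw [ρ_mul_apply]; exact EL_map_mem (inv_mem hh₁) (hg f hf)
    have he' : S.ρ (h₁⁻¹ * g) e = e := by rw [ρ_mul_apply, ← h₁e]; simp
    obtain ⟨r, hr, hrf⟩ := heis_transitive hef he hf hf' (by
      nth_rw 1 [← he']; rw [S.ω_ρ, hef]) hn'.zeroOrHyp
    have hrE := HeisN_le_EL hef he hr
    have hre := HeisN_fix hef hr
    obtain ⟨k, hk⟩ : ∃ k, k = r⁻¹ * (h₁⁻¹ * g) := ⟨_, rfl⟩
    have hke : S.ρ k e = e := by rw [hk, ρ_mul_apply, he']; exact ρ_inv_eq hre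
    have hkf : S.ρ k f = f := by rw [hk, ρ_mul_apply]; exact ρ_inv_eq hrf
    obtain ⟨h₂, hh₂, H⟩ := ih hn' (hL.inf_perp hef he hf) (g := k) (by
      intro v hv
      refine ⟨?_, ?_⟩
      · rw [hk, ρ_mul_apply, ρ_mul_apply]
        exact EL_map_mem (inv_mem hrE) (EL_map_mem (inv_mem hh₁) (hg v hv.1))
      · have := map_mem_perp k hv.2
        rwa [hke, hkf] at this)
    refine ⟨h₁ * r * h₂, mul_mem (mul_mem hh₁ hrE) (EL_mono inf_le_left hh₂), fun v hv => ?_⟩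
    have hgk : g = h₁ * r * k := by rw [hk]; group
    rw [hgk, ρ_mul_apply, ρ_mul_apply _ h₂]
    congr 1
    rw [eq_add_proj (S := S) e f v]
    obtain ⟨i1, i2⟩ := EL_perp_fix hh₂
    simp only [map_add, map_smul, hke, hkf, i1, i2, H _ (proj_mem hef he hf hv)]

end

/-- An element of the rank one subgroup acting by `-1` on the plane. -/
theorem exists_neg {m m' : V} (h : S.ω m m' = 1) :
    ∃ j, S.ρ j m = -m ∧ ∀ v ∈ S.perp m m', S.ρ j v = v := by
  refine ⟨w (S.tr m) (fun c => S.tr m' (-c)) 1 * w (S.tr m) (fun c => S.tr m' (-c)) 1, ?_, ?_⟩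
  · rw [ρ_mul_apply, ρ_w_m h]; simp [ρ_w_m' h]
  · intro v hv
    obtain ⟨h1, h2⟩ := mem_perp.1 hv
    rw [ρ_mul_apply, ρ_w_perp h _ h1 h2, ρ_w_perp h _ h1 h2]

variable (S) in
/-- `h` acts as an element of the Heisenberg group at `e` lying over `w`. -/
def Over (e : V) (h : E) (w : V) : Prop :=
  ∃ c : R, ∀ v, S.ρ h v = v + S.ω w v • e + S.ω e v • (w + c • e)

theorem over_nn {e f w : V} (h : S.ω e f = 1) (hX : S.X w) (hw : w ∈ S.perp e f) :
    S.Over e (S.nn e w) w := by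
  obtain ⟨h1, h2⟩ := mem_perp.1 hw
  exact ⟨1, fun v => by rw [ρ_nn h hX h1 h2]; module⟩

theorem over_tr {e f : V} (h : S.ω e f = 1) (c : R) : S.Over e (S.tr e c) 0 :=
  ⟨c, fun v => by rw [ρ_tr' (X_of_one h)]; simp [smul_smul, mul_comm]⟩

theorem over_one {e : V} : S.Over e 1 0 := ⟨0, fun v => by simp⟩

theorem Over.mul {e w w' : V} {h h' : E} (H : S.Over e h w) (H' : S.Over e h' w')
    (hw : S.ω e w = 0) (hw' : S.ω e w' = 0) : S.Over e (h * h') (w + w') := by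
  obtain ⟨c, hc⟩ := H
  obtain ⟨d, hd⟩ := H'
  refine ⟨c + d + S.ω w w', fun v => ?_⟩
  rw [ρ_mul_apply, hd]
  simp only [map_add, map_smul, hc, S.alt, hw', ω_swap_zero hw, LinearMap.add_apply]
  module

theorem Over.inv {e w : V} {h : E} (H : S.Over e h w) (hw : S.ω e w = 0) : S.Over e h⁻¹ (-w) := by
  obtain ⟨c, hc⟩ := H
  refine ⟨-c, fun v => ρ_inv_eq ?_⟩
  simp only [map_add, map_smul, map_neg, LinearMap.neg_apply, hc, S.alt, hw, ω_swap_zero hw]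
  module

theorem Over.fix {e w : V} {h : E} (H : S.Over e h w) (hw : S.ω e w = 0) : S.ρ h e = e := by
  obtain ⟨c, hc⟩ := H
  rw [hc, ω_swap_zero hw, S.alt]; simp

theorem Over.tr_comm {e f w : V} (hef : S.ω e f = 1) {h : E} (H : S.Over e h w) (hw : S.ω e w = 0)
    (c : R) : Commute h (S.tr e c) := tr_comm_of_fix (X_of_one hef) (H.fix hw) c

theorem Over.unique {e f w : V} (hef : S.ω e f = 1) {h h' : E} (H : S.Over e h w) (H' : S.Over e h' w)
    (hw : S.ω e w = 0) : ∃ d k, S.ρ k = 1 ∧ h = h' * (S.tr e d * k) := by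
  obtain ⟨c, hc⟩ := H
  have hfix := H'.fix hw
  obtain ⟨c', hc'⟩ := H'
  obtain ⟨k, hk, hh⟩ := exists_ker (S := S) (g := h) (h := h' * S.tr e (c - c')) (fun v => by
    rw [ρ_mul_apply, ρ_tr' (X_of_one hef), map_add, map_smul, hfix, hc, hc']; module)
  exact ⟨c - c', k, hk, by rw [hh, mul_assoc]⟩

variable (S) in
/-- Elements over `w` and `w'` commute up to the root subgroup of `e`. -/
def CommOver (e w w' : V) : Prop :=
  ∀ h h', S.Over e h w → S.Over e h' w' → ∃ c, h * h' = S.tr e c * (h' * h)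

theorem commOver_of_exists {e f w w' : V} (hef : S.ω e f = 1) (hw : S.ω e w = 0) (hw' : S.ω e w' = 0)
    {h h' : E} (H : S.Over e h w) (H' : S.Over e h' w') {c : R} (hc : h * h' = S.tr e c * (h' * h)) :
    S.CommOver e w w' := by
  intro g g' G G'
  obtain ⟨d, k, hk, rfl⟩ := G.unique hef H hw
  obtain ⟨d', k', hk', rfl⟩ := G'.unique hef H' hw'
  have a1 : ∀ x, Commute x k := fun x => S.ker_central k hk x
  have a2 : ∀ x, Commute x k' := fun x => S.ker_central k' hk' x
  have b1 : Commute h (S.tr e d * k) := (H.tr_comm hef hw d).mul_right (a1 h)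
  have b2 : Commute h' (S.tr e d * k) := (H'.tr_comm hef hw' d).mul_right (a1 h')
  have b3 : Commute h (S.tr e d' * k') := (H.tr_comm hef hw d').mul_right (a2 h)
  have b4 : Commute (S.tr e d) (S.tr e d') := tr_comm_self (X_of_one hef) d d'
  have b5 : Commute (S.tr e d * k) (S.tr e d' * k') := (b4.mul_left (a1 _).symm).mul_right (a2 _)
  refine ⟨c, ?_⟩
  calc h * (S.tr e d * k) * (h' * (S.tr e d' * k'))
      = h * ((S.tr e d * k) * h') * (S.tr e d' * k') := by group
    _ = (h * h') * ((S.tr e d * k) * (S.tr e d' * k')) := by rw [← b2.eq]; group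
    _ = S.tr e c * (h' * (h * (S.tr e d' * k')) * (S.tr e d * k)) := by rw [hc, b5.eq]; group
    _ = _ := by rw [b3.eq]; group

theorem CommOver.symm {e f w w' : V} (hef : S.ω e f = 1) (H : S.CommOver e w w') :
    S.CommOver e w' w := by
  intro h h' h1 h2
  obtain ⟨c, hc⟩ := H h' h h2 h1
  exact ⟨-c, by rw [hc, tr_neg (X_of_one hef)]; group⟩

theorem CommOver.add {e f w w₁ w₂ : V} (hef : S.ω e f = 1) (hw : S.ω e w = 0)
    (hw₁ : S.ω e w₁ = 0) (hw₂ : S.ω e w₂ = 0) (h₁ : ∃ h, S.Over e h w₁)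
    (h₂ : ∃ h, S.Over e h w₂) (H₁ : S.CommOver e w w₁) (H₂ : S.CommOver e w w₂) :
    S.CommOver e w (w₁ + w₂) := by
  intro h h' hh hh'
  obtain ⟨g₁, hg₁⟩ := h₁
  obtain ⟨g₂, hg₂⟩ := h₂
  obtain ⟨c₁, hc₁⟩ := H₁ h g₁ hh hg₁
  obtain ⟨c₂, hc₂⟩ := H₂ h g₂ hh hg₂
  have key : h * (g₁ * g₂) = S.tr e (c₁ + c₂) * ((g₁ * g₂) * h) := by
    have := hg₁.tr_comm hef hw₁ c₂
    calc h * (g₁ * g₂) = (h * g₁) * g₂ := by group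
      _ = S.tr e c₁ * (g₁ * (h * g₂)) := by rw [hc₁]; group
      _ = S.tr e c₁ * ((g₁ * S.tr e c₂) * (g₂ * h)) := by rw [hc₂]; group
      _ = _ := by rw [this.eq, S.tr_add e (X_of_one hef)]; group
  exact commOver_of_exists hef hw (by rw [map_add, hw₁, hw₂, add_zero]) hh
    (hg₁.mul hg₂ hw₁ hw₂) key h h' hh hh'

theorem nn_comm {e f w w' : V} (hef : S.ω e f = 1) (hX : S.X w) (hX' : S.X w')
    (hw : w ∈ S.perp e f) (hw' : w' ∈ S.perp e f) (h : S.ω w w' = 0) :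
    Commute (S.nn e w) (S.nn e w') := by
  obtain ⟨h1, h2⟩ := mem_perp.1 hw
  obtain ⟨h3, h4⟩ := mem_perp.1 hw'
  have x1 := X_add_of hef h2
  have x2 := X_add_of hef h4
  have a1 : Commute (S.tr (e + w) 1) (S.tr (e + w') 1) :=
    tr_comm x1 x2 (by simp [S.alt, h3, ω_swap_zero h1, h]) _ _
  have a2 : Commute (S.tr (e + w) 1) (S.tr w' (-1)) := tr_comm x1 hX' (by simp [h3, h]) _ _
  have a3 : Commute (S.tr w (-1)) (S.tr (e + w') 1) :=
    tr_comm hX x2 (by simp [ω_swap_zero h1, h]) _ _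
  have a4 : Commute (S.tr w (-1)) (S.tr w' (-1)) := tr_comm hX hX' h _ _
  exact (a1.mul_right a2).mul_left (a3.mul_right a4)

theorem nn_pow {e f w : V} (hef : S.ω e f = 1) (hX : S.X w) (hw : w ∈ S.perp e f) {M : ℕ}
    (hM : (M : R) = 0) : S.nn e w ^ M = 1 := by
  obtain ⟨h1, h2⟩ := mem_perp.1 hw
  have x1 := X_add_of hef h2
  have : Commute (S.tr (e + w) 1) (S.tr w (-1)) := tr_comm x1 hX (by simp [h1, S.alt]) _ _
  rw [nn, this.mul_pow, ← tr_nsmul x1, ← tr_nsmul hX, hM]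
  simp [tr_zero x1, tr_zero hX]

/-- `nn (-e) w` is inverse to `nn e w` up to the root subgroup of `e`. -/
theorem nn_neg_mul {e f w w' : V} (hef : S.ω e f = 1) (hww : S.ω w w' = 1) (hw : w ∈ S.perp e f)
    (hw' : w' ∈ S.perp e f) : S.nn (-e) w * S.nn e w = S.tr e 2 := by
  obtain ⟨h1, h2⟩ := mem_perp.1 hw
  obtain ⟨h3, h4⟩ := mem_perp.1 hw'
  have hX := X_of_one hww
  have hE := X_of_one hef
  have x1 := X_add_of hef h2
  have r := S.tr_add_sub w w' e hww hE (ω_swap_zero h1) (ω_swap_zero h3) 1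
  have c1 : Commute (S.tr w (-1)) (S.tr (e + w) 1) := tr_comm hX x1 (by simp [ω_swap_zero h1, S.alt]) _ _
  have c2 : Commute (S.tr (w - e) 1) (S.tr (w + e) 1) := by
    refine tr_comm ?_ ?_ ?_ _ _
    · exact X_of_one (y := w') (by simp [hww, h3])
    · exact X_of_one (y := w') (by simp [hww, h3])
    · simp [S.alt, h1, ω_swap_zero h1]
  have c3 : Commute (S.tr w 2) (S.tr e 2) := tr_comm hX hE (ω_swap_zero h1) _ _
  have e1 : -e + w = w - e := by abel
  have e2 : e + w = w + e := by abel
  rw [nn, nn, e1]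
  rw [e2] at c1 ⊢
  calc S.tr (w - e) 1 * S.tr w (-1) * (S.tr (w + e) 1 * S.tr w (-1))
      = S.tr (w - e) 1 * (S.tr w (-1) * S.tr (w + e) 1) * S.tr w (-1) := by group
    _ = (S.tr (w - e) 1 * S.tr (w + e) 1) * (S.tr w (-1) * S.tr w (-1)) := by rw [c1.eq]; group
    _ = (S.tr w 2 * S.tr e 2) * S.tr w (-2) := by
      rw [c2.eq, r, ← S.tr_add w hX]; norm_num
    _ = _ := by rw [c3.eq, tr_neg hX]; group

end TransvectionSystem
end SpH2

namespace SpH2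

/-- Bilinearity of commutators that are central in the relevant sense. -/
theorem mul_comm_mul_of_central {G : Type*} [Group G] {A A' B B' c c' P P' : G}
    (hc : A * B = c * (B * A)) (hc' : A' * B' = c' * (B' * A')) (hP : A * B' = P * (B' * A))
    (hP' : A' * B = P' * (B * A')) 
    (a1 : Commute A c') (a2 : Commute A P') (a3 : Commute B c') (b1 : Commute B P) :
    A * A' * (B * B') = P' * c' * (c * P) * (B * B' * (A * A')) := by
  calc A * A' * (B * B') = A * (A' * B) * B' := by group
    _ = (A * P') * B * (A' * B') := by rw [hP']; group
    _ = P' * A * (B * c') * (B' * A') := by rw [hc', a2.eq]; group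
    _ = P' * (A * c') * B * (B' * A') := by rw [a3.eq]; group
    _ = P' * c' * (A * B) * (B' * A') := by rw [a1.eq]; group
    _ = P' * c' * c * B * (A * B') * A' := by rw [hc]; group
    _ = P' * c' * c * (B * P) * B' * A * A' := by rw [hP]; group
    _ = _ := by rw [b1.eq]; group

namespace TransvectionSystem

open RankOne

variable {R V E : Type*} [CommRing R] [AddCommGroup V] [Module R V] [Group E]
  {S : TransvectionSystem R V E}

variable (S) in
/-- The long root element attached to two orthogonal vectors. -/
def qq (e e' : V) : E := S.tr (e + e') 1 * S.tr e (-1) * S.tr e' (-1)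

theorem ThreePairs.swap {e f a b e' f' : V} (T : S.ThreePairs e f a b e' f') :
    S.ThreePairs e' f' a b e f where
  h₀ := T.h₂
  h₁ := T.h₁
  h₂ := T.h₀
  e₁_mem := perp_symm T.e₂_mem' T.f₂_mem'
  f₁_mem := perp_symm' T.e₂_mem' T.f₂_mem'
  e₂_mem := perp_symm T.e₂_mem T.f₂_mem
  f₂_mem := perp_symm' T.e₂_mem T.f₂_mem
  e₂_mem' := perp_symm T.e₁_mem T.f₁_mem
  f₂_mem' := perp_symm' T.e₁_mem T.f₁_mem

section

variable {e f a b e' f' : V}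

theorem ThreePairs.add_pair (T : S.ThreePairs e f a b e' f') : S.ω (e + e') f = 1 := by
  have := T.h₀
  have := (mem_perp.1 T.e₂_mem).2
  simp [*, ω_swap_zero]

theorem ThreePairs.X_add (T : S.ThreePairs e f a b e' f') : S.X (e + e') := X_of_one T.add_pair

theorem ThreePairs.ω_eq_zero (T : S.ThreePairs e f a b e' f') : S.ω e e' = 0 := (mem_perp.1 T.e₂_mem).1

theorem ThreePairs.commute_tr (T : S.ThreePairs e f a b e' f') (c d : R) :
    Commute (S.tr e c) (S.tr e' d) := tr_comm (X_of_one T.h₀) (X_of_one T.h₂) T.ω_eq_zero c d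

theorem ThreePairs.commute_tr_add (T : S.ThreePairs e f a b e' f') (c d : R) :
    Commute (S.tr (e + e') c) (S.tr e d) :=
  tr_comm T.X_add (X_of_one T.h₀) (by simp [S.alt, ω_swap_zero T.ω_eq_zero]) c d

theorem ThreePairs.commute_tr_add' (T : S.ThreePairs e f a b e' f') (c d : R) :
    Commute (S.tr (e + e') c) (S.tr e' d) :=
  tr_comm T.X_add (X_of_one T.h₂) (by simp [S.alt, T.ω_eq_zero]) c d

theorem ThreePairs.qq_symm (T : S.ThreePairs e f a b e' f') : S.qq e' e = S.qq e e' := by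
  rw [qq, qq, add_comm, mul_assoc, mul_assoc, (T.commute_tr _ _).eq]

theorem ThreePairs.commute_qq (T : S.ThreePairs e f a b e' f') {g : E} (h : S.ρ g e = e)
    (h' : S.ρ g e' = e') : Commute g (S.qq e e') := by
  have h1 : Commute g (S.tr (e + e') 1) := tr_comm_of_fix T.X_add (by rw [map_add, h, h']) _
  have h2 : Commute g (S.tr e (-1)) := tr_comm_of_fix (X_of_one T.h₀) h _
  have h3 : Commute g (S.tr e' (-1)) := tr_comm_of_fix (X_of_one T.h₂) h' _
  exact (h1.mul_right h2).mul_right h3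

theorem ThreePairs.qq_mul_qq (T : S.ThreePairs e f a b e' f') :
    S.qq e e' * S.qq e e' * (S.tr e 2 * S.tr e' 2) = S.tr (e + e') 2 := by
  have c1 := T.commute_tr_add 1 (-1)
  have c2 := T.commute_tr_add' 1 (-1)
  have c3 := T.commute_tr (-1) (-1)
  have e1 : S.qq e e' * S.qq e e' = S.tr (e + e') 2 * (S.tr e (-2) * S.tr e' (-2)) := by
    calc S.qq e e' * S.qq e e' = (S.qq e e') ^ 2 := (pow_two _).symm
      _ = S.tr (e + e') 1 ^ 2 * (S.tr e (-1) ^ 2 * S.tr e' (-1) ^ 2) := by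
        rw [qq, mul_assoc, (c1.mul_right c2).mul_pow, c3.mul_pow]
      _ = _ := by
        rw [← tr_nsmul T.X_add, ← tr_nsmul (X_of_one T.h₀), ← tr_nsmul (X_of_one T.h₂)]; norm_num
  rw [e1, tr_neg (X_of_one T.h₀), tr_neg (X_of_one T.h₂), (T.commute_tr 2 2).eq]
  group

theorem ThreePairs.ρ_qq (T : S.ThreePairs e f a b e' f') (v : V) :
    S.ρ (S.qq e e') v = v + S.ω e v • e' + S.ω e' v • e := by
  have := T.ω_eq_zero
  rw [qq, ρ_mul_apply, ρ_mul_apply, ρ_tr' (X_of_one T.h₂), ρ_tr' (X_of_one T.h₀), ρ_tr' T.X_add]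
  simp only [map_add, map_smul, LinearMap.add_apply, S.alt, this, ω_swap_zero this]
  module

theorem ThreePairs.conj_qq (T : S.ThreePairs e f a b e' f') {j : E} (h : S.ρ j e = e)
    (h' : S.ρ j e' = -e') : j * S.qq e e' * j⁻¹ = (S.qq e e')⁻¹ := by
  have hE := X_of_one T.h₀
  have hE' := X_of_one T.h₂
  obtain ⟨i1, i2⟩ := mem_perp.1 T.e₂_mem
  have r := S.tr_add_sub e f e' T.h₀ hE' i1 i2 1
  have x1 : S.X (e - e') := X_of_one (y := f) (by simp [T.h₀, ω_swap_zero i2])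
  have e1 : j * S.qq e e' * j⁻¹ = S.tr (e - e') 1 * S.tr e (-1) * S.tr e' (-1) := by
    calc j * S.qq e e' * j⁻¹ = (j * S.tr (e + e') 1 * j⁻¹) * (j * S.tr e (-1) * j⁻¹) *
          (j * S.tr e' (-1) * j⁻¹) := by rw [qq]; group
      _ = _ := by
        rw [S.tr_conj _ T.X_add, S.tr_conj _ hE, S.tr_conj _ hE', map_add, h, h', tr_neg_vec hE',
          sub_eq_add_neg]
  rw [e1, eq_inv_iff_mul_eq_one]
  have c1 := T.commute_tr (-1) (-1)
  have c2 : Commute (S.tr (e - e') 1) (S.tr e (-1)) :=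
    tr_comm x1 hE (by simp [S.alt, ω_swap_zero i1]) _ _
  have c3 : Commute (S.tr (e - e') 1) (S.tr e' (-1)) :=
    tr_comm x1 hE' (by simp [S.alt, i1]) _ _
  have c4 : Commute (S.tr (e - e') 1) (S.tr (e + e') 1) :=
    tr_comm x1 T.X_add (by simp [S.alt, i1, ω_swap_zero i1]) _ _
  have c5 := T.commute_tr_add 1 (-1)
  have c6 := T.commute_tr_add' 1 (-1)
  have s1 : S.tr e 2 * (S.tr e (-1) * S.tr e (-1)) = 1 := by
    rw [← S.tr_add e hE, ← S.tr_add e hE]; norm_num [tr_zero hE]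
  have s2 : S.tr e' 2 * (S.tr e' (-1) * S.tr e' (-1)) = 1 := by
    rw [← S.tr_add e' hE', ← S.tr_add e' hE']; norm_num [tr_zero hE']
  have c7 : Commute (S.tr e' 2) (S.tr e (-1)) := (T.commute_tr (-1) 2).symm
  calc S.tr (e - e') 1 * S.tr e (-1) * S.tr e' (-1) * S.qq e e'
      = S.tr (e - e') 1 * ((S.tr e (-1) * S.tr e' (-1)) * S.tr (e + e') 1) *
          (S.tr e (-1) * S.tr e' (-1)) := by rw [qq]; group
    _ = (S.tr (e - e') 1 * S.tr (e + e') 1) * (S.tr e (-1) * (S.tr e' (-1) * S.tr e (-1)) *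
          S.tr e' (-1)) := by rw [← (c5.mul_right c6).eq]; group
    _ = S.tr e 2 * (S.tr e' 2 * (S.tr e (-1) * S.tr e (-1))) * (S.tr e' (-1) * S.tr e' (-1)) := by
      rw [c4.eq, r, mul_one, ← c1.eq]; group
    _ = 1 := by 
      rw [(c7.mul_right c7).eq, ← mul_assoc (S.tr e 2), s1, one_mul, s2]

/-- The commutator of short root elements along a common hyperbolic pair, up to a sign. -/
theorem ThreePairs.nn_comm_nn (T : S.ThreePairs e f a b e' f') : ∃ l, S.ρ l = 1 ∧ l * l = 1 ∧
    S.nn e a * S.nn e' b = S.qq e e' * l * (S.nn e' b * S.nn e a) := by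
  have hE' := X_of_one T.h₂
  have hA := X_of_one T.h₁
  have hB := X_of_one' T.h₁
  obtain ⟨a1, a2⟩ := mem_perp.1 T.e₁_mem
  obtain ⟨b1, b2⟩ := mem_perp.1 T.f₁_mem
  obtain ⟨a3, a4⟩ := mem_perp.1 T.swap.e₁_mem
  obtain ⟨b3, b4⟩ := mem_perp.1 T.swap.f₁_mem
  have ee := T.ω_eq_zero
  have rA : ∀ v, S.ρ (S.nn e a) v = _ := ρ_nn T.h₀ hA a1 a2
  have rB : ∀ v, S.ρ (S.nn e' b) v = _ := ρ_nn T.h₂ hB b3 b4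
  have Ae' : S.ρ (S.nn e a) e' = e' := by rw [rA, ee, ω_swap_zero a3]; simp
  have Be : S.ρ (S.nn e' b) e = e := by rw [rB, ω_swap_zero ee, ω_swap_zero b1]; simp
  have Be' : S.ρ (S.nn e' b) e' = e' := by rw [rB, S.alt, ω_swap_zero b3]; simp
  obtain ⟨l, hl, H⟩ := exists_ker (S := S) (g := S.nn e a * S.nn e' b)
    (h := S.qq e e' * (S.nn e' b * S.nn e a)) (fun v => by
      simp only [ρ_mul_apply, T.ρ_qq, rA, rB, map_add, map_smul, S.alt, ee, a1, b1, ω_swap_zero b1,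
        a3, ω_swap_zero a3, b3, T.h₁,
        S.skew a b, ω_swap_zero ee]
      module)
  have lc : ∀ g, Commute g l := fun g => S.ker_central l hl g
  have H' : S.nn e a * S.nn e' b = S.qq e e' * l * (S.nn e' b * S.nn e a) := by
    rw [H, mul_assoc, (lc _).eq, mul_assoc]
  refine ⟨l, hl, ?_, H'⟩
  obtain ⟨j, hj, hj'⟩ := exists_neg T.h₂
  have je := hj' e T.swap.e₂_mem
  have ja := hj' a T.swap.e₁_mem
  have jb := hj' b T.swap.f₁_mem
  have n1 : j * S.nn e a * j⁻¹ = S.nn e a := by rw [nn_conj T.h₀ hA a2, je, ja]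
  have n2 : j * S.nn e' b * j⁻¹ = S.tr e' 2 * (S.nn e' b)⁻¹ := by
    rw [nn_conj T.h₂ hB b4, hj, jb, eq_mul_inv_iff_mul_eq]
    refine nn_neg_mul T.h₂ (w' := -a) ?_ T.swap.f₁_mem (neg_mem T.swap.e₁_mem)
    rw [map_neg, S.skew a b, T.h₁, neg_neg]
  have n3 := T.conj_qq je hj
  have cA : Commute (S.nn e a) (S.tr e' 2) := tr_comm_of_fix hE' Ae' _
  have cq : Commute (S.qq e e') (S.tr e' 2) := (T.commute_qq (g := S.tr e' 2)
    (tr_fix hE' (ω_swap_zero ee) _) (tr_fix hE' (S.alt _) _)).symm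
  have cB : Commute (S.nn e' b) (S.qq e e') := T.commute_qq Be Be'
  have K : S.nn e a * (S.tr e' 2 * (S.nn e' b)⁻¹) =
      (S.qq e e')⁻¹ * l * (S.tr e' 2 * (S.nn e' b)⁻¹ * S.nn e a) := by
    have hjl : j * l * j⁻¹ = l := by rw [(lc j).eq]; group
    calc S.nn e a * (S.tr e' 2 * (S.nn e' b)⁻¹)
        = j * (S.nn e a * S.nn e' b) * j⁻¹ := by rw [← n2]; nth_rw 1 [← n1]; group
      _ = (j * S.qq e e' * j⁻¹) * (j * l * j⁻¹) * ((j * S.nn e' b * j⁻¹) * (j * S.nn e a * j⁻¹)) := by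
        rw [H']; group
      _ = _ := by rw [n1, n2, n3, hjl]
  generalize S.nn e a = A at *
  generalize S.nn e' b = B at *
  generalize S.qq e e' = q at *
  generalize S.tr e' 2 = t at *
  have K' : A * B⁻¹ = q⁻¹ * l * (B⁻¹ * A) := by
    have : t * (A * B⁻¹) = t * (q⁻¹ * l * (B⁻¹ * A)) := by
      calc t * (A * B⁻¹) = (A * t) * B⁻¹ := by rw [cA.eq]; group
        _ = q⁻¹ * (l * t) * (B⁻¹ * A) := by rw [mul_assoc, K]; group
        _ = (q⁻¹ * t) * l * (B⁻¹ * A) := by rw [← (lc t).eq]; group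
        _ = _ := by rw [cq.inv_left.eq]; group
    exact mul_left_cancel this
  -- invert the first relation
  have K2 : A = q * l * B * (q⁻¹ * l) * B⁻¹ * A := by
    calc A = (A * B) * B⁻¹ := by group
      _ = q * l * B * (A * B⁻¹) := by rw [H']; group
      _ = _ := by rw [K']; group
  have K3 : q * l * B * (q⁻¹ * l) * B⁻¹ = l * l := by
    calc q * l * B * (q⁻¹ * l) * B⁻¹ = q * l * (B * q⁻¹) * (l * B⁻¹) := by group
      _ = q * (l * q⁻¹) * (B * B⁻¹) * l := by rw [cB.inv_right.eq, ← (lc B⁻¹).eq]; group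
      _ = l * l := by rw [← (lc q⁻¹).eq]; group
  rw [K3] at K2
  exact mul_eq_right.1 K2.symm

theorem exists_nn_comm (h : S.ω e f = 1) (hab : S.ω a b = 1) (ha : a ∈ S.perp e f)
    (hb : b ∈ S.perp e f) :
    ∃ m, S.ρ m = 1 ∧ S.nn e a * S.nn e b = S.tr e 2 * m * (S.nn e b * S.nn e a) := by
  obtain ⟨a1, a2⟩ := mem_perp.1 ha
  obtain ⟨b1, b2⟩ := mem_perp.1 hb
  obtain ⟨m, hm, H⟩ := exists_ker (S := S) (g := S.nn e a * S.nn e b)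
    (h := S.tr e 2 * (S.nn e b * S.nn e a)) (fun v => by
      simp only [ρ_mul_apply, ρ_nn h (X_of_one hab) a1 a2, ρ_nn h (X_of_one' hab) b1 b2,
        ρ_tr' (X_of_one h), map_add, map_smul, S.alt, a1, b1, ω_swap_zero a1, ω_swap_zero b1, hab,
        S.skew a b]
      module)
  exact ⟨m, hm, by rw [H, mul_assoc, S.ker_central m hm, mul_assoc]⟩

variable [OddChainRing R]

/-- Short root elements satisfy the Heisenberg commutator relation exactly. -/
theorem ThreePairs.nn_comm_pair (T : S.ThreePairs e f a b e' f') :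
    S.nn e a * S.nn e b = S.tr e 2 * (S.nn e b * S.nn e a) := by
  have hE := X_of_one T.h₀
  have hE' := X_of_one T.h₂
  have hA := X_of_one T.h₁
  have hB := X_of_one' T.h₁
  have T' := T.swap
  have ee := T.ω_eq_zero
  obtain ⟨a1, a2⟩ := mem_perp.1 T.e₁_mem
  obtain ⟨b1, b2⟩ := mem_perp.1 T.f₁_mem
  obtain ⟨a3, a4⟩ := mem_perp.1 T'.e₁_mem
  obtain ⟨b3, b4⟩ := mem_perp.1 T'.f₁_mem
  obtain ⟨m, hm, H⟩ := exists_nn_comm T.h₀ T.h₁ T.e₁_mem T.f₁_mem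
  have mc : ∀ g, Commute g m := fun g => S.ker_central m hm g
  -- the discrepancy does not depend on the vector
  have indep : ∀ x, x ∈ S.perp a b → S.X x →
      S.nn x a * S.nn x b = S.tr x 2 * m * (S.nn x b * S.nn x a) := by
    intro x hx hX
    obtain ⟨g, hg, rfl⟩ := (good_top.inf_perp T.h₁ trivial trivial).transitive
      ⟨trivial, perp_symm T.e₁_mem T.f₁_mem⟩ hE ⟨trivial, hx⟩ hX
    obtain ⟨ga, gb⟩ := EL_perp_fix hg
    have n1 := nn_conj T.h₀ hA a2 g
    have n2 := nn_conj T.h₀ hB b2 g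
    rw [ga] at n1
    rw [gb] at n2
    rw [← n1, ← n2, ← S.tr_conj _ hE]
    calc g * S.nn e a * g⁻¹ * (g * S.nn e b * g⁻¹) = g * (S.nn e a * S.nn e b) * g⁻¹ := by group
      _ = g * S.tr e 2 * (m * (S.nn e b * S.nn e a * g⁻¹)) := by rw [H]; group
      _ = g * S.tr e 2 * (g⁻¹ * m * g * (S.nn e b * S.nn e a * g⁻¹)) := by
        rw [(mc g⁻¹).eq]; group
      _ = _ := by group
  have H' := indep e' (perp_symm T'.e₁_mem T'.f₁_mem) hE'
  obtain ⟨l, hl, hll, L⟩ := T.nn_comm_nn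
  obtain ⟨l', hl', hll', L'⟩ := T'.nn_comm_nn
  rw [T.qq_symm] at L'
  have lc : ∀ g, Commute g l := fun g => S.ker_central l hl g
  have lc' : ∀ g, Commute g l' := fun g => S.ker_central l' hl' g
  have p1 : a ∈ S.perp (e + e') f := mem_perp.2 ⟨by simp [a1, a3], a2⟩
  have p2 : b ∈ S.perp (e + e') f := mem_perp.2 ⟨by simp [b1, b3], b2⟩
  have H2 := indep (e + e') (perp_symm p1 p2) T.X_add
  have rAe : S.ρ (S.nn e a) e = e := by rw [ρ_nn T.h₀ hA a1 a2, S.alt, ω_swap_zero a1]; simp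
  have rBe : S.ρ (S.nn e b) e = e := by rw [ρ_nn T.h₀ hB b1 b2, S.alt, ω_swap_zero b1]; simp
  have rAe' : S.ρ (S.nn e a) e' = e' := by rw [ρ_nn T.h₀ hA a1 a2, ee, ω_swap_zero a3]; simp
  have rBe' : S.ρ (S.nn e b) e' = e' := by rw [ρ_nn T.h₀ hB b1 b2, ee, ω_swap_zero b3]; simp
  have rA'e : S.ρ (S.nn e' a) e = e := by
    rw [ρ_nn T.h₂ hA a3 a4, ω_swap_zero ee, ω_swap_zero a1]; simp
  have rB'e : S.ρ (S.nn e' b) e = e := by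
    rw [ρ_nn T.h₂ hB b3 b4, ω_swap_zero ee, ω_swap_zero b1]; simp
  have rA'e' : S.ρ (S.nn e' a) e' = e' := by rw [ρ_nn T.h₂ hA a3 a4, S.alt, ω_swap_zero a3]; simp
  have rB'e' : S.ρ (S.nn e' b) e' = e' := by rw [ρ_nn T.h₂ hB b3 b4, S.alt, ω_swap_zero b3]; simp
  obtain ⟨k, hk, Ka⟩ := exists_ker (S := S) (g := S.nn (e + e') a)
    (h := S.nn e a * S.nn e' a * S.qq e e') (fun v => by
      simp only [ρ_mul_apply, ρ_nn T.h₀ hA a1 a2, ρ_nn T.h₂ hA a3 a4, T.ρ_qq,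
        ρ_nn T.add_pair hA (mem_perp.1 p1).1 a2, map_add, map_smul, S.alt, ee, a1,
        ω_swap_zero a1, ω_swap_zero a3, ω_swap_zero ee, LinearMap.add_apply]
      module)
  obtain ⟨k', hk', Kb⟩ := exists_ker (S := S) (g := S.nn (e + e') b)
    (h := S.nn e b * S.nn e' b * S.qq e e') (fun v => by
      simp only [ρ_mul_apply, ρ_nn T.h₀ hB b1 b2, ρ_nn T.h₂ hB b3 b4, T.ρ_qq,
        ρ_nn T.add_pair hB (mem_perp.1 p2).1 b2, map_add, map_smul, S.alt, ee, b1,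
        ω_swap_zero b1, ω_swap_zero b3, ω_swap_zero ee, LinearMap.add_apply]
      module)
  have kc : ∀ g, Commute g k := fun g => S.ker_central k hk g
  have kc' : ∀ g, Commute g k' := fun g => S.ker_central k' hk' g
  have qA := T.commute_qq rAe rAe'
  have qB := T.commute_qq rBe rBe'
  have qA' := T.commute_qq rA'e rA'e'
  have qB' := T.commute_qq rB'e rB'e'
  have tA : Commute (S.nn e a) (S.tr e' 2) := tr_comm_of_fix hE' rAe' _
  have tB : Commute (S.nn e b) (S.tr e' 2) := tr_comm_of_fix hE' rBe' _
  have tA0 : Commute (S.nn e a) (S.tr e 2) := tr_comm_of_fix hE rAe _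
  have tq : Commute (S.tr e 2) (S.qq e e') :=
    T.commute_qq (tr_fix hE (S.alt e) 2) (tr_fix hE ee 2)
  have tq' : Commute (S.tr e' 2) (S.qq e e') :=
    T.commute_qq (tr_fix hE' (ω_swap_zero ee) 2) (tr_fix hE' (S.alt e') 2)
  have key := mul_comm_mul_of_central H H' L L' (tA.mul_right (mc _)) (qA.mul_right (lc' _))
    (tB.mul_right (mc _)) (qB.mul_right (lc _))
  have qq2 := T.qq_mul_qq
  have tt := T.commute_tr 2 2
  obtain ⟨M, hM, hM0⟩ := OddChainRing.exists_odd_cast_eq_zero (R := R)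
  have AM := nn_pow T.h₀ hA T.e₁_mem hM0
  have tM : S.tr e 2 ^ M = 1 := by rw [← tr_nsmul hE, hM0, zero_mul, tr_zero hE]
  have m1 : m = 1 := by
    rw [Ka, Kb, ← qq2] at H2
    generalize S.nn e a = A at *
    generalize S.nn e' a = A' at *
    generalize S.nn e b = B at *
    generalize S.nn e' b = B' at *
    generalize S.qq e e' = q at *
    generalize S.tr e 2 = t at *
    generalize S.tr e' 2 = t' at *
    have cA : Commute (A * A') (q * k) := (qA.mul_left qA').mul_right (kc _)
    have cA' : Commute (A * A') (q * k') := (qA.mul_left qA').mul_right (kc' _)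
    have cB : Commute (B * B') (q * k) := (qB.mul_left qB').mul_right (kc _)
    have cq : Commute (q * k) (q * k') :=
      (((Commute.refl q).mul_right (kc' q))).mul_left ((kc q).symm.mul_right (kc' k))
    have key2 : A * A' * (B * B') = q * q * (t * t') * m * (B * B' * (A * A')) := by
      have h1 : A * A' * q * k * (B * B' * q * k') = A * A' * (B * B') * ((q * k) * (q * k')) := by
        calc A * A' * q * k * (B * B' * q * k') = A * A' * ((q * k) * (B * B')) * (q * k') := by group
          _ = _ := by rw [← cB.eq]; group
      have h2 : B * B' * q * k' * (A * A' * q * k) = B * B' * (A * A') * ((q * k) * (q * k')) := by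
        calc B * B' * q * k' * (A * A' * q * k) = B * B' * ((q * k') * (A * A')) * (q * k) := by group
          _ = B * B' * (A * A') * ((q * k') * (q * k)) := by rw [← cA'.eq]; group
          _ = _ := by rw [cq.eq]
      rw [h1, h2, ← mul_assoc (q * q * (t * t') * m)] at H2
      exact mul_right_cancel H2
    rw [key] at key2
    have key3 := mul_right_cancel key2
    have key4 : q * q * (t * t') * (m * m * (l' * l)) = q * q * (t * t') * m := by
      rw [← key3]
      symm
      calc q * l' * (t' * m) * (t * m * (q * l))
          = q * (l' * (t' * m * t * m * q * l)) := by group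
        _ = q * t' * (m * t) * (m * q) * (l * l') := by rw [← (lc' (t' * m * t * m * q * l)).eq]; group
        _ = q * t' * t * (m * (q * m)) * (l' * l) := by
          rw [← (mc t).eq, ← (mc q).eq, (lc' l).eq]; group
        _ = q * ((t' * t) * q) * (m * m * (l' * l)) := by rw [← mul_assoc m, ← (mc q).eq]; group
        _ = _ := by rw [(tq'.mul_left tq).eq, tt.eq]; group
    have key5 : m * (l' * l) = 1 := by
      have := mul_left_cancel key4
      rwa [mul_assoc, mul_eq_left] at this
    have m2 : m ^ 2 = 1 := by
      have : m = l' * l := by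
        have e1 : (l' * l) * (l' * l) = 1 := by
          rw [← mul_assoc, mul_assoc l' l l', ← (lc l').eq, ← mul_assoc, hll', one_mul, hll]
        exact mul_right_cancel (key5.trans e1.symm)
      rw [this, (lc l').mul_pow, pow_two, pow_two, hll, hll', one_mul]
    have mM : m ^ M = 1 := by
      have e1 : A = (t * m) * (B * A * B⁻¹) := by
        calc A = (A * B) * B⁻¹ := by group
          _ = _ := by rw [H]; group
      have e2 : Commute (t * m) (B * A * B⁻¹) := by
        have : B * A * B⁻¹ = (t * m)⁻¹ * A := by rw [eq_inv_mul_iff_mul_eq]; exact e1.symm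
        rw [this]
        exact ((Commute.refl _).inv_right).mul_right (tA0.mul_right (mc _)).symm
      have e3 := congrArg (· ^ M) e1
      simp only [e2.mul_pow, (mc t).mul_pow, conj_pow, AM, tM] at e3
      simpa using e3.symm
    obtain ⟨r, rfl⟩ := hM
    rwa [pow_succ, pow_mul, m2, one_pow, one_mul] at mM
  rw [H, m1, mul_one]

end
end TransvectionSystem
end SpH2

namespace SpH2
namespace TransvectionSystem

open RankOne

variable {R V E : Type*} [CommRing R] [AddCommGroup V] [Module R V] [Group E]
  {S : TransvectionSystem R V E} {e f : V}

theorem commOver_of_eq_zero (hef : S.ω e f = 1) {w w' : V} (hw : w ∈ S.perp e f) (hX : S.X w)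
    (hw' : w' ∈ S.perp e f) (hX' : S.X w') (h : S.ω w w' = 0) : S.CommOver e w w' :=
  commOver_of_exists hef (mem_perp.1 hw).1 (mem_perp.1 hw').1 (over_nn hef hX hw)
    (over_nn hef hX' hw') (c := 0) (by
      rw [tr_zero (X_of_one hef), one_mul]; exact nn_comm hef hX hX' hw hw' h)

variable [OddChainRing R]

theorem X_add_of_not {w a b : V} (hw : ¬ S.X w) (hab : S.ω a b = 1) : S.X (w + a) :=
  ⟨b, by
    rw [map_add, LinearMap.add_apply, hab, add_comm]
    exact isUnit_add_of_not isUnit_one fun hu => hw ⟨b, hu⟩⟩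

theorem exists_over (hef : S.ω e f = 1) {a b : V} (ha : a ∈ S.perp e f)
    (hab : S.ω a b = 1) {w : V} (hw : w ∈ S.perp e f) : ∃ h, S.Over e h w := by
  by_cases hX : S.X w
  · exact ⟨_, over_nn hef hX hw⟩
  · have h1 := over_nn hef (X_add_of_not hX hab) (add_mem hw ha)
    have h2 := over_nn hef (X_of_one hab).neg (neg_mem ha)
    have h3 := h1.mul h2 (mem_perp.1 (add_mem hw ha)).1 (mem_perp.1 (neg_mem ha)).1
    rw [add_neg_cancel_right] at h3
    exact ⟨_, h3⟩

theorem commOver_of_eq_one {e₀ f₀ e₁ f₁ e₂ f₂ : V} (T : S.ThreePairs e₀ f₀ e₁ f₁ e₂ f₂)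
    (hef : S.ω e f = 1) {w w' : V} (hw : w ∈ S.perp e f) (hw' : w' ∈ S.perp e f)
    (h : S.ω w w' = 1) : S.CommOver e w w' := by
  obtain ⟨e', f', T'⟩ := exists_third_pair T hef h hw hw'
  exact commOver_of_exists hef (mem_perp.1 hw).1 (mem_perp.1 hw').1
    (over_nn hef (X_of_one h) hw) (over_nn hef (X_of_one' h) hw') T'.nn_comm_pair

theorem commOver_of_X {e₀ f₀ e₁ f₁ e₂ f₂ : V} (T : S.ThreePairs e₀ f₀ e₁ f₁ e₂ f₂)
    (hef : S.ω e f = 1) {w w' : V} (hw : w ∈ S.perp e f) (hX : S.X w)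
    (hw' : w' ∈ S.perp e f) : S.CommOver e w w' := by
  obtain ⟨z, ⟨-, hz⟩, hwz⟩ := (good_top.inf_perp hef trivial trivial).exists_one ⟨trivial, hw⟩ hX
  obtain ⟨n, hn⟩ := OddChainRing.natCast_surjective (S.ω w w')
  have ex : ∀ {v : V}, v ∈ S.perp e f → ∃ h, S.Over e h v := fun hv => exists_over hef hw hwz hv
  have ew := (mem_perp.1 hw).1
  have base : S.CommOver e w 0 := by
    obtain ⟨h, hh⟩ := ex hw
    exact commOver_of_exists hef ew (map_zero _) hh over_one (c := 0)
      (by simp [tr_zero (X_of_one hef)])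
  have mult : ∀ n : ℕ, S.CommOver e w (n • z) := by
    intro n
    induction n with
    | zero => simpa using base
    | succ n ih =>
      rw [succ_nsmul]
      have hnz : n • z ∈ S.perp e f := nsmul_mem hz n
      exact ih.add hef ew (mem_perp.1 hnz).1 (mem_perp.1 hz).1 (ex hnz) (ex hz)
        (commOver_of_eq_one T hef hw hz hwz)
  have orth : ∀ y ∈ S.perp e f, S.ω w y = 0 → S.CommOver e w y := by
    intro y hy h0
    by_cases hY : S.X y
    · exact commOver_of_eq_zero hef hw hX hy hY h0
    · have h1 := commOver_of_eq_zero hef hw hX (add_mem hy hw) (X_add_of_not hY hwz)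
        (by rw [map_add, h0, S.alt, add_zero])
      have h2 := commOver_of_eq_zero hef hw hX (neg_mem hw) hX.neg (by rw [map_neg, S.alt, neg_zero])
      have h3 := h1.add hef ew (mem_perp.1 (add_mem hy hw)).1 (mem_perp.1 (neg_mem hw)).1
        (ex (add_mem hy hw)) (ex (neg_mem hw)) h2
      rwa [add_neg_cancel_right] at h3
  have hnz : n • z ∈ S.perp e f := nsmul_mem hz n
  have hy : w' - n • z ∈ S.perp e f := sub_mem hw' hnz
  have h := (mult n).add hef ew (mem_perp.1 hnz).1 (mem_perp.1 hy).1 (ex hnz) (ex hy)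
    (orth _ hy (by rw [map_sub, map_nsmul, hwz, nsmul_eq_mul, mul_one, hn, sub_self]))
  rwa [add_sub_cancel] at h

theorem commOver {e₀ f₀ e₁ f₁ e₂ f₂ : V} (T : S.ThreePairs e₀ f₀ e₁ f₁ e₂ f₂)
    (hef : S.ω e f = 1) {w w' : V} (hw : w ∈ S.perp e f)
    (hw' : w' ∈ S.perp e f) : S.CommOver e w w' := by
  by_cases hX : S.X w
  · exact commOver_of_X T hef hw hX hw'
  obtain ⟨a, ha, b, hb, hab⟩ := exists_second_pair T hef
  have h1 := (commOver_of_X T hef (add_mem hw ha) (X_add_of_not hX hab) hw').symm hef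
  have h2 := (commOver_of_X T hef (neg_mem ha) (X_of_one hab).neg hw').symm hef
  have h3 := h1.add hef (mem_perp.1 hw').1 (mem_perp.1 (add_mem hw ha)).1
    (mem_perp.1 (neg_mem ha)).1 (exists_over hef ha hab (add_mem hw ha))
    (exists_over hef ha hab (neg_mem ha)) h2
  rw [add_neg_cancel_right] at h3
  exact h3.symm hef

end TransvectionSystem
end SpH2

namespace SpH2
namespace TransvectionSystem

open RankOne

variable {R V E : Type*} [CommRing R] [AddCommGroup V] [Module R V] [Group E]
  {S : TransvectionSystem R V E} {e f : V} {L : Submodule R V}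

theorem HeisN_conj (hef : S.ω e f = 1) {n m : E} (hn : n ∈ S.HeisN e (L ⊓ S.perp e f))
    (hm : m ∈ S.EL (L ⊓ S.perp e f)) : m * n * m⁻¹ ∈ S.HeisN e (L ⊓ S.perp e f) := by
  have hme := (EL_perp_fix hm).1
  induction hn using Subgroup.closure_induction with
  | mem g hx =>
    rcases hx with ⟨w, hw, hX, rfl⟩ | ⟨c, rfl⟩
    · rw [nn_conj hef hX (mem_perp.1 hw.2).2, hme]
      exact nn_mem (EL_map_mem hm hw) (hX.map m)
    · rw [S.tr_conj e (X_of_one hef), hme]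
      exact tr_mem_HeisN _ _ _
  | one => simp
  | mul a b _ _ ha hb => convert mul_mem ha hb using 1; group
  | inv a _ ha => convert inv_mem ha using 1; group

/-- The parabolic subgroup generated by the Heisenberg group and its Levi complement. -/
def HeisEL (hef : S.ω e f = 1) (L : Submodule R V) : Subgroup E where
  carrier := {g | ∃ n ∈ S.HeisN e (L ⊓ S.perp e f), ∃ m ∈ S.EL (L ⊓ S.perp e f), g = n * m}
  one_mem' := ⟨1, one_mem _, 1, one_mem _, by simp⟩
  mul_mem' := by
    rintro _ _ ⟨n, hn, m, hm, rfl⟩ ⟨n', hn', m', hm', rfl⟩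
    exact ⟨n * (m * n' * m⁻¹), mul_mem hn (HeisN_conj hef hn' hm), m * m', mul_mem hm hm', by group⟩
  inv_mem' := by
    rintro _ ⟨n, hn, m, hm, rfl⟩
    exact ⟨m⁻¹ * n⁻¹ * m⁻¹⁻¹, HeisN_conj hef (inv_mem hn) (inv_mem hm), m⁻¹, inv_mem hm, by group⟩

theorem HeisN_le_HeisEL (hef : S.ω e f = 1) : S.HeisN e (L ⊓ S.perp e f) ≤ HeisEL hef L :=
  fun n hn => ⟨n, hn, 1, one_mem _, by simp⟩

theorem EL_le_HeisEL (hef : S.ω e f = 1) : S.EL (L ⊓ S.perp e f) ≤ HeisEL hef L :=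
  fun m hm => ⟨1, one_mem _, m, hm, by simp⟩

theorem HeisN_over (hef : S.ω e f = 1) {n : E} (hn : n ∈ S.HeisN e (L ⊓ S.perp e f)) :
    ∃ w ∈ L ⊓ S.perp e f, S.Over e n w := by
  induction hn using Subgroup.closure_induction with
  | mem g hx =>
    rcases hx with ⟨w, hw, hX, rfl⟩ | ⟨c, rfl⟩
    · exact ⟨w, hw, over_nn hef hX hw.2⟩
    · exact ⟨0, zero_mem _, over_tr hef c⟩
  | one => exact ⟨0, zero_mem _, over_one⟩
  | mul a b _ _ ha hb =>
    obtain ⟨w, hw, h⟩ := ha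
    obtain ⟨w', hw', h'⟩ := hb
    exact ⟨_, add_mem hw hw', h.mul h' (mem_perp.1 hw.2).1 (mem_perp.1 hw'.2).1⟩
  | inv a _ ha =>
    obtain ⟨w, hw, h⟩ := ha
    exact ⟨_, neg_mem hw, h.inv (mem_perp.1 hw.2).1⟩

theorem HeisN_tr_comm (hef : S.ω e f = 1) {n : E} (hn : n ∈ S.HeisN e (L ⊓ S.perp e f)) (c : R) :
    Commute n (S.tr e c) := tr_comm_of_fix (X_of_one hef) (HeisN_fix hef hn) c

theorem tr_mem_HeisEL_of_X (hL : S.Good L) (hef : S.ω e f = 1) (he : e ∈ L) (hf : f ∈ L) {α : R}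
    {v : V} (hv : v ∈ L ⊓ S.perp e f) (hX : S.X v) (c : R) : S.tr (α • e + v) c ∈ HeisEL hef L := by
  obtain ⟨z, hz, hvz⟩ := (hL.inf_perp hef he hf).exists_one hv hX
  have hw : -α • z + v ∈ L ⊓ S.perp e f := add_mem (Submodule.smul_mem _ _ hz) hv
  have hwX : S.X (-α • z + v) := X_of_one (y := z) (by simp [S.alt, hvz])
  have hr : S.ρ (S.nn e (-α • z + v)) v = α • e + v := by
    rw [ρ_nn hef hwX (mem_perp.1 hw.2).1 (mem_perp.1 hw.2).2, (mem_perp.1 hv.2).1]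
    simp only [map_add, map_smul, LinearMap.add_apply, LinearMap.smul_apply, S.skew v z, hvz, S.alt]
    module
  rw [← hr, ← S.tr_conj v hX]
  have h1 := HeisN_le_HeisEL hef (nn_mem (S := S) (e := e) hw hwX)
  exact mul_mem (mul_mem h1 (EL_le_HeisEL hef (tr_mem_EL hv hX c))) (inv_mem h1)

variable [OddChainRing R]

theorem tr_mem_HeisEL (hL : S.Good L) (hef : S.ω e f = 1) (he : e ∈ L) (hf : f ∈ L)
    (hL' : S.ZeroOrHyp (L ⊓ S.perp e f)) {α : R}
    {v : V} (hv : v ∈ L ⊓ S.perp e f) (hX : S.X (α • e + v)) (c : R) :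
    S.tr (α • e + v) c ∈ HeisEL hef L := by
  by_cases hvX : S.X v
  · exact tr_mem_HeisEL_of_X hL hef he hf hv hvX c
  have hα : IsUnit α := by
    obtain ⟨y, hy⟩ := hX
    rw [map_add, map_smul, LinearMap.add_apply, LinearMap.smul_apply, smul_eq_mul] at hy
    rcases isUnit_add_or hy with h | h
    · exact isUnit_of_mul_isUnit_left h
    · exact absurd ⟨y, h⟩ hvX
  rcases hL' with h0 | ⟨a, ha, b, hb, hab⟩
  · rw [h0 v hv, add_zero, S.tr_smul e (X_of_one hef) α hα]
    exact HeisN_le_HeisEL hef (tr_mem_HeisN _ _ _)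
  · obtain ⟨z, hz, z', hzz, hvz⟩ : ∃ z ∈ L ⊓ S.perp e f, ∃ z', S.ω z z' = 1 ∧ S.ω v z = 0 := by
      rcases OddChainRing.dvd_total (S.ω v a) (S.ω v b) with ⟨r, hr⟩ | ⟨r, hr⟩
      · refine ⟨b - r • a, sub_mem hb (Submodule.smul_mem _ _ ha), -a, ?_, ?_⟩
        · simp [S.alt, S.skew a b, hab]
        · simp [hr, mul_comm]
      · refine ⟨a - r • b, sub_mem ha (Submodule.smul_mem _ _ hb), b, ?_, ?_⟩
        · simp [S.alt, hab]
        · simp [hr, mul_comm]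
    have hzX := X_of_one hzz
    obtain ⟨u, rfl⟩ := hα
    obtain ⟨d, hd⟩ : ∃ d : R, c = 2 * d := by
      obtain ⟨t, ht⟩ := isUnit_two (R := R)
      exact ⟨(↑t⁻¹ : R) * c, by rw [← ht]; simp⟩
    have r := S.tr_add_sub ((u : R) • e + v) ((↑u⁻¹ : R) • f) z
      (by simp [hef, ω_swap_zero (mem_perp.1 hv.2).2]) hzX (by simp [hvz, (mem_perp.1 hz.2).1])
      (by simp [(mem_perp.1 hz.2).2]) d
    rw [← hd] at r
    have r' := eq_mul_inv_of_mul_eq r.symm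
    rw [r', add_assoc, add_sub_assoc]
    refine mul_mem (mul_mem ?_ ?_) (inv_mem ?_)
    · exact tr_mem_HeisEL_of_X hL hef he hf (add_mem hv hz) (X_add_of_not hvX hzz) _
    · refine tr_mem_HeisEL_of_X hL hef he hf (sub_mem hv hz) ?_ _
      rw [sub_eq_add_neg]
      exact X_add_of_not hvX (b := -z') (by simpa using hzz)
    · exact EL_le_HeisEL hef (tr_mem_EL hz hzX _)

theorem SL_le_HeisEL (hL : S.Good L) (hef : S.ω e f = 1) (he : e ∈ L) (hf : f ∈ L)
    (hL' : S.ZeroOrHyp (L ⊓ S.perp e f)) : S.SL L e ≤ HeisEL hef L := by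
  rw [SL, Subgroup.closure_le]
  rintro _ ⟨v, hv, hX, h0, c, rfl⟩
  have h1 : v = S.ω v f • e + S.proj e f v := by rw [proj, h0]; module
  rw [h1] at hX ⊢
  exact tr_mem_HeisEL hL hef he hf hL' (proj_mem hef he hf hv) hX c

section

variable {e₀ f₀ e₁ f₁ e₂ f₂ : V} (T : S.ThreePairs e₀ f₀ e₁ f₁ e₂ f₂)

include T

theorem HeisN_comm (hef : S.ω e f = 1) {n n' : E} (hn : n ∈ S.HeisN e (L ⊓ S.perp e f))
    (hn' : n' ∈ S.HeisN e (L ⊓ S.perp e f)) : ∃ c, n * n' = S.tr e c * (n' * n) := by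
  obtain ⟨w, hw, h⟩ := HeisN_over hef hn
  obtain ⟨w', hw', h'⟩ := HeisN_over hef hn'
  exact commOver T hef hw.2 hw'.2 n n' h h'

theorem HeisN_mul_pow (hef : S.ω e f = 1) {n n' : E} (hn : n ∈ S.HeisN e (L ⊓ S.perp e f))
    (hn' : n' ∈ S.HeisN e (L ⊓ S.perp e f)) (i : ℕ) :
    ∃ c, (n * n') ^ i = S.tr e c * (n ^ i * n' ^ i) := by
  induction i with
  | zero => exact ⟨0, by simp [tr_zero (X_of_one hef)]⟩
  | succ i ih =>
    obtain ⟨c, hc⟩ := ih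
    obtain ⟨d, hd⟩ := HeisN_comm T hef (pow_mem hn' i) hn
    have h1 := HeisN_tr_comm hef (pow_mem hn i) d
    refine ⟨c + d, ?_⟩
    calc (n * n') ^ (i + 1) = S.tr e c * n ^ i * (n' ^ i * n) * n' := by rw [pow_succ, hc]; group
      _ = S.tr e c * (n ^ i * S.tr e d) * n * (n' ^ i * n') := by rw [hd]; group
      _ = _ := by rw [h1.eq, ← pow_succ, S.tr_add e (X_of_one hef), pow_succ n]; group

theorem HeisN_pow (hef : S.ω e f = 1) {n : E} (hn : n ∈ S.HeisN e (L ⊓ S.perp e f)) {M : ℕ}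
    (hM : (M : R) = 0) : ∃ c, n ^ M = S.tr e c := by
  induction hn using Subgroup.closure_induction with
  | mem g hx =>
    rcases hx with ⟨w, hw, hX, rfl⟩ | ⟨c, rfl⟩
    · exact ⟨0, by rw [nn_pow hef hX hw.2 hM, tr_zero (X_of_one hef)]⟩
    · exact ⟨M * c, (tr_nsmul (X_of_one hef) M c).symm⟩
  | one => exact ⟨0, by rw [one_pow, tr_zero (X_of_one hef)]⟩
  | mul a b ha hb iha ihb =>
    obtain ⟨c, hc⟩ := iha
    obtain ⟨d, hd⟩ := ihb
    obtain ⟨c', h⟩ := HeisN_mul_pow T hef ha hb M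
    exact ⟨c' + (c + d), by rw [h, hc, hd, S.tr_add e (X_of_one hef), S.tr_add e (X_of_one hef)]⟩
  | inv a _ ha =>
    obtain ⟨c, hc⟩ := ha
    exact ⟨-c, by rw [inv_pow, hc, tr_neg (X_of_one hef)]⟩

theorem HeisN_conj_neg (hL : S.Good L) (hef : S.ω e f = 1) (he : e ∈ L) (hf : f ∈ L) {j : E}
    (hj : S.ρ j e = -e) (hj' : ∀ v ∈ S.perp e f, S.ρ j v = v) {n : E}
    (hn : n ∈ S.HeisN e (L ⊓ S.perp e f)) : ∃ c, j * n * j⁻¹ = S.tr e c * n⁻¹ := by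
  have hX := X_of_one hef
  induction hn using Subgroup.closure_induction with
  | mem g hx =>
    rcases hx with ⟨w, hw, hwX, rfl⟩ | ⟨c, rfl⟩
    · obtain ⟨w', hw', hww⟩ := (hL.inf_perp hef he hf).exists_one hw hwX
      refine ⟨2, ?_⟩
      rw [nn_conj hef hwX (mem_perp.1 hw.2).2, hj, hj' w hw.2, eq_mul_inv_iff_mul_eq]
      exact nn_neg_mul hef hww hw.2 hw'.2
    · refine ⟨2 * c, ?_⟩
      rw [S.tr_conj e hX, hj, tr_neg_vec hX, two_mul, S.tr_add e hX, mul_inv_cancel_right]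
  | one => exact ⟨0, by simp [tr_zero hX]⟩
  | mul a b ha hb iha ihb =>
    obtain ⟨c, hc⟩ := iha
    obtain ⟨d, hd⟩ := ihb
    obtain ⟨r, hr⟩ := HeisN_comm T hef ha hb
    have h1 := (HeisN_tr_comm hef ha d).inv_left
    have h2 := HeisN_tr_comm hef (mul_mem hb ha) r
    refine ⟨c + d + r, ?_⟩
    have h3 : (a * b)⁻¹ = S.tr e (-r) * (b * a)⁻¹ := by
      rw [hr, tr_neg hX, _root_.mul_inv_rev, h2.inv_left.inv_right.eq]
    calc j * (a * b) * j⁻¹ = (j * a * j⁻¹) * (j * b * j⁻¹) := by group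
      _ = S.tr e c * (a⁻¹ * S.tr e d) * b⁻¹ := by rw [hc, hd]; group
      _ = S.tr e c * S.tr e d * (b * a)⁻¹ := by rw [h1.eq]; group
      _ = _ := by rw [h3, S.tr_add e hX, S.tr_add e hX, tr_neg hX]; group
  | inv a ha iha =>
    obtain ⟨c, hc⟩ := iha
    refine ⟨-c, ?_⟩
    calc j * a⁻¹ * j⁻¹ = (j * a * j⁻¹)⁻¹ := by group
      _ = a * (S.tr e c)⁻¹ := by rw [hc]; group
      _ = _ := by rw [(HeisN_tr_comm hef ha c).inv_right.eq, tr_neg hX, inv_inv]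

/-- The kernel is trivial on `EL L` provided it is on `EL (L ⊓ perp e f)`. -/
theorem ker_trivial_step (hL : S.Good L) (hef : S.ω e f = 1) (he : e ∈ L) (hf : f ∈ L)
    (hL' : S.ZeroOrHyp (L ⊓ S.perp e f))
    (ih : ∀ k ∈ S.EL (L ⊓ S.perp e f), S.ρ k = 1 → k = 1) {k : E} (hk : k ∈ S.EL L)
    (hk1 : S.ρ k = 1) : k = 1 := by
  have hX := X_of_one hef
  obtain ⟨n, hn, m, hm, rfl⟩ :=
    SL_le_HeisEL hL hef he hf hL' (mem_SL_of_fix hL he hX hk (ρ_of_ker hk1 e))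
  obtain ⟨w, hw, c, H⟩ := HeisN_over hef hn
  have nf : S.ρ n f = f := by
    have := ρ_of_ker hk1 f
    rwa [ρ_mul_apply, (EL_perp_fix hm).2] at this
  rw [H, hef, ω_swap_zero (mem_perp.1 hw.2).2] at nf
  have hwc : w + c • e = 0 := by simpa using nf
  have hc : c = 0 := by
    have := congrArg (S.ω f) hwc
    simpa [(mem_perp.1 hw.2).2, S.skew e f, hef] using this
  have hw0 : w = 0 := by simpa [hc] using hwc
  have hn1 : S.ρ n = 1 := by
    refine LinearEquiv.ext fun v => ?_
    rw [H, hc, hw0]; simp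
  have hm1 : m = 1 := ih m hm (by rw [← hk1, map_mul, hn1, one_mul])
  rw [hm1, mul_one]
  obtain ⟨j, hj, hj'⟩ := exists_neg hef
  obtain ⟨d, hd⟩ := HeisN_conj_neg T hL hef he hf hj hj' hn
  obtain ⟨M, ⟨r, hr⟩, hM⟩ := OddChainRing.exists_odd_cast_eq_zero (R := R)
  obtain ⟨d', hd'⟩ := HeisN_pow T hef hn hM
  have tr_one : ∀ t : R, S.ρ (S.tr e t) = 1 → S.tr e t = 1 := by
    intro t ht
    have := ρ_of_ker ht f
    rw [ρ_tr' hX, hef, mul_one, add_eq_left] at this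
    have h2 := congrArg (fun x => S.ω x f) this
    simp only [map_smul, LinearMap.smul_apply, hef, smul_eq_mul, mul_one, map_zero,
      LinearMap.zero_apply] at h2
    rw [h2, tr_zero hX]
  have n2 : n ^ 2 = 1 := by
    rw [S.ker_central n hn1, mul_inv_cancel_right, eq_mul_inv_iff_mul_eq] at hd
    rw [pow_two, hd]
    exact tr_one d (by rw [← hd, map_mul, hn1, one_mul])
  have nM : n ^ M = 1 := by
    rw [hd']; exact tr_one d' (by rw [← hd', map_pow, hn1, one_pow])
  rwa [hr, pow_succ, pow_mul, n2, one_pow, one_mul] at nM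

/-- A transvection system is faithful on the subgroup generated by transvections. -/
theorem ker_trivial {n : ℕ} (hn : S.HasRank n L) (hL : S.Good L) {k : E} (hk : k ∈ S.EL L)
    (hk1 : S.ρ k = 1) : k = 1 := by
  induction n generalizing L k with
  | zero =>
    have : S.EL L ≤ ⊥ := by
      rw [EL, Subgroup.closure_le]
      rintro _ ⟨v, hv, hX, c, rfl⟩
      obtain ⟨z, hz⟩ := hX
      rw [hn v hv, map_zero] at hz
      exact absurd hz (by simp)
    exact this hk
  | succ n ih =>
    obtain ⟨e, he, f, hf, hef, hn'⟩ := hn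
    exact ker_trivial_step T hL hef he hf hn'.zeroOrHyp
      (fun k hk hk1 => ih hn' (hL.inf_perp hef he hf) hk hk1) hk hk1

end

end TransvectionSystem
end SpH2

namespace SpH2

theorem eq_one_of_sq_of_odd {G : Type*} [Group G] {x : G} (h : x ^ 2 = 1) {M : ℕ} (hM : Odd M)
    (hx : x ^ M = 1) : x = 1 := by
  obtain ⟨r, rfl⟩ := hM
  rwa [pow_succ, pow_mul, h, one_pow, one_mul] at hx

/-- A map on a group is multiplicative on a subgroup, with commuting values. -/
structure AbelianOn {G A : Type*} [Group G] [Group A] (φ : G → A) (H : Subgroup G) : Prop where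
  map_mul : ∀ g ∈ H, ∀ h ∈ H, φ (g * h) = φ g * φ h
  comm : ∀ g ∈ H, ∀ h ∈ H, Commute (φ g) (φ h)

namespace AbelianOn

variable {G A : Type*} [Group G] [Group A] {φ : G → A} {H K : Subgroup G}

theorem mono (h : AbelianOn φ H) (hK : K ≤ H) : AbelianOn φ K :=
  ⟨fun g hg k hk => h.map_mul g (hK hg) k (hK hk), fun g hg k hk => h.comm g (hK hg) k (hK hk)⟩

theorem map_one (h : AbelianOn φ H) : φ 1 = 1 := by
  have := h.map_mul 1 (one_mem _) 1 (one_mem _)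
  simpa using this

theorem map_inv (h : AbelianOn φ H) {g : G} (hg : g ∈ H) : φ g⁻¹ = (φ g)⁻¹ := by
  have := h.map_mul g hg g⁻¹ (inv_mem hg)
  rw [mul_inv_cancel, h.map_one] at this
  exact eq_inv_of_mul_eq_one_right this.symm

theorem map_pow (h : AbelianOn φ H) {g : G} (hg : g ∈ H) (n : ℕ) : φ (g ^ n) = φ g ^ n := by
  induction n with
  | zero => simp [h.map_one]
  | succ n ih => rw [pow_succ, pow_succ, h.map_mul _ (pow_mem hg n) _ hg, ih]

theorem map_conj (h : AbelianOn φ H) {g k : G} (hg : g ∈ H) (hk : k ∈ H) : φ (g * k * g⁻¹) = φ k := by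
  rw [h.map_mul _ (mul_mem hg hk) _ (inv_mem hg), h.map_mul _ hg _ hk, h.map_inv hg,
    (h.comm _ hg _ hk).eq, mul_inv_cancel_right]

/-- A multiplicative map trivial on generators is trivial. -/
theorem eq_one_of_closure (h : AbelianOn φ H) {s : Set G} (hs : Subgroup.closure s ≤ H)
    (h1 : ∀ g ∈ s, φ g = 1) {g : G} (hg : g ∈ Subgroup.closure s) : φ g = 1 := by
  induction hg using Subgroup.closure_induction with
  | mem g hx => exact h1 g hx
  | one => exact h.map_one
  | mul a b ha hb iha ihb => rw [h.map_mul a (hs ha) b (hs hb), iha, ihb, one_mul]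
  | inv a ha iha => rw [h.map_inv (hs ha), iha, inv_one]

end AbelianOn

namespace TransvectionSystem

variable {R V E : Type*} [CommRing R] [AddCommGroup V] [Module R V] [Group E]
  {S : TransvectionSystem R V E} [OddChainRing R] {A : Type*} [Group A] {φ : E → A}

theorem exists_tr_eq_pow {x : V} (hx : S.X x) (c : R) : ∃ n : ℕ, S.tr x c = S.tr x 1 ^ n := by
  obtain ⟨n, rfl⟩ := OddChainRing.natCast_surjective c
  exact ⟨n, by rw [← tr_nsmul hx, mul_one]⟩

/-- Abelian characters vanish on the transvection group of a module containing two orthogonal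
hyperbolic pairs. -/
theorem eq_one_of_mem_EL {L : Submodule R V} (hφ : AbelianOn φ (S.EL L)) (hL : S.Good L)
    {a b c d : V} (ha : a ∈ L) (hc : c ∈ L) (hab : S.ω a b = 1) (hcd : S.ω c d = 1)
    (hc' : c ∈ S.perp a b) {g : E} (hg : g ∈ S.EL L) : φ g = 1 := by
  have hA := X_of_one hab
  have hC := X_of_one hcd
  have const : ∀ v ∈ L, S.X v → φ (S.tr v 1) = φ (S.tr a 1) := by
    intro v hv hX
    obtain ⟨g, hg, rfl⟩ := hL.transitive ha hA hv hX
    rw [← S.tr_conj a hA]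
    exact hφ.map_conj hg (tr_mem_EL ha hA 1)
  obtain ⟨h1, h2⟩ := mem_perp.1 hc'
  have x1 : S.X (a + c) := X_of_one (y := b) (by simp [hab, ω_swap_zero h2])
  have x2 : S.X (a - c) := X_of_one (y := b) (by simp [hab, ω_swap_zero h2])
  have r := S.tr_add_sub a b c hab hC h1 h2 1
  have two : ∀ v, S.X v → S.tr v (2 * 1) = S.tr v 1 ^ 2 := by
    intro v hv; rw [← tr_nsmul hv]; norm_num
  rw [two a hA, two c hC] at r
  have r' := congrArg φ r
  have m := fun {v : V} (hv : v ∈ L) (hX : S.X v) => tr_mem_EL (S := S) hv hX 1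
  rw [hφ.map_mul _ (m (add_mem ha hc) x1) _ (m (sub_mem ha hc) x2),
    hφ.map_mul _ (pow_mem (m ha hA) 2) _ (pow_mem (m hc hC) 2), hφ.map_pow (m ha hA),
    hφ.map_pow (m hc hC), const _ (add_mem ha hc) x1, const _ (sub_mem ha hc) x2,
    const _ hc hC, ← pow_two, right_eq_mul] at r'
  obtain ⟨M, hM, hM0⟩ := OddChainRing.exists_odd_cast_eq_zero (R := R)
  have r1 : φ (S.tr a 1) = 1 := by
    refine eq_one_of_sq_of_odd r' hM ?_
    rw [← hφ.map_pow (m ha hA), ← tr_nsmul hA, hM0, zero_mul, tr_zero hA, hφ.map_one]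
  refine hφ.eq_one_of_closure le_rfl ?_ hg
  rintro _ ⟨v, hv, hX, t, rfl⟩
  obtain ⟨n, hn⟩ := exists_tr_eq_pow hX t
  rw [hn, hφ.map_pow (m hv hX), const v hv hX, r1, one_pow]

variable {e₀ f₀ e₁ f₁ e₂ f₂ : V}

/-- For a faithful system the transvections generate. -/
theorem EL_top_eq_top {n : ℕ} (hρ : Function.Injective S.ρ) (hn : S.HasRank n ⊤) : S.EL ⊤ = ⊤ := by
  refine eq_top_iff.2 fun g _ => ?_
  obtain ⟨h, hh, H⟩ := exists_mem_EL_of_stab hn good_top (g := g) fun _ _ => trivial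
  rwa [hρ (ρ_ext (S := S) fun v => H v trivial)]

variable (S) in
/-- The stabilizer of a vector. -/
def stab (e : V) : Subgroup E where
  carrier := {g | S.ρ g e = e}
  one_mem' := by simp
  mul_mem' {g h} hg hh := by
    change S.ρ g e = e at hg
    change S.ρ h e = e at hh
    change S.ρ (g * h) e = e
    rw [ρ_mul_apply, hh, hg]
  inv_mem' {g} hg := ρ_inv_eq hg

/-- The stabilizer of a unimodular vector is perfect. -/
theorem eq_one_of_mem_stab {n : ℕ} (hρ : Function.Injective S.ρ)
    (T : S.ThreePairs e₀ f₀ e₁ f₁ e₂ f₂) (hn : S.HasRank n (⊤ ⊓ S.perp e₀ f₀))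
    (hφ : AbelianOn φ (S.stab e₀)) {g : E} (hg : g ∈ S.stab e₀) : φ g = 1 := by
  have hL : S.Good (⊤ ⊓ S.perp e₀ f₀) := good_top.inf_perp T.h₀ trivial trivial
  have hE := X_of_one T.h₀
  have hA := X_of_one T.h₁
  have hEL : S.EL (⊤ ⊓ S.perp e₀ f₀) ≤ S.stab e₀ := fun g hg => (EL_perp_fix hg).1
  have hHe : S.HeisN e₀ (⊤ ⊓ S.perp e₀ f₀) ≤ S.stab e₀ := fun g hg => HeisN_fix T.h₀ hg
  have levi : ∀ g ∈ S.EL (⊤ ⊓ S.perp e₀ f₀), φ g = 1 := fun g hg =>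
    eq_one_of_mem_EL (hφ.mono hEL) hL ⟨trivial, T.e₁_mem⟩ ⟨trivial, T.e₂_mem⟩ T.h₁ T.h₂ T.e₂_mem' hg
  have nm : ∀ {w}, w ∈ S.perp e₀ f₀ → S.X w → S.nn e₀ w ∈ S.stab e₀ := fun hw hX =>
    hHe (nn_mem ⟨trivial, hw⟩ hX)
  have tm : ∀ c, S.tr e₀ c ∈ S.stab e₀ := fun c => hHe (tr_mem_HeisN _ _ c)
  have const : ∀ w ∈ S.perp e₀ f₀, S.X w → φ (S.nn e₀ w) = φ (S.nn e₀ e₁) := by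
    intro w hw hX
    obtain ⟨g, hg, rfl⟩ := hL.transitive ⟨trivial, T.e₁_mem⟩ hA ⟨trivial, hw⟩ hX
    have h := nn_conj T.h₀ hA (mem_perp.1 T.e₁_mem).2 g
    rw [(EL_perp_fix hg).1] at h
    rw [← h]
    exact hφ.map_conj (hEL hg) (nm T.e₁_mem hA)
  obtain ⟨M, hM, hM0⟩ := OddChainRing.exists_odd_cast_eq_zero (R := R)
  have two : S.tr e₀ 2 = S.tr e₀ 1 ^ 2 := by rw [← tr_nsmul hE]; norm_num
  have root : φ (S.tr e₀ 1) = 1 := by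
    refine eq_one_of_sq_of_odd ?_ hM ?_
    · have hB := X_of_one' T.h₁
      have r := congrArg φ T.nn_comm_pair
      have m1 := nm T.e₁_mem hA
      have m2 := nm T.f₁_mem hB
      rw [hφ.map_mul _ (tm 2) _ (mul_mem m2 m1), hφ.map_mul _ m1 _ m2, hφ.map_mul _ m2 _ m1,
        (hφ.comm _ m1 _ m2).eq, right_eq_mul, two, hφ.map_pow (tm 1)] at r
      exact r
    · rw [← hφ.map_pow (tm 1), ← tr_nsmul hE, hM0, zero_mul, tr_zero hE, hφ.map_one]
  have roots : ∀ c, φ (S.tr e₀ c) = 1 := by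
    intro c
    obtain ⟨n, hn⟩ := exists_tr_eq_pow hE c
    rw [hn, hφ.map_pow (tm 1), root, one_pow]
  have short : φ (S.nn e₀ e₁) = 1 := by
    refine eq_one_of_sq_of_odd ?_ hM ?_
    · have e1 : S.nn e₀ e₁ * S.nn e₀ (-e₁) = S.tr e₀ 2 := by
        refine hρ (ρ_ext (S := S) fun v => ?_)
        obtain ⟨h1, h2⟩ := mem_perp.1 T.e₁_mem
        rw [ρ_mul_apply, ρ_nn T.h₀ hA h1 h2, ρ_nn T.h₀ hA.neg (by simp [h1]) (by simp [h2]), ρ_tr' hE]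
        simp only [map_add, map_smul, map_neg, LinearMap.neg_apply, S.alt, h1, ω_swap_zero h1]
        module
      have m1 := nm T.e₁_mem hA
      have m2 := nm (neg_mem T.e₁_mem) hA.neg
      have r := congrArg φ e1
      rwa [hφ.map_mul _ m1 _ m2, const _ (neg_mem T.e₁_mem) hA.neg, roots, ← pow_two] at r
    · rw [← hφ.map_pow (nm T.e₁_mem hA), nn_pow T.h₀ hA T.e₁_mem hM0, hφ.map_one]
  have heis : ∀ g ∈ S.HeisN e₀ (⊤ ⊓ S.perp e₀ f₀), φ g = 1 := by
    intro g hg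
    refine hφ.eq_one_of_closure hHe ?_ hg
    rintro _ (⟨w, hw, hX, rfl⟩ | ⟨c, rfl⟩)
    · rw [const w hw.2 hX, short]
    · exact roots c
  have hge : S.ρ g e₀ = e₀ := hg
  obtain ⟨r, hr, hrf⟩ := heis_transitive (L := ⊤) T.h₀ trivial trivial (f' := S.ρ g f₀) trivial
    (by nth_rw 1 [← hge]; rw [S.ω_ρ, T.h₀]) hn.zeroOrHyp
  have hke : S.ρ (r⁻¹ * g) e₀ = e₀ := by rw [ρ_mul_apply, hge]; exact ρ_inv_eq (hHe hr)
  have hkf : S.ρ (r⁻¹ * g) f₀ = f₀ := by rw [ρ_mul_apply]; exact ρ_inv_eq hrf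
  obtain ⟨h, hh, H⟩ := exists_mem_EL_of_stab hn hL (g := r⁻¹ * g) fun v hv => by
    have := map_mem_perp (r⁻¹ * g) hv.2
    rw [hke, hkf] at this
    exact ⟨trivial, this⟩
  have hk : r⁻¹ * g = h := by
    refine hρ (ρ_ext (S := S) fun v => ?_)
    obtain ⟨i1, i2⟩ := EL_perp_fix hh
    rw [eq_add_proj (S := S) e₀ f₀ v]
    simp only [map_add, map_smul, hke, hkf, i1, i2,
      H _ (proj_mem T.h₀ (L := ⊤) trivial trivial trivial)]
  have hgr : g = r * h := by rw [← hk]; group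
  rw [hgr, hφ.map_mul _ (hHe hr) _ (hEL hh), heis r hr, levi h hh, one_mul]

/-- The group of a faithful system is perfect. -/
theorem eq_one_of_faithful {n : ℕ} (hρ : Function.Injective S.ρ)
    (T : S.ThreePairs e₀ f₀ e₁ f₁ e₂ f₂) (hn : S.HasRank n ⊤) (hφ : AbelianOn φ ⊤) (g : E) :
    φ g = 1 :=
  eq_one_of_mem_EL (S := S) (L := ⊤) (hφ.mono le_top) good_top trivial trivial T.h₀ T.h₁ T.e₁_mem
    (by rw [EL_top_eq_top hρ hn]; trivial)

end TransvectionSystem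
end SpH2

namespace SpH2

/-- A central surjection. -/
structure CentralSurjection {E G : Type*} [Group E] [Group G] (π : E →* G) : Prop where
  surjective : Function.Surjective π
  central : ∀ k, π k = 1 → ∀ g, Commute g k

namespace TransvectionSystem

variable {M : ℕ} {V E G : Type*} [AddCommGroup V] [Module (ZMod M) V] [Group E] [Group G]
  {S : TransvectionSystem (ZMod M) V G} {π : E →* G}

variable (S π) in
/-- An equivariant choice of lifts of odd order of the transvections `S.tr x 1`. -/
structure RootLift (Q : ℕ) (t : V → E) : Prop where
  conj : ∀ x, S.X x → ∀ g, g * t x * g⁻¹ = t (S.ρ (π g) x)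
  map : ∀ x, S.X x → π (t x) = S.tr x 1
  pow_eq_one : ∀ x, S.X x → t x ^ Q = 1

variable (S) in
/-- The relation `tr_add_sub` for the lifts. -/
def AddSub (t : V → E) : Prop :=
  ∀ x x' y, S.ω x x' = 1 → S.X y → S.ω x y = 0 → S.ω x' y = 0 →
    t (x + y) * t (x - y) = t x ^ 2 * t y ^ 2

namespace RootLift

variable {Q : ℕ} {t : V → E} {x x' y : V}

theorem commute (L : RootLift S π Q t) (hx : S.X x) (hy : S.X y) (h : S.ω x y = 0) :
    Commute (t x) (t y) := by
  have := L.conj y hy (t x)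
  rw [L.map x hx, tr_fix hx h] at this
  exact mul_inv_eq_iff_eq_mul.1 this

theorem X_add (h : S.ω x x' = 1) (h' : S.ω x' y = 0) : S.X (x + y) :=
  X_of_one (y := x') (by simp [h, ω_swap_zero h'])

theorem X_sub (h : S.ω x x' = 1) (h' : S.ω x' y = 0) : S.X (x - y) :=
  X_of_one (y := x') (by simp [h, ω_swap_zero h'])

theorem commute_add_sub (L : RootLift S π Q t) (h : S.ω x x' = 1) (h0 : S.ω x y = 0)
    (h' : S.ω x' y = 0) : Commute (t (x + y)) (t (x - y)) :=
  L.commute (X_add h h') (X_sub h h') (by simp [S.alt, h0, ω_swap_zero h0])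

theorem commute_add (L : RootLift S π Q t) (h : S.ω x x' = 1) (h' : S.ω x' y = 0) {z : V} (hZ : S.X z) (h1 : S.ω x z = 0) (h2 : S.ω y z = 0) :
    Commute (t (x + y) * t (x - y)) (t z) :=
  (L.commute (X_add h h') hZ (by simp [h1, h2])).mul_left
    (L.commute (X_sub h h') hZ (by simp [h1, h2]))

end RootLift
end TransvectionSystem

namespace TransvectionSystem

variable {M : ℕ} [OddChainRing (ZMod M)] {V E G : Type*} [AddCommGroup V]
  [Module (ZMod M) V] [Group E] [Group G]
  {S : TransvectionSystem (ZMod M) V G} {π : E →* G} {e₀ f₀ e₁ f₁ e₂ f₂ : V}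

/-- Lifts of a transvection commute with the lifts of its centralizer. -/
theorem commute_of_stab {n : ℕ} (hπ : CentralSurjection π) (hρ : Function.Injective S.ρ)
    (T : S.ThreePairs e₀ f₀ e₁ f₁ e₂ f₂) (hn : S.HasRank n (⊤ ⊓ S.perp e₀ f₀)) {a : E} {c : ZMod M}
    (ha : π a = S.tr e₀ c) {g : E} (hg : S.ρ (π g) e₀ = e₀) : Commute g a := by
  set κ : E → E := fun g => a⁻¹ * g * a * g⁻¹ with hκ
  have cen : ∀ g, S.ρ (π g) e₀ = e₀ → ∀ h, Commute h (κ g) := by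
    intro g hg
    refine hπ.central _ ?_
    have := tr_comm_of_fix (X_of_one T.h₀) hg c
    simp only [hκ, map_mul, map_inv, ha, mul_assoc]
    rw [← mul_assoc (π g), this]; group
  have mul : ∀ g h, S.ρ (π h) e₀ = e₀ → κ (g * h) = κ g * κ h := by
    intro g h hh
    have : κ (g * h) = a⁻¹ * (g * (a * κ h)) * g⁻¹ := by simp only [hκ]; group
    calc κ (g * h) = a⁻¹ * g * a * (κ h * g⁻¹) := by rw [this]; group
      _ = κ g * κ h := by rw [← (cen h hh g⁻¹).eq]; simp only [hκ]; group
  obtain ⟨l, hl⟩ := hπ.surjective.hasRightInverse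
  have ker : ∀ g h, π g = π h → S.ρ (π h) e₀ = e₀ → κ g = κ h := by
    intro g h e hh
    have hk : π (g * h⁻¹) = 1 := by simp [e]
    have e1 : g = g * h⁻¹ * h := by group
    have : κ (g * h⁻¹) = 1 := by
      have := (hπ.central _ hk a⁻¹).eq
      simp only [hκ]; rw [this]; group
    rw [e1, mul _ _ hh, this, one_mul]
  have hst : ∀ x ∈ S.stab e₀, S.ρ (π (l x)) e₀ = e₀ := fun x hx => by rw [hl]; exact hx
  have hφ : AbelianOn (fun x => κ (l x)) (S.stab e₀) := by
    refine ⟨fun x hx y hy => ?_, fun x hx y hy => cen _ (hst y hy) _⟩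
    rw [← mul _ _ (hst y hy)]
    refine ker _ _ (by simp [hl _]) ?_
    rw [map_mul, ρ_mul_apply, hst y hy, hst x hx]
  have h1 := eq_one_of_mem_stab hρ T hn hφ (g := π g) hg
  have h2 : κ g = 1 := by rw [← ker _ g (hl _) hg]; exact h1
  have : a⁻¹ * g * a = g := mul_inv_eq_one.1 h2
  change g * a = a * g
  nth_rw 2 [← this]; group

/-- A lift of odd order of a transvection extends to an equivariant choice of lifts. -/
theorem exists_rootLift {n : ℕ} (hπ : CentralSurjection π) (hρ : Function.Injective S.ρ)
    (T : S.ThreePairs e₀ f₀ e₁ f₁ e₂ f₂) (hn : S.HasRank n (⊤ ⊓ S.perp e₀ f₀)) {a : E} {Q : ℕ}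
    (ha : π a = S.tr e₀ 1) (hQ : a ^ Q = 1) : ∃ t : V → E, RootLift S π Q t := by
  have hX := X_of_one T.h₀
  have ex : ∀ x, ∃ g, S.X x → S.ρ (π g) e₀ = x := by
    intro x
    by_cases hx : S.X x
    · obtain ⟨g, -, hg⟩ := good_top.transitive (S := S) (x := e₀) trivial hX trivial hx
      obtain ⟨g, rfl⟩ := hπ.surjective g
      exact ⟨g, fun _ => hg⟩
    · exact ⟨1, fun h => absurd h hx⟩
  choose s hs using ex
  have ind : ∀ x, S.X x → ∀ g, S.ρ (π g) e₀ = x → g * a * g⁻¹ = s x * a * (s x)⁻¹ := by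
    intro x hx g hg
    have := commute_of_stab hπ hρ T hn ha (g := (s x)⁻¹ * g) (by
      rw [map_mul, ρ_mul_apply, hg, map_inv]; exact ρ_inv_eq (hs x hx))
    have e : (s x)⁻¹ * g * a = a * ((s x)⁻¹ * g) := this
    have : g * a = s x * ((s x)⁻¹ * g * a) := by group
    rw [this, e]; group
  refine ⟨fun x => s x * a * (s x)⁻¹, fun x hx g => ?_, fun x hx => ?_, fun x hx => ?_⟩
  · rw [← ind _ (hx.map (π g)) (g * s x) (by rw [map_mul, ρ_mul_apply, hs x hx])]
    group
  · rw [map_mul, map_mul, map_inv, ha, S.tr_conj e₀ hX, hs x hx]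
  · rw [conj_pow, hQ]; simp

namespace RootLift

variable {Q : ℕ} {t : V → E}

/-- The lifts can be corrected to satisfy `AddSub`. -/
theorem exists_addSub (hπ : CentralSurjection π) (T : S.ThreePairs e₀ f₀ e₁ f₁ e₂ f₂)
    (L : RootLift S π Q t) (hQ : Odd Q) : ∃ t' : V → E, RootLift S π Q t' ∧ AddSub S t' := by
  have h0 := X_of_one T.h₀
  have h1 := X_of_one T.h₁
  obtain ⟨o1, o2⟩ := mem_perp.1 T.e₁_mem
  set δ := (t e₀ ^ 2 * t e₁ ^ 2)⁻¹ * (t (e₀ + e₁) * t (e₀ - e₁)) with hδ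
  have add := X_add T.h₀ o2
  have sub := X_sub T.h₀ o2
  have π2 : ∀ x, S.X x → π (t x) ^ 2 = S.tr x (2 * 1) := fun x hx => by
    rw [L.map x hx, ← tr_nsmul hx]; norm_num
  have δ1 : π δ = 1 := by
    simp only [hδ, map_mul, map_inv, map_pow]
    rw [π2 _ h0, π2 _ h1, L.map _ add, L.map _ sub, S.tr_add_sub e₀ f₀ e₁ T.h₀ h1 o1 o2]
    group
  have cen := hπ.central δ δ1
  have all : ∀ x x' y, S.ω x x' = 1 → S.X y → S.ω x y = 0 → S.ω x' y = 0 →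
      t (x + y) * t (x - y) = t x ^ 2 * t y ^ 2 * δ := by
    intro x x' y h hy i1 i2
    have hL := good_top.inf_perp h (L := ⊤) trivial trivial
    obtain ⟨z, hz, hyz⟩ := hL.exists_one ⟨trivial, mem_perp.2 ⟨i1, i2⟩⟩ hy
    obtain ⟨g, -, rfl, rfl, rfl, rfl⟩ := exists_map_pairs T h hyz (mem_perp.2 ⟨i1, i2⟩) hz.2
    obtain ⟨g, rfl⟩ := hπ.surjective g
    rw [← map_add, ← map_sub, ← L.conj _ add, ← L.conj _ sub, ← L.conj _ h0, ← L.conj _ h1,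
      conj_pow, conj_pow]
    have : t (e₀ + e₁) * t (e₀ - e₁) = t e₀ ^ 2 * t e₁ ^ 2 * δ := by rw [hδ]; group
    calc g * t (e₀ + e₁) * g⁻¹ * (g * t (e₀ - e₁) * g⁻¹)
        = g * (t (e₀ + e₁) * t (e₀ - e₁)) * g⁻¹ := by group
      _ = g * (t e₀ ^ 2 * t e₁ ^ 2) * (δ * g⁻¹) := by rw [this]; group
      _ = _ := by rw [← (cen g⁻¹).eq]; group
  have δQ : δ ^ Q = 1 := by
    have c1 : Commute (t e₀ ^ 2) (t e₁ ^ 2) := (L.commute h0 h1 o1).pow_pow 2 2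
    have c2 := L.commute_add_sub T.h₀ o1 o2
    rw [hδ, Commute.mul_pow, inv_pow, c1.mul_pow, c2.mul_pow, L.pow_eq_one _ add,
      L.pow_eq_one _ sub, ← pow_mul, ← pow_mul, mul_comm 2, pow_mul, pow_mul, L.pow_eq_one _ h0,
      L.pow_eq_one _ h1]
    · simp
    · refine (Commute.inv_left ?_)
      have a1 := L.commute_add T.h₀ o2 h0 (S.alt _) (ω_swap_zero o1)
      have a2 := L.commute_add T.h₀ o2 h1 o1 (S.alt _)
      exact ((a1.pow_right 2).mul_right (a2.pow_right 2)).symm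
  obtain ⟨r, hr⟩ := hQ
  have cr : ∀ g, Commute g (δ ^ (r + 1)) := fun g => (cen g).pow_right _
  have e2 : δ ^ (r + 1) * δ ^ (r + 1) = δ := by
    rw [← pow_add, show r + 1 + (r + 1) = Q + 1 by omega, pow_succ, δQ, one_mul]
  refine ⟨fun x => t x * δ ^ (r + 1), ⟨fun x hx g => ?_, fun x hx => ?_, fun x hx => ?_⟩, ?_⟩
  · rw [← L.conj x hx g, ← mul_assoc, mul_assoc, ← (cr g⁻¹).eq, ← mul_assoc]
  · rw [map_mul, map_pow, δ1, L.map x hx]; simp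
  · rw [(cr _).mul_pow, L.pow_eq_one x hx, ← pow_mul, mul_comm, pow_mul, δQ]; simp
  · intro x x' y h hy i1 i2
    have sq : ∀ z, (t z * δ ^ (r + 1)) ^ 2 = t z ^ 2 * δ := fun z => by
      rw [(cr _).mul_pow, pow_two (δ ^ (r + 1)), e2]
    rw [sq, sq, mul_assoc, ← mul_assoc _ (t (x - y)), ← (cr (t (x - y))).eq,
      mul_assoc (t (x - y)), e2, ← mul_assoc, all x x' y h hy i1 i2, mul_assoc (t x ^ 2) δ,
      ← mul_assoc δ, ← (cen _).eq]
    group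

theorem pow_level_eq_one (hπ : CentralSurjection π) (T : S.ThreePairs e₀ f₀ e₁ f₁ e₂ f₂)
    (L : RootLift S π Q t) (hQ : Odd Q) (A : AddSub S t) {x : V} (hx : S.X x) : t x ^ M = 1 := by
  have h0 := X_of_one T.h₀
  have h1 := X_of_one T.h₁
  obtain ⟨o1, o2⟩ := mem_perp.1 T.e₁_mem
  have one : π (t e₀ ^ M) = 1 := by
    rw [map_pow, L.map _ h0, ← tr_nsmul h0]; simp [tr_zero h0]
  have cen := hπ.central _ one
  have const : ∀ x, S.X x → t x ^ M = t e₀ ^ M := by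
    intro x hx
    obtain ⟨g, -, rfl⟩ := good_top.transitive (S := S) (x := e₀) trivial h0 trivial hx
    obtain ⟨g, rfl⟩ := hπ.surjective g
    rw [← L.conj _ h0, conj_pow, (cen g).eq]; group
  rw [const x hx]
  have c1 : Commute (t e₀ ^ 2) (t e₁ ^ 2) := (L.commute h0 h1 o1).pow_pow 2 2
  have c2 := L.commute_add_sub T.h₀ o1 o2
  have r := congrArg (· ^ M) (A e₀ f₀ e₁ T.h₀ h1 o1 o2)
  simp only [c1.mul_pow, c2.mul_pow, const _ (X_add T.h₀ o2), const _ (X_sub T.h₀ o2), ← pow_mul,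
    mul_comm 2] at r
  rw [pow_mul, pow_mul, const _ h1, ← pow_two, left_eq_mul] at r
  refine eq_one_of_sq_of_odd r hQ ?_
  rw [← pow_mul, mul_comm, pow_mul, L.pow_eq_one _ h0, one_pow]

theorem pow_val (hπ : CentralSurjection π) (T : S.ThreePairs e₀ f₀ e₁ f₁ e₂ f₂)
    (L : RootLift S π Q t) (hQ : Odd Q) (A : AddSub S t) {x : V} (hx : S.X x) {n : ℕ} {c : ZMod M}
    (hc : (n : ZMod M) = c) : t x ^ c.val = t x ^ n := by
  rw [← hc, ZMod.val_natCast, ← pow_eq_pow_mod _ (L.pow_level_eq_one hπ T hQ A hx)]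

variable [NeZero M]

theorem smul_eq_pow (hπ : CentralSurjection π) (T : S.ThreePairs e₀ f₀ e₁ f₁ e₂ f₂)
    (L : RootLift S π Q t) (hQ : Odd Q) (hM : Odd M) (A : AddSub S t) {x : V} (hx : S.X x)
    {u : ZMod M} (hu : IsUnit u) : t (u • x) = t x ^ (u ^ 2).val := by
  set n := (u ^ 2).val with hn
  have h0 := X_of_one T.h₀
  have h1 := X_of_one T.h₁
  obtain ⟨o1, o2⟩ := mem_perp.1 T.e₁_mem
  set μ := t (u • e₀) * (t e₀ ^ n)⁻¹ with hμ
  have one : π μ = 1 := by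
    rw [hμ, map_mul, map_inv, map_pow, L.map _ h0, L.map _ (h0.smul hu), ← tr_nsmul h0,
      S.tr_smul _ h0 u hu, hn, ZMod.natCast_zmod_val, mul_inv_cancel]
  have cen := hπ.central _ one
  have const : ∀ x, S.X x → t (u • x) = t x ^ n * μ := by
    intro x hx
    obtain ⟨g, -, rfl⟩ := good_top.transitive (S := S) (x := e₀) trivial h0 trivial hx
    obtain ⟨g, rfl⟩ := hπ.surjective g
    have e : t (u • e₀) = μ * t e₀ ^ n := by rw [hμ]; group
    rw [← map_smul, ← L.conj _ h0, ← L.conj _ (h0.smul hu), conj_pow, e, ← (cen _).eq, mul_assoc,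
      mul_assoc _ μ, ← (cen g⁻¹).eq]
    group
  have c1 : Commute (t e₀ ^ 2) (t e₁ ^ 2) := (L.commute h0 h1 o1).pow_pow 2 2
  have c2 := L.commute_add_sub T.h₀ o1 o2
  obtain ⟨v, rfl⟩ := hu
  have r := A (v.1 • e₀) ((↑v⁻¹ : ZMod M) • f₀) (v.1 • e₁) (by simp [T.h₀]) (h1.smul v.isUnit)
    (by simp [o1]) (by simp [o2])
  rw [← smul_add, ← smul_sub, const _ (X_add T.h₀ o2), const _ (X_sub T.h₀ o2), const _ h0,
    const _ h1, (cen _).mul_pow, (cen _).mul_pow, (cen _).symm.mul_mul_mul_comm,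
    ((cen _).symm.pow_left 2).mul_mul_mul_comm, ← c2.mul_pow, A e₀ f₀ e₁ T.h₀ h1 o1 o2, ← pow_mul,
    ← pow_mul, mul_comm n, pow_mul, pow_mul, ← c1.mul_pow, mul_right_inj, ← pow_two,
    left_eq_mul] at r
  have μ1 : μ = 1 := by
    refine eq_one_of_sq_of_odd r hM ?_
    have := L.pow_level_eq_one hπ T hQ A (h0.smul v.isUnit)
    rwa [const _ h0, (cen _).mul_pow, ← pow_mul, mul_comm, pow_mul,
      L.pow_level_eq_one hπ T hQ A h0, one_pow, one_mul] at this
  rw [const x hx, μ1, mul_one]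

/-- The lifted transvection system. -/
def system (hπ : CentralSurjection π) (hρ : Function.Injective S.ρ)
    (T : S.ThreePairs e₀ f₀ e₁ f₁ e₂ f₂)
    (L : RootLift S π Q t) (hQ : Odd Q) (hM : Odd M) (A : AddSub S t) :
    TransvectionSystem (ZMod M) V E where
  ω := S.ω
  ρ := S.ρ.comp π
  tr x c := t x ^ c.val
  alt := S.alt
  ω_ρ g := S.ω_ρ (π g)
  ker_central k hk g := hπ.central k (hρ (by rw [map_one]; exact hk)) g
  ρ_tr x hx c v := by
    rw [MonoidHom.comp_apply, map_pow, L.map x hx, ← tr_nsmul hx, ZMod.natCast_zmod_val, mul_one,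
      S.ρ_tr x hx]
  tr_add x hx c d := by
    rw [← pow_add]
    exact L.pow_val hπ T hQ A hx (by simp)
  tr_conj x hx g c := by
    rw [← conj_pow, L.conj x hx]; rfl
  tr_smul x hx u hu c := by
    rw [L.smul_eq_pow hπ T hQ hM A hx hu, ← pow_mul]
    exact (L.pow_val hπ T hQ A hx (by simp)).symm
  tr_add_sub x x' y h hy h0 h' c := by
    have hx : S.X x := X_of_one h
    have c1 : Commute (t x ^ 2) (t y ^ 2) := (L.commute hx hy h0).pow_pow 2 2
    rw [← (L.commute_add_sub h h0 h').mul_pow, A x x' y h hy h0 h', c1.mul_pow, ← pow_mul,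
      ← pow_mul, L.pow_val hπ T hQ A hx (n := 2 * c.val) (by simp),
      L.pow_val hπ T hQ A hy (n := 2 * c.val) (by simp)]

end RootLift

theorem HasRank.congr {R V E E' : Type*} [CommRing R] [AddCommGroup V] [Module R V] [Group E] [Group E']
    {S : TransvectionSystem R V E} {S' : TransvectionSystem R V E'} (h : S'.ω = S.ω) {n : ℕ}
    {L : Submodule R V} (hn : S.HasRank n L) : S'.HasRank n L := by
  induction n generalizing L with
  | zero => exact hn
  | succ n ih =>
    obtain ⟨e, he, f, hf, hef, H⟩ := hn
    refine ⟨e, he, f, hf, by rw [h, hef], ?_⟩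
    have : S'.perp e f = S.perp e f := by rw [perp, perp, h]
    rw [this]
    exact ih H

theorem exists_odd_pow_mul {K : ℕ} (hK : K ≠ 0) (M : ℕ) (hM : Odd M) :
    ∃ Q r m : ℕ, Odd Q ∧ r = 1 + M * m ∧ M * K ∣ r * Q := by
  obtain ⟨s, Q, hQ, rfl⟩ := Nat.exists_eq_two_pow_mul_odd hK
  obtain ⟨d, hd⟩ : 2 ^ s ∣ (M + 1) ^ s := pow_dvd_pow_of_dvd hM.add_one.two_dvd s
  have hm : ∃ m, (M + 1) ^ s = 1 + M * m := by
    clear hd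
    induction s with
    | zero => exact ⟨0, by simp⟩
    | succ s ih =>
      obtain ⟨m, hm⟩ := ih (fun h => hK (by rw [pow_succ, mul_right_comm, h, zero_mul]))
      exact ⟨1 + m * (M + 1), by rw [pow_succ, hm]; ring⟩
  obtain ⟨m, hm⟩ := hm
  exact ⟨M * Q, _, m, hM.mul hQ, hm, ⟨d, by rw [hd]; ring⟩⟩

variable [NeZero M]

/-- A central surjection with finite kernel onto the group of a faithful system splits. -/
theorem exists_section {n n' : ℕ} (hπ : CentralSurjection π) (hρ : Function.Injective S.ρ) (hM : Odd M)
    (T : S.ThreePairs e₀ f₀ e₁ f₁ e₂ f₂) (hn : S.HasRank n (⊤ ⊓ S.perp e₀ f₀))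
    (hn' : S.HasRank n' ⊤) {K : ℕ} (hK : K ≠ 0) (hK' : ∀ k, π k = 1 → k ^ K = 1) :
    ∃ s : G →* E, ∀ g, π (s g) = g := by
  have h0 := X_of_one T.h₀
  obtain ⟨a, ha⟩ := hπ.surjective (S.tr e₀ 1)
  obtain ⟨Q, r, m, hQ, hr, hd⟩ := exists_odd_pow_mul hK M hM
  have hM0 : S.tr e₀ 1 ^ M = 1 := by rw [← tr_nsmul h0]; simp [tr_zero h0]
  have aMK : a ^ (M * K) = 1 := by
    rw [pow_mul]; exact hK' _ (by rw [map_pow, ha, hM0])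
  obtain ⟨t, L⟩ := exists_rootLift hπ hρ T hn (a := a ^ r) (Q := Q)
    (by rw [map_pow, ha, hr, pow_add, pow_mul, hM0]; simp)
    (by rw [← pow_mul]; obtain ⟨d, hd⟩ := hd; rw [hd, pow_mul, aMK, one_pow])
  obtain ⟨t, L, A⟩ := L.exists_addSub hπ T hQ
  set S' := L.system hπ hρ T hQ hM A with hS'
  have T' : S'.ThreePairs e₀ f₀ e₁ f₁ e₂ f₂ :=
    ⟨T.h₀, T.h₁, T.h₂, T.e₁_mem, T.f₁_mem, T.e₂_mem, T.f₂_mem, T.e₂_mem', T.f₂_mem'⟩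
  have hR : S'.HasRank n' ⊤ := HasRank.congr (S := S) (S' := S') rfl hn'
  set π' := π.comp (S'.EL ⊤).subtype with hπ'
  have inj : Function.Injective π' := by
    rw [injective_iff_map_eq_one]
    rintro ⟨k, hk⟩ h
    refine Subtype.ext (ker_trivial T' hR good_top hk ?_)
    change S.ρ (π k) = 1
    rw [show π k = 1 from h, map_one]
  have surj : Function.Surjective π' := by
    rw [← MonoidHom.range_eq_top, eq_top_iff, ← EL_top_eq_top hρ hn', EL, Subgroup.closure_le]
    rintro _ ⟨v, hv, hX, c, rfl⟩
    refine ⟨⟨S'.tr v c, tr_mem_EL (S := S') hv hX c⟩, ?_⟩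
    change π (t v ^ c.val) = _
    rw [map_pow, L.map v hX, ← tr_nsmul hX, ZMod.natCast_zmod_val, mul_one]
  let e := MulEquiv.ofBijective π' ⟨inj, surj⟩
  refine ⟨(S'.EL ⊤).subtype.comp e.symm.toMonoidHom, fun g => ?_⟩
  exact e.apply_symm_apply g

end TransvectionSystem
end SpH2

namespace SpH2

section ZMod

variable {p : ℕ} [Fact p.Prime] {k : ℕ}

theorem zmod_eq_pow_mul_unit (a : ZMod (p ^ k)) (ha : a ≠ 0) :
    ∃ (i : ℕ) (u : ZMod (p ^ k)), IsUnit u ∧ a = (p : ZMod (p ^ k)) ^ i * u := by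
  have hp : p.Prime := Fact.out
  have hv : a.val ≠ 0 := by simpa using ha
  obtain ⟨i, n, hn, h⟩ := Nat.exists_eq_pow_mul_and_not_dvd hv p hp.ne_one
  refine ⟨i, n, (ZMod.isUnit_iff_coprime _ _).2 ?_, ?_⟩
  · exact (((Nat.Prime.coprime_iff_not_dvd hp).2 hn).pow_left k).symm
  · rw [← ZMod.natCast_zmod_val a, h]; push_cast; rfl

theorem zmod_dvd_total (a b : ZMod (p ^ k)) : a ∣ b ∨ b ∣ a := by
  by_cases ha : a = 0
  · exact .inr (ha ▸ dvd_zero b)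
  by_cases hb : b = 0
  · exact .inl (hb ▸ dvd_zero a)
  obtain ⟨i, u, hu, rfl⟩ := zmod_eq_pow_mul_unit a ha
  obtain ⟨j, v, hv, rfl⟩ := zmod_eq_pow_mul_unit b hb
  rw [hu.mul_right_dvd, hv.dvd_mul_right, hv.mul_right_dvd, hu.dvd_mul_right]
  exact (le_total i j).imp (pow_dvd_pow _) (pow_dvd_pow _)

theorem exists_nonsquare_add_field (hp : p ≠ 2) :
    ∃ a b : ZMod p, a + b = 1 ∧ ¬ IsSquare a ∧ ¬ IsSquare b := by
  obtain ⟨n, hn⟩ := FiniteField.exists_nonsquare (F := ZMod p) (by rwa [ZMod.ringChar_zmod_n])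
  obtain ⟨x, y, hxy⟩ := ZMod.sq_add_sq p n
  have hn0 : n ≠ 0 := fun h => hn (h ▸ IsSquare.zero)
  have key : ∀ z : ZMod p, z ≠ 0 → ¬ IsSquare (z ^ 2 / n) := by
    rintro z hz ⟨r, hr⟩
    have hr0 : r ≠ 0 := by
      rintro rfl
      simp [hz, hn0] at hr
    refine hn ⟨z / r, ?_⟩
    field_simp at hr ⊢
    linear_combination -hr
  refine ⟨x ^ 2 / n, y ^ 2 / n, by rw [← add_div, hxy, div_self hn0], key x ?_, key y ?_⟩
  · rintro rfl
    exact hn ⟨y, by rw [← hxy]; ring⟩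
  · rintro rfl
    exact hn ⟨x, by rw [← hxy]; ring⟩

theorem oddChainRing_zmod (hp : p ≠ 2) (hk : k ≠ 0) : OddChainRing (ZMod (p ^ k)) := by
  have hpp : p.Prime := Fact.out
  have : Fact (1 < p ^ k) := ⟨Nat.one_lt_pow hk hpp.one_lt⟩
  have hloc : IsLocalRing (ZMod (p ^ k)) := by
    refine IsLocalRing.of_isUnit_or_isUnit_one_sub_self fun a => ?_
    refine (zmod_dvd_total a (1 - a)).imp (fun h => ?_) (fun h => ?_)
    · exact isUnit_of_dvd_one ((dvd_sub_self_right).1 h)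
    · exact isUnit_of_dvd_one (by simpa using dvd_add h (dvd_refl (1 - a)))
  refine { hloc with
    exists_odd_cast_eq_zero := ⟨p ^ k, (hpp.odd_of_ne_two hp).pow, ZMod.natCast_self _⟩
    natCast_surjective := fun r => ⟨r.val, ZMod.natCast_zmod_val r⟩
    dvd_total := zmod_dvd_total
    units_cyclic := ZMod.isCyclic_units_of_prime_pow p hpp hp k
    exists_nonsquare_add := ?_ }
  obtain ⟨a, b, hab, ha, hb⟩ := exists_nonsquare_add_field hp
  let f : ZMod (p ^ k) →+* ZMod p := ZMod.castHom (dvd_pow_self p hk) (ZMod p)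
  obtain ⟨a', rfl⟩ := ZMod.ringHom_surjective f a
  have hb' : b = f (1 - a') := by rw [map_sub, map_one, ← hab]; ring
  have hu : ∀ c : ZMod (p ^ k), ¬ IsSquare (f c) → IsUnit c := by
    intro c hc
    by_contra h
    have hc0 : f c ≠ 0 := fun h => hc (h ▸ IsSquare.zero)
    obtain ⟨i, u, hu, rfl⟩ := zmod_eq_pow_mul_unit c (fun h => hc0 (by rw [h, map_zero]))
    rcases i with _ | i
    · exact h (by simpa using hu)
    · exact hc0 (by simp)
  have hns : ∀ (c : ZMod (p ^ k)) (hc : ¬ IsSquare (f c)), ¬ IsSquare (hu c hc).unit := by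
    rintro c hc ⟨r, hr⟩
    refine hc ⟨f r, ?_⟩
    rw [← map_mul, ← Units.val_mul, ← hr, IsUnit.unit_spec]
  rw [hb'] at hb
  exact ⟨_, _, by simp, hns a' ha, hns (1 - a') hb⟩

end ZMod

end SpH2

namespace SpH2

namespace TransvectionSystem

variable {R V E : Type*} [CommRing R] [AddCommGroup V] [Module R V] [Group E]

/-- For a faithful action the axioms of a transvection system are automatic. -/
def ofFaithful (ω : V →ₗ[R] V →ₗ[R] R) (ρ : E →* (V ≃ₗ[R] V)) (tr : V → R → E)
    (hρ : Function.Injective ρ) (alt : ∀ x, ω x x = 0) (ω_ρ : ∀ g x y, ω (ρ g x) (ρ g y) = ω x y)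
    (ρ_tr : ∀ x c v, ρ (tr x c) v = v + (c * ω x v) • x) : TransvectionSystem R V E :=
  have mul_apply : ∀ g h v, ρ (g * h) v = ρ g (ρ h v) := fun g h v => by rw [map_mul]; rfl
  { ω := ω
    ρ := ρ
    tr := tr
    alt := alt
    ω_ρ := ω_ρ
    ker_central := fun k hk g => by rw [hρ (hk.trans (map_one ρ).symm)]; simp
    ρ_tr := fun x _ => ρ_tr x
    tr_add := fun x _ c d => hρ <| LinearEquiv.ext fun v => by
      simp only [mul_apply, ρ_tr, map_add, map_smul, alt]
      module
    tr_conj := fun x _ g c => hρ <| LinearEquiv.ext fun v => by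
      have h : ρ g (ρ g⁻¹ v) = v := by rw [← mul_apply]; simp
      rw [mul_apply, mul_apply, ρ_tr, ρ_tr, map_add, map_smul, h, ← ω_ρ g, h]
    tr_smul := fun x _ u _ c => hρ <| LinearEquiv.ext fun v => by
      simp only [ρ_tr, map_smul, LinearMap.smul_apply]
      module
    tr_add_sub := fun x x' y _ _ h0 _ c => hρ <| LinearEquiv.ext fun v => by
      have h1 : ω y x = 0 := by
        have := alt (x + y)
        simpa [alt, h0] using this
      simp only [mul_apply, ρ_tr, map_add, map_sub, map_smul, alt, h0, h1, LinearMap.add_apply,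
        LinearMap.sub_apply]
      module }

end TransvectionSystem

section Symplectic

variable (l R : Type*) [DecidableEq l] [Fintype l] [CommRing R]

/-- The standard symplectic form. -/
noncomputable def stdForm : (l ⊕ l → R) →ₗ[R] (l ⊕ l → R) →ₗ[R] R := Matrix.toBilin' (-J l R)

/-- The standard representation. -/
noncomputable def stdRep : symplecticGroup l R →* ((l ⊕ l → R) ≃ₗ[R] (l ⊕ l → R)) :=
  (LinearMap.GeneralLinearGroup.generalLinearEquiv R (l ⊕ l → R)).toMonoidHom.comp
    (MonoidHom.toHomUnits
      (((Matrix.toLinAlgEquiv' (R := R) (n := l ⊕ l)) :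
        Matrix (l ⊕ l) (l ⊕ l) R →* Module.End R (l ⊕ l → R)).comp (symplecticGroup l R).subtype))

variable {l R}

theorem stdForm_apply (v w : l ⊕ l → R) : stdForm l R v w = v ⬝ᵥ (-J l R) *ᵥ w :=
  Matrix.toBilin'_apply' _ _ _

theorem stdForm_eq_sum (v w : l ⊕ l → R) : stdForm l R v w =
    ∑ i, v (Sum.inl i) * w (Sum.inr i) - ∑ i, v (Sum.inr i) * w (Sum.inl i) := by
  simp [stdForm_apply, J, Matrix.mulVec, dotProduct, Fintype.sum_sum_type, Matrix.one_apply,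
    sub_eq_add_neg]

theorem stdForm_inl (i : l) (v : l ⊕ l → R) :
    stdForm l R (Pi.single (Sum.inl i) 1) v = v (Sum.inr i) := by
  simp [stdForm_eq_sum, Pi.single_apply]

theorem stdForm_inr (i : l) (v : l ⊕ l → R) :
    stdForm l R (Pi.single (Sum.inr i) 1) v = -v (Sum.inl i) := by
  simp [stdForm_eq_sum, Pi.single_apply]

theorem stdForm_mulVec (A : Matrix (l ⊕ l) (l ⊕ l) R) (v w : l ⊕ l → R) :
    stdForm l R (A *ᵥ v) (A *ᵥ w) = Matrix.toBilin' (-(Aᵀ * J l R * A)) v w := by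
  rw [stdForm_apply, Matrix.toBilin'_apply', ← Matrix.vecMul_transpose, ← Matrix.dotProduct_mulVec,
    Matrix.mulVec_mulVec, Matrix.mulVec_mulVec]
  simp [Matrix.mul_assoc]

theorem mem_symplecticGroup_iff_form (A : Matrix (l ⊕ l) (l ⊕ l) R) :
    A ∈ symplecticGroup l R ↔ ∀ v w, stdForm l R (A *ᵥ v) (A *ᵥ w) = stdForm l R v w := by
  rw [SymplecticGroup.mem_iff']
  refine ⟨fun h v w => by rw [stdForm_mulVec, h]; rfl, fun h => ?_⟩
  have : Matrix.toBilin' (-(Aᵀ * J l R * A)) = Matrix.toBilin' (-J l R) :=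
    LinearMap.ext₂ fun v w => by rw [← stdForm_mulVec, h]; rfl
  exact neg_injective (Matrix.toBilin'.injective this)

theorem stdForm_alt (x : l ⊕ l → R) : stdForm l R x x = 0 := by
  simp [stdForm_eq_sum, mul_comm]

theorem stdForm_skew (x y : l ⊕ l → R) : stdForm l R y x = -stdForm l R x y := by
  have h := stdForm_alt (x + y)
  simp only [map_add, LinearMap.add_apply, stdForm_alt] at h
  linear_combination h

/-- The matrix of a transvection. -/
def transvectionMatrix (x : l ⊕ l → R) (c : R) : Matrix (l ⊕ l) (l ⊕ l) R :=
  1 + c • Matrix.vecMulVec x (x ᵥ* (-J l R))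

theorem transvectionMatrix_mulVec (x : l ⊕ l → R) (c : R) (v : l ⊕ l → R) :
    transvectionMatrix x c *ᵥ v = v + (c * stdForm l R x v) • x := by
  rw [transvectionMatrix, Matrix.add_mulVec, Matrix.one_mulVec, Matrix.smul_mulVec,
    Matrix.vecMulVec_mulVec, stdForm_apply, Matrix.dotProduct_mulVec, mul_smul]
  simp

theorem transvectionMatrix_mem (x : l ⊕ l → R) (c : R) :
    transvectionMatrix x c ∈ symplecticGroup l R := by
  rw [mem_symplecticGroup_iff_form]
  intro v w
  simp only [transvectionMatrix_mulVec, map_add, map_smul, LinearMap.add_apply,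
    LinearMap.smul_apply, stdForm_alt, stdForm_skew x v, smul_eq_mul]
  ring

theorem stdRep_injective : Function.Injective (stdRep l R) := by
  intro A B h
  refine Subtype.ext (Matrix.ext_of_mulVec_single fun i => ?_)
  exact LinearEquiv.congr_fun h (Pi.single i 1)

variable (l R) in
/-- The transvection system of the symplectic group. -/
noncomputable def stdSystem : TransvectionSystem R (l ⊕ l → R) (symplecticGroup l R) :=
  .ofFaithful (stdForm l R) (stdRep l R)
    (fun x c => ⟨transvectionMatrix x c, transvectionMatrix_mem x c⟩) stdRep_injective stdForm_alt
    (fun A => (mem_symplecticGroup_iff_form A.1).1 A.2) transvectionMatrix_mulVec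

end Symplectic

section Rank

variable {R : Type*} [CommRing R] {g : ℕ}

/-- The vectors whose first `2 * m` coordinates vanish. -/
def tail (R : Type*) [CommRing R] (g m : ℕ) : Submodule R (Fin g ⊕ Fin g → R) where
  carrier := {v | ∀ i : Fin g, i.1 < m → v (Sum.inl i) = 0 ∧ v (Sum.inr i) = 0}
  add_mem' hv hw i hi := by simp [hv i hi, hw i hi]
  zero_mem' i _ := by simp
  smul_mem' c v hv i hi := by simp [hv i hi]

theorem mem_tail {m : ℕ} {v : Fin g ⊕ Fin g → R} :
    v ∈ tail R g m ↔ ∀ i : Fin g, i.1 < m → v (Sum.inl i) = 0 ∧ v (Sum.inr i) = 0 := Iff.rfl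

theorem tail_zero : tail R g 0 = ⊤ := eq_top_iff.2 fun _ _ => mem_tail.2 (by simp)

theorem mem_std_perp {i : Fin g} {v : Fin g ⊕ Fin g → R} :
    v ∈ (stdSystem (Fin g) R).perp (Pi.single (Sum.inl i) 1) (Pi.single (Sum.inr i) 1) ↔
      v (Sum.inl i) = 0 ∧ v (Sum.inr i) = 0 := by
  rw [TransvectionSystem.mem_perp]
  change stdForm _ _ _ _ = 0 ∧ stdForm _ _ _ _ = 0 ↔ _
  rw [stdForm_inl, stdForm_inr, neg_eq_zero, and_comm]

theorem tail_inf_perp {m : ℕ} (hm : m < g) :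
    tail R g m ⊓ (stdSystem (Fin g) R).perp (Pi.single (Sum.inl ⟨m, hm⟩) 1)
      (Pi.single (Sum.inr ⟨m, hm⟩) 1) = tail R g (m + 1) := by
  ext v
  rw [Submodule.mem_inf, mem_std_perp, mem_tail, mem_tail]
  refine ⟨fun h i hi => ?_, fun h => ⟨fun i hi => h i (by omega), h ⟨m, hm⟩ (by simp)⟩⟩
  rcases Nat.lt_succ_iff_lt_or_eq.1 hi with h' | h'
  · exact h.1 i h'
  · obtain rfl : i = ⟨m, hm⟩ := Fin.ext h'
    exact h.2

theorem hasRank_tail (n m : ℕ) (h : m + n = g) : (stdSystem (Fin g) R).HasRank n (tail R g m) := by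
  induction n generalizing m with
  | zero =>
    intro v hv
    ext (i | i)
    · exact (hv i (by omega)).1
    · exact (hv i (by omega)).2
  | succ n ih =>
    have hm : m < g := by omega
    refine ⟨Pi.single (Sum.inl ⟨m, hm⟩) 1, mem_tail.2 fun i hi => ?_,
      Pi.single (Sum.inr ⟨m, hm⟩) 1, mem_tail.2 fun i hi => ?_, ?_, ?_⟩
    · have : i ≠ ⟨m, hm⟩ := fun h => by simp [h] at hi
      simp [this]
    · have : i ≠ ⟨m, hm⟩ := fun h => by simp [h] at hi
      simp [this]
    · exact (stdForm_inl _ _).trans (by simp)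
    · rw [tail_inf_perp]
      exact ih (m + 1) (by omega)

theorem threePairs_std (hg : 3 ≤ g) : (stdSystem (Fin g) R).ThreePairs
    (Pi.single (Sum.inl ⟨0, by omega⟩) 1) (Pi.single (Sum.inr ⟨0, by omega⟩) 1)
    (Pi.single (Sum.inl ⟨1, by omega⟩) 1) (Pi.single (Sum.inr ⟨1, by omega⟩) 1)
    (Pi.single (Sum.inl ⟨2, by omega⟩) 1) (Pi.single (Sum.inr ⟨2, by omega⟩) 1) := by
  constructor
  iterate 3 exact (stdForm_inl _ _).trans (by simp)
  all_goals exact mem_std_perp.2 (by simp)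

end Rank

end SpH2

namespace SpH2

/-- `G` is perfect and every central surjection onto `G` with kernel of finite exponent splits. -/
structure SplitsCentral (G : Type) [Group G] : Prop where
  exists_section : ∀ (E : Type) [Group E] (π : E →* G), CentralSurjection π → ∀ K : ℕ, K ≠ 0 →
    (∀ k, π k = 1 → k ^ K = 1) → ∃ s : G →* E, ∀ g, π (s g) = g
  perfect : ∀ (E : Type) [Group E] (φ : G → E), AbelianOn φ ⊤ → ∀ g, φ g = 1

namespace SplitsCentral

variable {G H : Type} [Group G] [Group H]

theorem of_subsingleton [Subsingleton G] : SplitsCentral G where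
  exists_section _ _ _ _ _ _ _ := ⟨1, fun _ => Subsingleton.elim _ _⟩
  perfect _ _ _ hφ g := by rw [Subsingleton.elim g 1, hφ.map_one]

theorem exists_lift (hG : SplitsCentral G) {E : Type} [Group E] {π : E →* H}
    (hπ : CentralSurjection π) {K : ℕ} (hK : K ≠ 0) (hK' : ∀ k, π k = 1 → k ^ K = 1) (f : G →* H) :
    ∃ s : G →* E, ∀ g, π (s g) = f g := by
  let P := (π.comp (MonoidHom.fst E G)).eqLocus (f.comp (MonoidHom.snd E G))
  have hP : ∀ x : P, π x.1.1 = f x.1.2 := fun x => x.2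
  let q : P →* G := (MonoidHom.snd E G).comp P.subtype
  have hk : ∀ k : P, q k = 1 → π k.1.1 = 1 := by
    intro k h
    rw [hP k, show k.1.2 = 1 from h, map_one]
  have hq : CentralSurjection q := by
    refine ⟨fun g => ?_, fun k h x => Subtype.ext (Prod.ext ?_ ?_)⟩
    · obtain ⟨e, he⟩ := hπ.surjective (f g)
      exact ⟨⟨(e, g), he⟩, rfl⟩
    · exact hπ.central _ (hk k h) x.1.1
    · change x.1.2 * k.1.2 = k.1.2 * x.1.2
      rw [show k.1.2 = 1 from h]; simp
  have hqK : ∀ k, q k = 1 → k ^ K = 1 := by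
    refine fun k h => Subtype.ext (Prod.ext (hK' _ (hk k h)) ?_)
    change k.1.2 ^ K = 1
    rw [show k.1.2 = 1 from h, one_pow]
  obtain ⟨s, hs⟩ := hG.exists_section P q hq K hK hqK
  refine ⟨((MonoidHom.fst E G).comp P.subtype).comp s, fun g => ?_⟩
  exact (hP (s g)).trans (congrArg f (hs g))

theorem _root_.SpH2.AbelianOn.comp {A : Type} [Group A] {φ : H → A} (hφ : AbelianOn φ ⊤) (f : G →* H) :
    AbelianOn (fun g => φ (f g)) ⊤ :=
  ⟨fun g _ h _ => by rw [map_mul]; exact hφ.map_mul _ trivial _ trivial,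
    fun g _ h _ => hφ.comm _ trivial _ trivial⟩

theorem of_mulEquiv (hG : SplitsCentral G) (e : G ≃* H) : SplitsCentral H where
  exists_section E _ π hπ K hK hK' := by
    obtain ⟨s, hs⟩ := hG.exists_lift hπ hK hK' e.toMonoidHom
    exact ⟨s.comp e.symm.toMonoidHom, fun g => (hs _).trans (e.apply_symm_apply g)⟩
  perfect E _ φ hφ g := by
    have := hG.perfect E _ (hφ.comp e.toMonoidHom) (e.symm g)
    rwa [MulEquiv.toMonoidHom_eq_coe, MonoidHom.coe_coe, e.apply_symm_apply] at this

theorem commute_lift (hG : SplitsCentral G) {E Γ : Type} [Group E] [Group Γ] {π : E →* Γ}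
    (hπ : CentralSurjection π) (s : G →* E) {y : E} (hy : ∀ g, Commute (π (s g)) (π y)) (g : G) :
    Commute (s g) y := by
  set φ : G → E := fun g => s g * y * (s g)⁻¹ * y⁻¹ with hφ
  have cen : ∀ g h, Commute h (φ g) := fun g => hπ.central _ (by
    simp only [hφ, map_mul, map_inv]
    rw [(hy g).eq]; group)
  have hφ' : AbelianOn φ ⊤ := by
    refine ⟨fun g _ h _ => ?_, fun g _ h _ => cen h _⟩
    calc φ (g * h) = s g * φ h * (y * (s g)⁻¹ * y⁻¹) := by simp only [hφ, map_mul]; group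
      _ = φ h * φ g := by rw [(cen h (s g)).eq]; simp only [hφ]; group
      _ = φ g * φ h := ((cen h _).eq).symm
  have := hG.perfect E φ hφ' g
  exact mul_inv_eq_iff_eq_mul.1 (mul_inv_eq_one.1 this)

theorem prod (hG : SplitsCentral G) (hH : SplitsCentral H) : SplitsCentral (G × H) where
  exists_section E _ π hπ K hK hK' := by
    obtain ⟨s, hs⟩ := hG.exists_lift hπ hK hK' (MonoidHom.inl G H)
    obtain ⟨t, ht⟩ := hH.exists_lift hπ hK hK' (MonoidHom.inr G H)
    have comm : ∀ g h, Commute (s g) (t h) := fun g h =>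
      hG.commute_lift hπ s (fun g => by rw [hs, ht]; exact MonoidHom.commute_inl_inr g h) g
    refine ⟨s.noncommCoprod t comm, fun g => ?_⟩
    rw [MonoidHom.noncommCoprod_apply, map_mul, hs, ht]
    simp
  perfect E _ φ hφ g := by
    have h1 := hG.perfect E _ (hφ.comp (MonoidHom.inl G H)) g.1
    have h2 := hH.perfect E _ (hφ.comp (MonoidHom.inr G H)) g.2
    have : g = MonoidHom.inl G H g.1 * MonoidHom.inr G H g.2 := by simp
    rw [this, hφ.map_mul _ trivial _ trivial, h1, h2, one_mul]

end SplitsCentral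

section SymplecticProduct

variable {l R R₁ R₂ : Type*} [DecidableEq l] [Fintype l] [CommRing R] [CommRing R₁] [CommRing R₂]

/-- Functoriality of the symplectic group. -/
def symplecticMap (f : R →+* R₁) : symplecticGroup l R →* symplecticGroup l R₁ where
  toFun A := ⟨A.1.map f, SymplecticGroup.map_mem A.2 f⟩
  map_one' := Subtype.ext (by simp)
  map_mul' A B := Subtype.ext (by simp [Matrix.map_mul])

variable (l) in
/-- The symplectic group over a product of rings. -/
noncomputable def symplecticProd (e : R ≃+* R₁ × R₂) :
    symplecticGroup l R ≃* symplecticGroup l R₁ × symplecticGroup l R₂ := by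
  let f₁ : R →+* R₁ := (RingHom.fst R₁ R₂).comp e
  let f₂ : R →+* R₂ := (RingHom.snd R₁ R₂).comp e
  have inj : ∀ A B : Matrix (l ⊕ l) (l ⊕ l) R, A.map f₁ = B.map f₁ → A.map f₂ = B.map f₂ → A = B := by
    intro A B h1 h2
    ext i j
    exact e.injective (Prod.ext (congrFun₂ h1 i j) (congrFun₂ h2 i j))
  refine MulEquiv.ofBijective ((symplecticMap f₁).prod (symplecticMap f₂)) ⟨?_, ?_⟩
  · intro A B h
    have h' := Prod.ext_iff.1 h
    exact Subtype.ext (inj _ _ (congrArg Subtype.val h'.1) (congrArg Subtype.val h'.2))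
  · rintro ⟨A, B⟩
    let M : Matrix (l ⊕ l) (l ⊕ l) R := Matrix.of fun i j => e.symm (A.1 i j, B.1 i j)
    have h1 : M.map f₁ = A.1 := by ext i j; simp [M, f₁]
    have h2 : M.map f₂ = B.1 := by ext i j; simp [M, f₂]
    have hM : M ∈ symplecticGroup l R := by
      rw [SymplecticGroup.mem_iff]
      refine inj _ _ ?_ ?_
      · rw [Matrix.map_mul, Matrix.map_mul, Matrix.transpose_map, h1, map_J]
        exact SymplecticGroup.mem_iff.1 A.2
      · rw [Matrix.map_mul, Matrix.map_mul, Matrix.transpose_map, h2, map_J]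
        exact SymplecticGroup.mem_iff.1 B.2
    exact ⟨⟨M, hM⟩, Prod.ext (Subtype.ext h1) (Subtype.ext h2)⟩

end SymplecticProduct

theorem splitsCentral_prime_pow {g : ℕ} (hg : 3 ≤ g) {p k : ℕ} (hp : p.Prime) (hp2 : p ≠ 2)
    (hk : k ≠ 0) : SplitsCentral (symplecticGroup (Fin g) (ZMod (p ^ k))) := by
  have : Fact p.Prime := ⟨hp⟩
  have := oddChainRing_zmod (p := p) hp2 hk
  have T := threePairs_std (R := ZMod (p ^ k)) hg
  have hn := hasRank_tail (R := ZMod (p ^ k)) (g := g) g 0 (by omega)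
  have hn' := hasRank_tail (R := ZMod (p ^ k)) (g := g) (g - 1) 1 (by omega)
  rw [← tail_inf_perp (by omega)] at hn'
  rw [tail_zero] at hn hn'
  exact ⟨fun E _ π hπ K hK hK' => TransvectionSystem.exists_section hπ stdRep_injective
    (hp.odd_of_ne_two hp2).pow T hn' hn hK hK',
    fun E _ φ hφ => TransvectionSystem.eq_one_of_faithful stdRep_injective T hn hφ⟩

theorem splitsCentral_symplecticGroup {g : ℕ} (hg : 3 ≤ g) (N : ℕ) (hN : Odd N) :
    SplitsCentral (symplecticGroup (Fin g) (ZMod N)) := by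
  induction N using Nat.recOnPosPrimePosCoprime with
  | prime_pow p n hp hn =>
    refine splitsCentral_prime_pow hg hp ?_ hn.ne'
    rintro rfl
    exact (Nat.not_odd_iff_even.2 ((even_two).pow_of_ne_zero hn.ne')) hN
  | zero => simp at hN
  | one =>
    have : Subsingleton (symplecticGroup (Fin g) (ZMod 1)) :=
      ⟨fun A B => Subtype.ext (Subsingleton.elim _ _)⟩
    exact .of_subsingleton
  | coprime a b _ _ hab iha ihb =>
    rw [Nat.odd_mul] at hN
    exact ((iha hN.1).prod (ihb hN.2)).of_mulEquiv
      (symplecticProd (Fin g) (ZMod.chineseRemainder hab)).symm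

section Cohomology

variable {G C : Type} [Group G] [AddCommGroup C] {f : G × G → C}

/-- A 2-cocycle for the trivial action. -/
def IsTrivialCocycle (f : G × G → C) : Prop :=
  ∀ g h j, f (g * h, j) + f (g, h) = f (h, j) + f (g, h * j)

theorem IsTrivialCocycle.one_left (hf : IsTrivialCocycle f) (g : G) : f (1, g) = f (1, 1) := by
  have := hf 1 1 g
  simpa using this.symm

theorem IsTrivialCocycle.one_right (hf : IsTrivialCocycle f) (g : G) : f (g, 1) = f (1, 1) := by
  have := hf g 1 1
  simpa using this

/-- The central extension attached to a 2-cocycle. -/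
@[ext]
structure CocycleExtension (f : G × G → C) : Type where
  fst : C
  snd : G

/-- The group structure on the central extension attached to a 2-cocycle. -/
@[reducible]
def IsTrivialCocycle.group (hf : IsTrivialCocycle f) : Group (CocycleExtension f) :=
  letI : Mul (CocycleExtension f) := ⟨fun x y => ⟨x.1 + y.1 + f (x.2, y.2), x.2 * y.2⟩⟩
  letI : One (CocycleExtension f) := ⟨⟨-f (1, 1), 1⟩⟩
  letI : Inv (CocycleExtension f) := ⟨fun x => ⟨-x.1 - f (x.2⁻¹, x.2) - f (1, 1), x.2⁻¹⟩⟩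
  Group.ofLeftAxioms
    (fun x y z => by
      refine CocycleExtension.ext ?_ (mul_assoc _ _ _)
      change x.1 + y.1 + f (x.2, y.2) + z.1 + f (x.2 * y.2, z.2)
        = x.1 + (y.1 + z.1 + f (y.2, z.2)) + f (x.2, y.2 * z.2)
      calc _ = x.1 + y.1 + z.1 + (f (x.2 * y.2, z.2) + f (x.2, y.2)) := by abel
        _ = _ := by rw [hf]; abel)
    (fun x => by
      refine CocycleExtension.ext ?_ (one_mul _)
      change -f (1, 1) + x.1 + f (1, x.2) = x.1
      rw [hf.one_left x.2]; abel)
    (fun x => by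
      refine CocycleExtension.ext ?_ (inv_mul_cancel _)
      change -x.1 - f (x.2⁻¹, x.2) - f (1, 1) + x.1 + f (x.2⁻¹, x.2) = -f (1, 1)
      abel)

theorem IsTrivialCocycle.exists_coboundary [Finite C] (hG : SplitsCentral G)
    (hf : IsTrivialCocycle f) : ∃ x : G → C, ∀ g h, f (g, h) = x h - x (g * h) + x g := by
  let := hf.group
  let π : CocycleExtension f →* G :=
    { toFun := CocycleExtension.snd, map_one' := rfl, map_mul' := fun _ _ => rfl }
  have hπ : CentralSurjection π := by
    refine ⟨fun g => ⟨⟨0, g⟩, rfl⟩, fun k hk g => ?_⟩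
    replace hk : k.snd = 1 := hk
    refine CocycleExtension.ext ?_ ?_
    · change g.1 + k.1 + f (g.2, k.2) = k.1 + g.1 + f (k.2, g.2)
      rw [hk, hf.one_left, hf.one_right, add_comm g.1]
    · change g.2 * k.2 = k.2 * g.2
      rw [hk]; simp
  have : Finite π.ker := by
    refine Finite.of_injective (fun k : π.ker => k.1.fst) fun k k' h => ?_
    have hk : k.1.snd = 1 := k.2
    have hk' : k'.1.snd = 1 := k'.2
    exact Subtype.ext (CocycleExtension.ext h (hk.trans hk'.symm))
  obtain ⟨s, hs⟩ := hG.exists_section _ π hπ (Nat.card π.ker) Nat.card_pos.ne' fun k hk =>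
    congrArg Subtype.val (pow_card_eq_one' (x := (⟨k, hk⟩ : π.ker)))
  have hs' : ∀ g, (s g).snd = g := hs
  refine ⟨fun g => -(s g).fst, fun g h => ?_⟩
  have : (s (g * h)).fst = (s g).fst + (s h).fst + f ((s g).snd, (s h).snd) :=
    congrArg CocycleExtension.fst (map_mul s g h)
  rw [hs', hs'] at this
  simp only [this]; abel

theorem subsingleton_H2 [Finite C] (hG : SplitsCentral G) :
    Subsingleton (groupCohomology (Rep.trivial ℤ G C) 2) := by
  refine ⟨fun a b => ?_⟩
  have key : ∀ x : groupCohomology.H2 (Rep.trivial ℤ G C), x = 0 := by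
    intro x
    induction x using groupCohomology.H2_induction_on with
    | h x =>
      rw [groupCohomology.H2π_eq_zero_iff]
      have hx : IsTrivialCocycle (C := C) x.1 :=
        (groupCohomology.mem_cocycles₂_iff (A := Rep.trivial ℤ G C) x.1).1 x.2
      obtain ⟨y, hy⟩ := hx.exists_coboundary hG
      exact ⟨y, funext fun g => (hy g.1 g.2).symm⟩
  rw [key a, key b]

end Cohomology

end SpH2

/-- For every `g ≥ 3`, every odd `N ≥ 1` and every finite abelian group `C`
regarded as a trivial module over `G_N = Sp_{2g}(ℤ/Nℤ)`, the second group cohomology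
`H²(G_N, C)` vanishes. -/
theorem h2_symplecticGroup_finite_trivial_vanishes (g N : ℕ) (hg : 3 ≤ g) (hN : 1 ≤ N)
    (hNodd : Odd N) (C : Type) [AddCommGroup C] [Finite C] :
    Subsingleton
      (groupCohomology (Rep.trivial ℤ ↥(Matrix.symplecticGroup (Fin g) (ZMod N)) C) 2) :=
  SpH2.subsingleton_H2 (SpH2.splitsCentral_symplecticGroup hg N hNodd)
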